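/- Let x ∈ [0,1) and α ∈ [0,1) with (x,α) ≠ (0,0). Then for Lebesgue-almost every β ∈ (1,∞), the orbit of the coding sequence i^{α,β}(x) under the left shift σ on ℕ^ℕ equidistributes toward the pushforward measure (i^{α,β})_*μ_{α,β}; that is, for every bounded continuous function f : ℕ^ℕ → ℝ (with ℕ^ℕ carrying the product topology of the discrete topology on ℕ), lim_{n→∞} (1/n)·Σ_{m=0}^{n−1} f(σ^m(i^{α,β}(x))) = ∫ f d((i^{α,β})_*μ_{α,β}). -/

import Mathlib

open MeasureTheory Filter

/-- The map `x ↦ β·x + α mod 1` (fractional part of `β·x + α`). -/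
noncomputable def Tab (α β : ℝ) (x : ℝ) : ℝ := Int.fract (β * x + α)

/-- The coding sequence of `x` under `T_{α,β}`: `i^{α,β}_n(x) = ⌊β·T^n(x) + α⌋`. -/
noncomputable def code (α β : ℝ) (x : ℝ) : ℕ → ℕ :=
  fun n => (⌊β * (Tab α β)^[n] x + α⌋).toNat

/-- Unnormalized Parry density. -/
noncomputable def parryG (α β : ℝ) (x : ℝ) : ℝ :=
  ∑' n : ℕ, ((if x < (Tab α β)^[n] 1 then (1 : ℝ) else 0)
    - (if x < (Tab α β)^[n] 0 then (1 : ℝ) else 0)) / β ^ (n + 1)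

/-- Normalization constant. -/
noncomputable def parryN (α β : ℝ) : ℝ := ∫ x in Set.Icc (0 : ℝ) 1, parryG α β x

/-- The Parry measure `μ_{α,β}`, absolutely continuous w.r.t. Lebesgue on `[0,1]`. -/
noncomputable def parryMeasure (α β : ℝ) : Measure ℝ :=
  (volume.restrict (Set.Icc (0 : ℝ) 1)).withDensity
    (fun x => ENNReal.ofReal (parryG α β x / parryN α β))

/-- The orbit of `x` under `T` is `μ`-normal. -/
def IsNormalOrbit (T : ℝ → ℝ) (μ : Measure ℝ) (x : ℝ) : Prop :=
  ∀ f : ℝ → ℝ, ContinuousOn f (Set.Icc 0 1) →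
    Tendsto (fun n : ℕ => (n : ℝ)⁻¹ * ∑ m ∈ Finset.range n, f (T^[m] x)) atTop
      (nhds (∫ y, f y ∂μ))

/-- Left shift on `ℕ^ℕ`. -/
def shiftN (y : ℕ → ℕ) : ℕ → ℕ := fun n => y (n + 1)


section Helpers
open MeasureTheory Filter Set Topology
open scoped ENNReal NNReal


theorem Tab_mem (α β x : ℝ) : Tab α β x ∈ Ico (0:ℝ) 1 :=
  ⟨Int.fract_nonneg _, Int.fract_lt_one _⟩

theorem Tab_iter_mem {α β x : ℝ} (hx : x ∈ Ico (0:ℝ) 1) (n : ℕ) :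
    (Tab α β)^[n] x ∈ Ico (0:ℝ) 1 := by
  cases n with
  | zero => simpa using hx
  | succ n => rw [Function.iterate_succ_apply']; exact Tab_mem _ _ _

theorem Tab_iter_mem' {α β x : ℝ} (hx : x ∈ Icc (0:ℝ) 1) (n : ℕ) :
    (Tab α β)^[n] x ∈ Icc (0:ℝ) 1 := by
  cases n with
  | zero => simpa using hx
  | succ n => rw [Function.iterate_succ_apply']; exact Ico_subset_Icc_self (Tab_mem _ _ _)

theorem measurable_Tab (α β : ℝ) : Measurable (Tab α β) := by
  unfold Tab; exact measurable_fract.comp (by fun_prop)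

theorem measurable_Tab_iter (α β : ℝ) (n : ℕ) : Measurable ((Tab α β)^[n]) :=
  (measurable_Tab α β).iterate n

theorem measurable_code (α β : ℝ) : Measurable (code α β) := by
  rw [measurable_pi_iff]
  intro n
  unfold code
  have h1 : Measurable (fun x => ⌊β * (Tab α β)^[n] x + α⌋) :=
    Int.measurable_floor.comp (((measurable_Tab_iter α β n).const_mul β).add_const α)
  exact (measurable_from_top (f := Int.toNat)).comp h1

theorem code_Tab (α β x : ℝ) : code α β (Tab α β x) = shiftN (code α β x) := by
  funext n; simp [code, shiftN, Function.iterate_succ_apply]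

theorem shift_iter_code (α β x : ℝ) (m : ℕ) :
    shiftN^[m] (code α β x) = code α β ((Tab α β)^[m] x) := by
  induction m with
  | zero => rfl
  | succ m ih => rw [Function.iterate_succ_apply', Function.iterate_succ_apply', ih, code_Tab]

/-- one step relation with digit -/
theorem Tab_succ_eq {α β x : ℝ} (hα : 0 ≤ α) (hβ : 0 ≤ β) (hx : 0 ≤ x) (n : ℕ) :
    (Tab α β)^[n+1] x = β * (Tab α β)^[n] x + α - (code α β x n : ℝ) := by
  have h0 : 0 ≤ (Tab α β)^[n] x := by
    cases n with
    | zero => simpa using hx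
    | succ n => rw [Function.iterate_succ_apply']; exact (Tab_mem _ _ _).1
  have h1 : 0 ≤ ⌊β * (Tab α β)^[n] x + α⌋ := Int.floor_nonneg.2 (by positivity)
  have h2 : ((code α β x n : ℕ) : ℝ) = (⌊β * (Tab α β)^[n] x + α⌋ : ℝ) := by
    unfold code
    have := Int.toNat_of_nonneg h1
    exact_mod_cast this
  rw [h2, Function.iterate_succ_apply']
  unfold Tab
  rw [Int.fract]

def GoodM (α β : ℝ) (m : Measure ℝ) : Prop :=
  IsProbabilityMeasure m ∧ MeasurePreserving (Tab α β) m m ∧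
    ∃ C : ℝ, 0 ≤ C ∧ ∀ E, MeasurableSet E → volume E ≠ ⊤ → m.real E ≤ C * √(volume.real E)


/-- affine preimage null sets -/
theorem null_of_affine {b c : ℝ} (hb : b ≠ 0) {S S' : Set ℝ} (h : volume S = 0)
    (hs : ∀ t ∈ S', b * t + c ∈ S) : volume S' = 0 := by
  have h1 : S' ⊆ (fun t => b * t) ⁻¹' ((fun t => t + c) ⁻¹' S) := fun t ht => hs t ht
  refine measure_mono_null h1 ?_
  rw [Real.volume_preimage_mul_left hb, measure_preimage_add_right, h, mul_zero]

theorem grow_step {α β : ℝ} (hβ : 1 < β) {A : Set ℝ} (hA : Tab α β ⁻¹' A = A) {p q : ℝ}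
    (hpq : p < q) (h : volume (Ioo p q \ A) = 0) :
    (∃ ε > 0, volume (Ioo 0 ε \ A) = 0) ∨
    (∃ p' q', 0 ≤ p' ∧ q' ≤ 1 ∧ q' - p' = β * (q - p) ∧ volume (Ioo p' q' \ A) = 0) := by
  have hβ0 : (0:ℝ) < β := by linarith
  have key : ∀ (j : ℤ) (t : ℝ), t ∈ Ico (0:ℝ) 1 → β⁻¹ * t + (j - α) / β ∈ A → t ∈ A := by
    intro j t ht h1
    rw [← hA] at h1
    have : Tab α β (β⁻¹ * t + (j - α) / β) = t := by
      unfold Tab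
      have e : β * (β⁻¹ * t + (j - α) / β) + α = t + j := by field_simp; ring
      rw [e, Int.fract_add_intCast, Int.fract_eq_self.2 ht]
    simpa [this] using h1
  set j : ℤ := ⌊β * p + α⌋ + 1 with hj
  have hjp : β * p + α < j := by rw [hj]; push_cast; exact Int.lt_floor_add_one _
  have hjp' : (j:ℝ) - 1 ≤ β * p + α := by rw [hj]; push_cast; simpa using Int.floor_le _
  by_cases hc : (j:ℝ) < β * q + α
  · left
    refine ⟨min (β * q + α - j) 1, by apply lt_min <;> linarith, ?_⟩
    refine null_of_affine (b := β⁻¹) (c := (j - α) / β) (by positivity) h ?_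
    rintro t ⟨⟨h0, h1⟩, h2⟩
    have h3 := lt_min_iff.1 h1
    refine ⟨⟨?_, ?_⟩, fun h4 => h2 (key j t ⟨h0.le, h3.2⟩ h4)⟩
    · rw [← mul_lt_mul_iff_right₀ hβ0]
      field_simp; linarith
    · rw [← mul_lt_mul_iff_right₀ hβ0]
      field_simp; linarith
  · right
    push Not at hc
    refine ⟨β * p + α - (j - 1), β * q + α - (j - 1), by linarith, by linarith, by ring, ?_⟩
    refine null_of_affine (b := β⁻¹) (c := ((j - 1 : ℤ) - α) / β) (by positivity) h ?_
    rintro t ⟨⟨h0, h1⟩, h2⟩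
    refine ⟨⟨?_, ?_⟩, fun h4 => h2 (key (j-1) t ⟨by linarith, by linarith⟩ h4)⟩
    · rw [← mul_lt_mul_iff_right₀ hβ0]
      push_cast; field_simp; linarith
    · rw [← mul_lt_mul_iff_right₀ hβ0]
      push_cast; field_simp; linarith

theorem grow_interval {α β : ℝ} (hβ : 1 < β) {A : Set ℝ} (hA : Tab α β ⁻¹' A = A) {p q : ℝ}
    (hpq : p < q) (h : volume (Ioo p q \ A) = 0) :
    ∃ ε > 0, volume (Ioo 0 ε \ A) = 0 := by
  by_contra hcon
  have : ∀ n : ℕ, ∃ p' q', 0 ≤ p' ∧ q' ≤ 1 ∧ q' - p' = β ^ (n+1) * (q - p) ∧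
      volume (Ioo p' q' \ A) = 0 := by
    intro n
    induction n with
    | zero =>
      rcases grow_step hβ hA hpq h with h1 | h1
      · exact absurd h1 hcon
      · simpa using h1
    | succ n ih =>
      obtain ⟨p', q', h1, h2, h3, h4⟩ := ih
      have : p' < q' := by
        have : 0 < β ^ (n+1) * (q - p) := mul_pos (by positivity) (by linarith)
        linarith
      rcases grow_step hβ hA this h4 with h5 | ⟨p'', q'', a1, a2, a3, a4⟩
      · exact absurd h5 hcon
      · exact ⟨p'', q'', a1, a2, by rw [a3, h3]; ring, a4⟩
  obtain ⟨n, hn⟩ := pow_unbounded_of_one_lt (1 / (q - p)) hβ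
  obtain ⟨p', q', h1, h2, h3, -⟩ := this n
  have hq : 0 < q - p := by linarith
  rw [div_lt_iff₀ hq] at hn
  have : β ^ n * (q - p) ≤ β ^ (n+1) * (q - p) := by
    gcongr
    · exact hβ.le
    · omega
  linarith

/-- affine along good orbits -/
theorem affine_orbit {α β r z : ℝ} (hβ : 1 < β) {n : ℕ}
    (hg : ∀ k, k < n → (Tab α β)^[k+1] z ∈ Icc (r / β ^ (n - (k+1))) (1 - r / β ^ (n - (k+1))))
    {t : ℝ} (ht : |t| < r / β ^ n) (k : ℕ) (hk : k ≤ n) :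
    (Tab α β)^[k] (z + t) = (Tab α β)^[k] z + β ^ k * t := by
  have hβ0 : (0:ℝ) < β := by linarith
  induction k with
  | zero => simp
  | succ k ih =>
    have hk' : k < n := hk
    have ih := ih hk'.le
    have h1 := hg k hk'
    rw [Function.iterate_succ_apply', ih]
    rw [Function.iterate_succ_apply'] at h1 ⊢
    set y := (Tab α β)^[k] z
    have hb : |β ^ (k+1) * t| < r / β ^ (n - (k+1)) := by
      rw [abs_mul, abs_of_pos (by positivity : (0:ℝ) < β ^ (k+1))]
      calc β ^ (k+1) * |t| < β ^ (k+1) * (r / β ^ n) := by gcongr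
        _ = r / β ^ (n - (k+1)) := by
          rw [pow_sub₀ _ hβ0.ne' hk]; field_simp
    have hb' := abs_lt.1 hb
    have e : β * (y + β ^ k * t) + α = (Tab α β y + β ^ (k+1) * t) + (⌊β * y + α⌋ : ℤ) := by
      unfold Tab; rw [Int.fract]; ring
    conv_lhs => unfold Tab
    rw [e, Int.fract_add_intCast, Int.fract_eq_self.2]
    exact ⟨by linarith [h1.1], by linarith [h1.2]⟩


theorem sqrt_pow' {x : ℝ} (hx : 0 ≤ x) (n : ℕ) : √(x ^ n) = √x ^ n := by
  rw [Real.sqrt_eq_iff_mul_self_eq (by positivity) (by positivity), ← mul_pow, Real.mul_self_sqrt hx]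

theorem GoodM.ac {α β : ℝ} {m : Measure ℝ} (h : GoodM α β m) : m ≪ volume := by
  obtain ⟨h1, -, C, hC, h3⟩ := h
  refine Measure.AbsolutelyContinuous.mk fun E hE h0 => ?_
  have := h3 E hE (by simp [h0])
  rw [measureReal_def, measureReal_def, h0] at this
  simp only [ENNReal.toReal_zero, Real.sqrt_zero, mul_zero] at this
  have h4 : (m E).toReal = 0 := le_antisymm this ENNReal.toReal_nonneg
  rcases (ENNReal.toReal_eq_zero_iff _).1 h4 with h | h
  · exact h
  · exact absurd h (measure_ne_top _ _)

theorem exists_density_point {m : Measure ℝ} [IsProbabilityMeasure m] (hm : m ≪ volume)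
    {A : Set ℝ} (hA : MeasurableSet A) {G : ℕ → Set ℝ} (hG : ∀ n, MeasurableSet (G n)) {a : ℝ}
    (ha : 0 < a) (h : ∀ n, a ≤ m.real (A ∩ G n)) :
    ∃ z, (∃ᶠ n in atTop, z ∈ G n) ∧
      Tendsto (fun r => volume (A ∩ Metric.closedBall z r) / volume (Metric.closedBall z r))
        (𝓝[>] 0) (𝓝 1) := by
  set S : ℕ → Set ℝ := fun N => ⋃ n ≥ N, (A ∩ G n) with hS
  have hSm : ∀ N, MeasurableSet (S N) := fun N =>
    MeasurableSet.iUnion fun n => MeasurableSet.iUnion fun _ => hA.inter (hG n)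
  have hanti : Antitone S := by
    intro i j hij x hx
    simp only [hS, mem_iUnion] at hx ⊢
    obtain ⟨n, hn, hx⟩ := hx
    exact ⟨n, le_trans hij hn, hx⟩
  have ht := tendsto_measure_iInter_atTop (μ := m) (fun N => (hSm N).nullMeasurableSet) hanti
    ⟨0, measure_ne_top _ _⟩
  have hle : ENNReal.ofReal a ≤ m (⋂ N, S N) := by
    refine ge_of_tendsto' ht fun N => ?_
    change ENNReal.ofReal a ≤ m (S N)
    rw [ENNReal.ofReal_le_iff_le_toReal (measure_ne_top _ _)]
    refine (h N).trans ?_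
    exact measureReal_mono (fun x hx => by
      simp only [hS, mem_iUnion]; exact ⟨N, le_refl _, hx⟩) (measure_ne_top _ _)
  have hpos : m (⋂ N, S N) ≠ 0 := by
    intro h0
    rw [h0] at hle
    simp at hle; linarith
  have hae := hm.ae_le (Besicovitch.ae_tendsto_measure_inter_div_of_measurableSet volume hA)
  obtain ⟨z, hz1, hz2⟩ : ∃ z, z ∈ (⋂ N, S N) ∧ _ :=
    (Frequently.and_eventually (frequently_ae_mem_iff.2 hpos) hae).exists
  simp only [hS, mem_iInter, mem_iUnion] at hz1
  have hzA : z ∈ A := by obtain ⟨n, -, h⟩ := hz1 0; exact h.1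
  refine ⟨z, ?_, by simpa [hzA] using hz2⟩
  rw [frequently_atTop]
  intro N
  obtain ⟨n, hn, h⟩ := hz1 N
  exact ⟨n, hn, h.2⟩

theorem transport_ball {α β r z : ℝ} (hβ : 1 < β) (hr : 0 < r) {A : Set ℝ}
    (hA : Tab α β ⁻¹' A = A) {n : ℕ}
    (hg : ∀ k, k < n → (Tab α β)^[k+1] z ∈ Icc (r / β ^ (n - (k+1))) (1 - r / β ^ (n - (k+1)))) :
    volume (Metric.closedBall ((Tab α β)^[n] z) (r/2) \ A) ≤
      ENNReal.ofReal (β ^ n) * volume (Metric.closedBall z (r / 2 / β ^ n) \ A) := by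
  have hβ0 : (0:ℝ) < β := by linarith
  have hbn : 0 < β ^ n := by positivity
  have hAn : (Tab α β)^[n] ⁻¹' A = A := by
    have : ∀ n, (Tab α β)^[n] ⁻¹' A = A := by
      intro n
      induction n with
      | zero => rfl
      | succ n ih => rw [Function.iterate_succ, preimage_comp, ih, hA]
    exact this n
  set y := (Tab α β)^[n] z with hy
  have hsub : Metric.closedBall y (r/2) \ A ⊆ (fun u => (β ^ n)⁻¹ * u) ⁻¹'
      ((fun v => v + (z - (β ^ n)⁻¹ * y)) ⁻¹' (Metric.closedBall z (r / 2 / β ^ n) \ A)) := by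
    rintro u ⟨hu, huA⟩
    simp only [mem_preimage, Set.mem_sdiff, Metric.mem_closedBall, Real.dist_eq] at hu ⊢
    set t := (β ^ n)⁻¹ * (u - y) with ht
    have e : (β ^ n)⁻¹ * u + (z - (β ^ n)⁻¹ * y) = z + t := by rw [ht]; ring
    have htb : |t| ≤ r / 2 / β ^ n := by
      rw [ht, abs_mul, abs_of_pos (by positivity), inv_mul_eq_div]
      gcongr
    rw [e]
    refine ⟨by simpa using htb, fun hc => huA ?_⟩
    rw [← hAn] at hc
    have := affine_orbit hβ hg (t := t) (lt_of_le_of_lt htb (by gcongr; linarith)) n le_rfl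
    simp only [mem_preimage] at hc
    rw [this, ← hy] at hc
    have e2 : y + β ^ n * t = u := by rw [ht]; field_simp; ring
    rwa [e2] at hc
  refine (measure_mono hsub).trans ?_
  rw [Real.volume_preimage_mul_left (by positivity), measure_preimage_add_right, inv_inv,
    abs_of_pos hbn]

theorem near_zero {α β : ℝ} (hβ : 1 < β) {m : Measure ℝ} (hm : GoodM α β m) {A : Set ℝ}
    (hAm : MeasurableSet A) (hA : Tab α β ⁻¹' A = A) (hmA : m A ≠ 0) :
    ∃ ε > 0, volume (Ioo 0 ε \ A) = 0 := by
  have hac := hm.ac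
  obtain ⟨hP, hinv, C, hC, hE⟩ := hm
  have hβ0 : (0:ℝ) < β := by linarith
  set a := m.real A with ha
  have hapos : 0 < a := ENNReal.toReal_pos hmA (measure_ne_top _ _)
  set ρ := √(β⁻¹) with hρ
  have hρ0 : 0 ≤ ρ := Real.sqrt_nonneg _
  have hρ1 : ρ < 1 := by
    rw [hρ, Real.sqrt_lt' one_pos]; simpa using inv_lt_one_of_one_lt₀ hβ
  obtain ⟨r, hr0, hr⟩ : ∃ r : ℝ, 0 < r ∧ C * √(2 * r) / (1 - ρ) < a / 2 := by
    have hc : Continuous (fun r : ℝ => C * √(2 * r) / (1 - ρ)) := by fun_prop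
    have h1 : ∀ᶠ r in 𝓝 (0:ℝ), C * √(2 * r) / (1 - ρ) < a / 2 := by
      apply hc.continuousAt.eventually_lt_const
      simp; positivity
    have h2 := (h1.filter_mono (nhdsWithin_le_nhds (s := Ioi 0))).and self_mem_nhdsWithin
    obtain ⟨r, h3, h4⟩ := h2.exists
    exact ⟨r, h4, h3⟩
  set E : ℝ → Set ℝ := fun s => Ico 0 s ∪ Ioo (1 - s) 1 with hEd
  have hEmeas : ∀ s, MeasurableSet (E s) := fun s => measurableSet_Ico.union measurableSet_Ioo
  have hEm : ∀ s, 0 ≤ s → m.real (E s) ≤ C * √(2 * s) := by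
    intro s hs
    have hv : volume (E s) ≤ ENNReal.ofReal (2 * s) := by
      refine (measure_union_le _ _).trans ?_
      rw [Real.volume_Ico, Real.volume_Ioo, ← ENNReal.ofReal_add (by linarith) (by linarith)]
      apply ENNReal.ofReal_le_ofReal; linarith
    refine (hE _ (hEmeas s) (ne_top_of_le_ne_top ENNReal.ofReal_ne_top hv)).trans ?_
    gcongr
    exact ENNReal.toReal_le_of_le_ofReal (by linarith) hv
  set G : ℕ → Set ℝ := fun n => {z | ∀ k, k < n →
    (Tab α β)^[k+1] z ∈ Icc (r / β ^ (n - (k+1))) (1 - r / β ^ (n - (k+1)))} with hG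
  have hGm : ∀ n, MeasurableSet (G n) := by
    intro n
    have : G n = ⋂ k, ⋂ (_ : k < n), (Tab α β)^[k+1] ⁻¹'
        Icc (r / β ^ (n - (k+1))) (1 - r / β ^ (n - (k+1))) := by
      ext z; simp [hG]
    rw [this]
    exact MeasurableSet.iInter fun k => MeasurableSet.iInter fun _ =>
      measurable_Tab_iter α β (k+1) measurableSet_Icc
  have hGc : ∀ n, m.real (G n)ᶜ ≤ a / 2 := by
    intro n
    have hsub : (G n)ᶜ ⊆ ⋃ k ∈ Finset.range n, (Tab α β)^[k+1] ⁻¹' E (r / β ^ (n - (k+1))) := by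
      intro z hz
      simp only [hG, mem_compl_iff, mem_ofPred_eq, not_forall] at hz
      obtain ⟨k, hk, hz⟩ := hz
      simp only [mem_iUnion, Finset.mem_range]
      refine ⟨k, hk, ?_⟩
      have hI : (Tab α β)^[k+1] z ∈ Ico (0:ℝ) 1 := by
        rw [Function.iterate_succ_apply']; exact Tab_mem _ _ _
      simp only [mem_Icc, not_and_or, not_le] at hz
      rcases hz with hz | hz
      · exact Or.inl ⟨hI.1, hz⟩
      · exact Or.inr ⟨hz, hI.2⟩
    calc m.real (G n)ᶜ ≤ m.real (⋃ k ∈ Finset.range n, (Tab α β)^[k+1] ⁻¹' E (r / β ^ (n - (k+1)))) :=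
          measureReal_mono hsub (measure_ne_top _ _)
      _ ≤ ∑ k ∈ Finset.range n, m.real ((Tab α β)^[k+1] ⁻¹' E (r / β ^ (n - (k+1)))) :=
          measureReal_biUnion_finset_le _ _
      _ = ∑ k ∈ Finset.range n, m.real (E (r / β ^ (n - (k+1)))) := by
          refine Finset.sum_congr rfl fun k _ => ?_
          rw [measureReal_def, measureReal_def, (hinv.iterate (k+1)).measure_preimage
            (hEmeas _).nullMeasurableSet]
      _ ≤ ∑ k ∈ Finset.range n, C * √(2 * r) * ρ ^ (n - 1 - k) := by
          refine Finset.sum_le_sum fun k _ => (hEm _ (by positivity)).trans_eq ?_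
          have : 2 * (r / β ^ (n - (k+1))) = 2 * r * (β⁻¹) ^ (n - 1 - k) := by
            rw [show n - (k+1) = n - 1 - k by omega, inv_pow]; ring
          rw [this, Real.sqrt_mul (by linarith), hρ, mul_assoc, sqrt_pow' (by positivity)]
      _ = ∑ k ∈ Finset.range n, C * √(2 * r) * ρ ^ k :=
          Finset.sum_range_reflect (fun k => C * √(2 * r) * ρ ^ k) n
      _ = C * √(2 * r) * ∑ k ∈ Finset.range n, ρ ^ k := by rw [Finset.mul_sum]
      _ ≤ C * √(2 * r) * (1 - ρ)⁻¹ := by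
          gcongr
          rw [← tsum_geometric_of_lt_one hρ0 hρ1]
          exact (summable_geometric_of_lt_one hρ0 hρ1).sum_le_tsum _ (fun _ _ => by positivity)
      _ ≤ a / 2 := by rw [← div_eq_mul_inv]; exact hr.le
  obtain ⟨z, hzf, hzd⟩ := exists_density_point hac hAm hGm (a := a / 2) (by linarith) (fun n => by
    have h1 : m.real A ≤ m.real (A ∩ G n) + m.real (G n)ᶜ := by
      refine (measureReal_mono (?_ : A ⊆ (A ∩ G n) ∪ (G n)ᶜ)).trans (measureReal_union_le _ _)
      intro x hx
      by_cases h : x ∈ G n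
      · exact Or.inl ⟨hx, h⟩
      · exact Or.inr h
    linarith [hGc n])
  obtain ⟨φ, hφ, hφG⟩ := extraction_of_frequently_atTop (hzf.and_eventually (eventually_ge_atTop 1))
  obtain ⟨y, hy, ψ, hψ, hlim⟩ := (isCompact_Icc (a := (0:ℝ)) (b := 1)).tendsto_subseq
    (x := fun i => (Tab α β)^[φ i] z) (fun i => by
      obtain ⟨k, hk⟩ : ∃ k, φ i = k + 1 := ⟨φ i - 1, by have := (hφG i).2; omega⟩
      simp only [hk]
      rw [Function.iterate_succ_apply']
      exact Ico_subset_Icc_self (Tab_mem _ _ _))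
  refine grow_interval hβ hA (p := y - r / 4) (q := y + r / 4) (by linarith) ?_
  -- the ratio tends to 0
  set θ : ℕ → ℕ := φ ∘ ψ with hθ
  have hθt : Tendsto θ atTop atTop := (hφ.comp hψ).tendsto_atTop
  have hrad : Tendsto (fun n : ℕ => r / 2 / β ^ n) atTop (𝓝[>] 0) := by
    rw [tendsto_nhdsWithin_iff]
    refine ⟨?_, Eventually.of_forall fun n => by simp only [mem_Ioi]; positivity⟩
    exact tendsto_const_nhds.div_atTop (tendsto_pow_atTop_atTop_of_one_lt hβ)
  have h1 := (hzd.comp hrad).comp hθt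
  have hb : ∀ n : ℕ, ENNReal.ofReal (β ^ n) * volume (Metric.closedBall z (r / 2 / β ^ n) \ A)
      = ENNReal.ofReal r * (1 - volume (A ∩ Metric.closedBall z (r / 2 / β ^ n)) /
          volume (Metric.closedBall z (r / 2 / β ^ n))) := by
    intro n
    have hbn : 0 < β ^ n := by positivity
    set B := Metric.closedBall z (r / 2 / β ^ n) with hB
    have hvB : volume B = ENNReal.ofReal (r / β ^ n) := by
      rw [hB, Real.volume_closedBall]; congr 1; ring
    have hv0 : volume B ≠ 0 := by rw [hvB]; simp; positivity
    have hvt : volume B ≠ ⊤ := by rw [hvB]; exact ENNReal.ofReal_ne_top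
    have h2 : volume (B \ A) = volume B - volume (A ∩ B) := by
      have := measure_inter_add_sdiff (μ := volume) B hAm
      rw [inter_comm] at this
      refine ENNReal.eq_sub_of_add_eq (ne_top_of_le_ne_top hvt (measure_mono inter_subset_right)) ?_
      rw [add_comm]; exact this
    rw [h2]
    have h3 : ENNReal.ofReal r = ENNReal.ofReal (β ^ n) * volume B := by
      rw [hvB, ← ENNReal.ofReal_mul hbn.le]; congr 1; field_simp
    rw [h3, mul_assoc, ENNReal.mul_sub (fun _ _ => hvt), mul_one, ENNReal.mul_div_cancel hv0 hvt]
  have h2 : Tendsto (fun i => ENNReal.ofReal r * (1 - volume (A ∩ Metric.closedBall z (r / 2 / β ^ (θ i))) /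
          volume (Metric.closedBall z (r / 2 / β ^ (θ i))))) atTop (𝓝 (ENNReal.ofReal r * (1 - 1))) := by
    refine ENNReal.Tendsto.const_mul ?_ (Or.inr ENNReal.ofReal_ne_top)
    exact ENNReal.Tendsto.sub tendsto_const_nhds h1 (Or.inl ENNReal.one_ne_top)
  simp only [tsub_self, mul_zero] at h2
  have h3 : ∀ᶠ i in atTop, volume (Ioo (y - r/4) (y + r/4) \ A) ≤ ENNReal.ofReal r * (1 - volume (A ∩ Metric.closedBall z (r / 2 / β ^ (θ i))) /
          volume (Metric.closedBall z (r / 2 / β ^ (θ i)))) := by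
    filter_upwards [hlim.eventually (Metric.ball_mem_nhds y (show 0 < r / 4 by linarith))] with i hi
    rw [← hb]
    refine le_trans (measure_mono ?_) (transport_ball hβ hr0 hA (hφG (ψ i)).1)
    apply sdiff_subset_sdiff_left
    intro u hu
    change |(Tab α β)^[φ (ψ i)] z - y| < r / 4 at hi
    change |u - (Tab α β)^[φ (ψ i)] z| ≤ r / 2
    rw [abs_le]
    have := abs_lt.1 hi
    constructor <;> linarith [hu.1, hu.2, this.1, this.2]
  exact le_antisymm (ge_of_tendsto h2 h3) (zero_le)

theorem GoodM.ergodic {α β : ℝ} (hβ : 1 < β) {m : Measure ℝ} (hm : GoodM α β m) :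
    Ergodic (Tab α β) m := by
  refine { hm.2.1 with aeconst_set := fun A hAm hA => ?_ }
  rw [eventuallyConst_set']
  by_contra hcon
  push Not at hcon
  have h1 : m A ≠ 0 := fun h => hcon.1 (ae_eq_empty.2 h)
  have h2 : m Aᶜ ≠ 0 := fun h => hcon.2 (ae_eq_univ.2 h)
  obtain ⟨ε, hε, hv⟩ := near_zero hβ hm hAm hA h1
  obtain ⟨ε', hε', hv'⟩ := near_zero hβ hm hAm.compl (by rw [preimage_compl, hA]) h2
  have : volume (Ioo 0 (min ε ε')) = 0 := by
    refine measure_mono_null (?_ : _ ⊆ (Ioo 0 ε \ A) ∪ (Ioo 0 ε' \ Aᶜ)) (measure_union_null hv hv')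
    intro u hu
    have := lt_min_iff.1 hu.2
    by_cases h : u ∈ A
    · exact Or.inr ⟨⟨hu.1, this.2⟩, by simpa using h⟩
    · exact Or.inl ⟨⟨hu.1, this.1⟩, h⟩
  rw [Real.volume_Ioo] at this
  simp at this
  rcases this with h | h <;> linarith

theorem GoodM.unique {α β : ℝ} (hβ : 1 < β) {m m' : Measure ℝ} (hm : GoodM α β m)
    (hm' : GoodM α β m') : m = m' := by
  have hP := hm.1
  have hP' := hm'.1
  set M : Measure ℝ := (2⁻¹ : ℝ≥0∞) • (m + m') with hM
  have hMg : GoodM α β M := by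
    obtain ⟨_, h2, C, hC, h3⟩ := hm
    obtain ⟨_, h2', C', hC', h3'⟩ := hm'
    refine ⟨⟨?_⟩, ⟨measurable_Tab α β, ?_⟩, C + C', by positivity, fun E hE hv => ?_⟩
    · simp [hM]
      exact ENNReal.inv_two_add_inv_two
    · rw [hM, Measure.map_smul, Measure.map_add _ _ (measurable_Tab α β), h2.map_eq, h2'.map_eq]
    · have e : M.real E = 2⁻¹ * (m.real E + m'.real E) := by
        rw [hM, measureReal_ennreal_smul_apply, measureReal_add_apply]; simp
      rw [e]
      have := h3 E hE hv
      have := h3' E hE hv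
      have h0 : 0 ≤ √(volume.real E) := Real.sqrt_nonneg _
      have a1 : 0 ≤ m.real E := measureReal_nonneg
      have a2 : 0 ≤ m'.real E := measureReal_nonneg
      linarith
  have hMP := hMg.1
  have he := hMg.ergodic hβ
  have hle : m ≪ M := by
    refine Measure.AbsolutelyContinuous.mk fun E _ h0 => ?_
    simp [hM] at h0; exact h0.1
  have hle' : m' ≪ M := by
    refine Measure.AbsolutelyContinuous.mk fun E _ h0 => ?_
    simp [hM] at h0; exact h0.2
  rw [he.eq_of_absolutelyContinuous hm.2.1 hle, he.eq_of_absolutelyContinuous hm'.2.1 hle']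


theorem int_fract_base {y s : ℝ} (hy : 0 ≤ y) (hs : s ∈ Icc (0:ℝ) 1) :
    ∫ u in (0:ℝ)..s, (if Int.fract u ≤ y then (1:ℝ) else 0) = min s y := by
  rw [intervalIntegral.integral_of_le hs.1, integral_Ioc_eq_integral_Ioo]
  have h1 : ∫ u in Ioo 0 s, (if Int.fract u ≤ y then (1:ℝ) else 0)
      = ∫ u in Ioo 0 s, (Iic y).indicator (fun _ => (1:ℝ)) u := by
    refine setIntegral_congr_fun measurableSet_Ioo fun u hu => ?_
    have : Int.fract u = u := Int.fract_eq_self.2 ⟨hu.1.le, hu.2.trans_le hs.2⟩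
    simp only [this, indicator, mem_Iic]
  rw [h1, setIntegral_indicator measurableSet_Iic, setIntegral_const, smul_eq_mul, mul_one]
  rcases le_or_gt s y with h | h
  · have : Ioo 0 s ∩ Iic y = Ioo 0 s := by
      ext u; simp only [mem_inter_iff, mem_Ioo, mem_Iic]; constructor
      · exact fun h => h.1
      · exact fun h' => ⟨h', by linarith [h'.2]⟩
    rw [this, min_eq_left h]; simp [hs.1]
  · have : Ioo 0 s ∩ Iic y = Ioc 0 y := by
      ext u; simp only [mem_inter_iff, mem_Ioo, mem_Iic, mem_Ioc]; constructor
      · exact fun h => ⟨h.1.1, h.2⟩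
      · exact fun h' => ⟨⟨h'.1, by linarith [h'.2]⟩, h'.2⟩
    rw [this, min_eq_right h.le]; simp [hy]

theorem fract_ite_intervalIntegrable (y a b : ℝ) :
    IntervalIntegrable (fun u => (if Int.fract u ≤ y then (1:ℝ) else 0)) volume a b := by
  have : (fun u : ℝ => (if Int.fract u ≤ y then (1:ℝ) else 0)) =
      (Int.fract ⁻¹' (Iic y)).indicator (fun _ => (1:ℝ)) := by
    ext u; simp [indicator]
  rw [this, intervalIntegrable_iff]
  refine Integrable.indicator ?_ (measurable_fract measurableSet_Iic)
  haveI : IsFiniteMeasure (volume.restrict (uIoc a b)) := ⟨by simp [uIoc]⟩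
  exact integrable_const _

theorem int_fract_nat {y : ℝ} (hy : y ∈ Icc (0:ℝ) 1) (n : ℕ) : ∀ {s : ℝ}, s ∈ Icc (0:ℝ) 1 →
    ∫ u in (0:ℝ)..(n + s), (if Int.fract u ≤ y then (1:ℝ) else 0) = n * y + min s y := by
  induction n with
  | zero => intro s hs; simpa using int_fract_base hy.1 hs
  | succ n ih =>
    intro s hs
    have h1 := ih (s := 1) ⟨by norm_num, le_rfl⟩
    rw [min_eq_right hy.2] at h1
    have h2 : ∫ u in ((n:ℝ)+1)..(((n+1:ℕ):ℝ) + s), (if Int.fract u ≤ y then (1:ℝ) else 0) = min s y := by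
      rw [← int_fract_base hy.1 hs]
      have := intervalIntegral.integral_comp_add_right (a := 0) (b := s)
        (fun u => (if Int.fract u ≤ y then (1:ℝ) else 0)) ((n:ℝ)+1)
      have e : (n:ℝ) + 1 = ((n+1 : ℕ) : ℝ) := by push_cast; ring
      rw [zero_add, add_comm s] at this
      rw [e] at this ⊢
      rw [← this]
      simp only [Int.fract_add_natCast]
    rw [← intervalIntegral.integral_add_adjacent_intervals (b := (n:ℝ)+1)
      (fract_ite_intervalIntegrable _ _ _) (fract_ite_intervalIntegrable _ _ _), h1, h2]
    push_cast; ring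

theorem int_fract {y : ℝ} (hy : y ∈ Icc (0:ℝ) 1) {t : ℝ} (ht : 0 ≤ t) :
    ∫ u in (0:ℝ)..t, (if Int.fract u ≤ y then (1:ℝ) else 0) = ⌊t⌋ * y + min (Int.fract t) y := by
  have h1 : 0 ≤ ⌊t⌋ := Int.floor_nonneg.2 ht
  have h2 : (⌊t⌋ : ℝ) = ((⌊t⌋.toNat : ℕ) : ℝ) := by
    have := Int.toNat_of_nonneg h1
    exact_mod_cast this.symm
  have := int_fract_nat hy ⌊t⌋.toNat (s := Int.fract t) ⟨Int.fract_nonneg _, (Int.fract_lt_one _).le⟩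
  rw [← h2, Int.floor_add_fract] at this
  exact this

theorem K_eq {α β y c : ℝ} (hα : α ∈ Ico (0:ℝ) 1) (hβ : 1 < β) (hy : y ∈ Icc (0:ℝ) 1)
    (hc : c ∈ Icc (0:ℝ) 1) :
    ∫ u in Icc (0:ℝ) 1, (if Tab α β u ≤ y then (1:ℝ) else 0) * (if u < c then 1 else 0) =
      β⁻¹ * (⌊β * c + α⌋ * y + min (Tab α β c) y - min α y) := by
  have hβ0 : (0:ℝ) < β := by linarith
  have h1 : (fun u => (if Tab α β u ≤ y then (1:ℝ) else 0) * (if u < c then 1 else 0)) =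
      (Iio c).indicator (fun u => (if Tab α β u ≤ y then (1:ℝ) else 0)) := by
    ext u; simp [indicator]
  rw [h1, setIntegral_indicator measurableSet_Iio]
  have h2 : Icc 0 1 ∩ Iio c = Ico 0 c := by
    ext u; simp only [mem_inter_iff, mem_Icc, mem_Iio, mem_Ico]
    constructor
    · exact fun h => ⟨h.1.1, h.2⟩
    · exact fun h => ⟨⟨h.1, by linarith [hc.2, h.2]⟩, h.2⟩
  rw [h2, integral_Ico_eq_integral_Ioo, ← integral_Ioc_eq_integral_Ioo,
    ← intervalIntegral.integral_of_le hc.1]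
  unfold Tab
  rw [intervalIntegral.integral_comp_mul_add (fun u => (if Int.fract u ≤ y then (1:ℝ) else 0))
    hβ0.ne' α, mul_zero, zero_add, smul_eq_mul]
  congr 1
  rw [← intervalIntegral.integral_interval_sub_left (a := 0) (fract_ite_intervalIntegrable _ _ _)
    (fract_ite_intervalIntegrable _ _ _), int_fract hy (by have := hc.1; have := hα.1; positivity),
    int_fract hy hα.1]
  have : ⌊α⌋ = 0 := Int.floor_eq_zero_iff.2 hα
  rw [this, Int.fract_eq_self.2 hα]; simp

theorem K_eq2 {y c : ℝ} (hy : y ∈ Icc (0:ℝ) 1) (hc : c ∈ Icc (0:ℝ) 1) :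
    ∫ u in Icc (0:ℝ) 1, (if u ≤ y then (1:ℝ) else 0) * (if u < c then 1 else 0) = min c y := by
  have h1 : (fun u => (if u ≤ y then (1:ℝ) else 0) * (if u < c then 1 else 0)) =
      (Iio c).indicator (fun u => (if u ≤ y then (1:ℝ) else 0)) := by
    ext u; simp [indicator]
  rw [h1, setIntegral_indicator measurableSet_Iio]
  have h2 : Icc 0 1 ∩ Iio c = Ico 0 c := by
    ext u; simp only [mem_inter_iff, mem_Icc, mem_Iio, mem_Ico]
    constructor
    · exact fun h => ⟨h.1.1, h.2⟩
    · exact fun h => ⟨⟨h.1, by linarith [hc.2, h.2]⟩, h.2⟩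
  rw [h2, integral_Ico_eq_integral_Ioo, ← int_fract_base hy.1 hc,
    intervalIntegral.integral_of_le hc.1, integral_Ioc_eq_integral_Ioo]
  refine setIntegral_congr_fun measurableSet_Ioo fun u hu => ?_
  have : Int.fract u = u := Int.fract_eq_self.2 ⟨hu.1.le, hu.2.trans_le hc.2⟩
  simp only [this]

noncomputable def pterm (α β : ℝ) (n : ℕ) (x : ℝ) : ℝ :=
  ((if x < (Tab α β)^[n] 1 then (1 : ℝ) else 0)
    - (if x < (Tab α β)^[n] 0 then (1 : ℝ) else 0)) / β ^ (n + 1)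

theorem pterm_meas (α β : ℝ) (n : ℕ) : Measurable (pterm α β n) := by
  unfold pterm
  exact ((Measurable.ite measurableSet_Iio measurable_const measurable_const).sub
    (Measurable.ite measurableSet_Iio measurable_const measurable_const)).div_const _

theorem pterm_bound (α : ℝ) {β : ℝ} (hβ : 1 < β) (n : ℕ) (x : ℝ) :
    |pterm α β n x| ≤ β⁻¹ ^ (n+1) := by
  have hβ0 : (0:ℝ) < β := by linarith
  unfold pterm
  rw [abs_div, abs_of_pos (by positivity : 0 < β ^ (n+1)), inv_pow, div_eq_mul_inv]
  refine mul_le_of_le_one_left (by positivity) ?_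
  split_ifs <;> simp

theorem geo_summable {β : ℝ} (hβ : 1 < β) : Summable (fun n : ℕ => β⁻¹ ^ (n+1)) :=
  (summable_nat_add_iff 1).2 (summable_geometric_of_lt_one (by positivity) (inv_lt_one_of_one_lt₀ hβ))

theorem pterm_summable (α : ℝ) {β : ℝ} (hβ : 1 < β) (x : ℝ) :
    Summable (fun n => pterm α β n x) :=
  Summable.of_norm_bounded (geo_summable hβ) (fun n => pterm_bound α hβ n x)

theorem parryG_eq (α β x : ℝ) : parryG α β x = ∑' n, pterm α β n x := rfl

theorem parryG_meas (α : ℝ) {β : ℝ} (hβ : 1 < β) : Measurable (parryG α β) := by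
  refine measurable_of_tendsto_metrizable (f := fun N x => ∑ n ∈ Finset.range N, pterm α β n x)
    (fun N => Finset.measurable_fun_sum _ fun n _ => pterm_meas α β n) ?_
  rw [tendsto_pi_nhds]
  intro x
  exact (pterm_summable α hβ x).hasSum.tendsto_sum_nat

theorem parryG_bound (α : ℝ) {β : ℝ} (hβ : 1 < β) :
    ∃ C : ℝ, 0 < C ∧ ∀ x, |parryG α β x| ≤ C := by
  refine ⟨(∑' n : ℕ, β⁻¹ ^ (n+1)) + 1, ?_, fun x => ?_⟩
  · have : 0 ≤ ∑' n : ℕ, β⁻¹ ^ (n+1) := tsum_nonneg fun n => by positivity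
    linarith
  have := tsum_of_norm_bounded (f := fun n => pterm α β n x) (geo_summable hβ).hasSum (fun n => pterm_bound α hβ n x)
  rw [parryG_eq]
  rw [Real.norm_eq_abs] at this
  linarith

theorem int_k_parry {α β : ℝ} (hβ : 1 < β) {k : ℝ → ℝ} (hk : Measurable k) (hk1 : ∀ u, |k u| ≤ 1) :
    HasSum (fun n => ((∫ u in Icc (0:ℝ) 1, k u * (if u < (Tab α β)^[n] 1 then 1 else 0)) -
      (∫ u in Icc (0:ℝ) 1, k u * (if u < (Tab α β)^[n] 0 then 1 else 0))) / β ^ (n+1))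
      (∫ u in Icc (0:ℝ) 1, k u * parryG α β u) := by
  have hint : ∀ c : ℝ, Integrable (fun u => k u * (if u < c then 1 else 0))
      (volume.restrict (Icc (0:ℝ) 1)) := by
    intro c
    refine Integrable.of_bound (C := 1) ((hk.mul
      (Measurable.ite measurableSet_Iio measurable_const measurable_const)).aestronglyMeasurable)
      (Eventually.of_forall fun u => ?_)
    rw [Real.norm_eq_abs, abs_mul]
    have : |if u < c then (1:ℝ) else 0| ≤ 1 := by split_ifs <;> simp
    calc _ ≤ 1 * 1 := mul_le_mul (hk1 u) this (abs_nonneg _) zero_le_one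
      _ = 1 := by norm_num
  have hb : ∀ n u, ‖k u * pterm α β n u‖ ≤ β⁻¹ ^ (n+1) := by
    intro n u
    rw [Real.norm_eq_abs, abs_mul]
    calc _ ≤ 1 * β⁻¹ ^ (n+1) := mul_le_mul (hk1 u) (pterm_bound α hβ n u) (abs_nonneg _) zero_le_one
      _ = _ := by ring
  have hi : ∀ n, Integrable (fun u => k u * pterm α β n u) (volume.restrict (Icc (0:ℝ) 1)) := by
    intro n
    exact Integrable.of_bound (C := β⁻¹ ^ (n+1)) ((hk.mul (pterm_meas α β n)).aestronglyMeasurable)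
      (Eventually.of_forall fun u => hb n u)
  have hs := hasSum_integral_of_summable_integral_norm hi (by
    refine Summable.of_nonneg_of_le (fun n => integral_nonneg fun u => norm_nonneg _) (fun n => ?_)
      (geo_summable hβ)
    refine (integral_mono (hi n).norm (integrable_const _) (fun u => hb n u)).trans ?_
    simp)
  convert! hs using 1
  · funext n
    rw [← integral_sub (hint _) (hint _), ← integral_div]
    congr 1
    funext u
    unfold pterm; ring
  · congr 1; funext u; rw [tsum_mul_left, parryG_eq]

theorem parry_inv_core {α β y : ℝ} (hα : α ∈ Ico (0:ℝ) 1) (hβ : 1 < β) (hy : y ∈ Icc (0:ℝ) 1) :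
    ∫ u in Icc (0:ℝ) 1, (if Tab α β u ≤ y then (1:ℝ) else 0) * parryG α β u =
    ∫ u in Icc (0:ℝ) 1, (if u ≤ y then (1:ℝ) else 0) * parryG α β u := by
  have hβ0 : (0:ℝ) < β := by linarith
  have ab : ∀ p : Prop, ∀ [Decidable p], |if p then (1:ℝ) else 0| ≤ 1 := by
    intro p _; split_ifs <;> simp
  have h1 := int_k_parry (α := α) hβ (k := fun u => if Tab α β u ≤ y then (1:ℝ) else 0)
    (Measurable.ite (measurable_Tab α β measurableSet_Iic) measurable_const measurable_const)
    (fun u => ab _)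
  have h2 := int_k_parry (α := α) hβ (k := fun u => if u ≤ y then (1:ℝ) else 0)
    (Measurable.ite measurableSet_Iic measurable_const measurable_const) (fun u => ab _)
  have m1 : ∀ n, (Tab α β)^[n] 1 ∈ Icc (0:ℝ) 1 := Tab_iter_mem' (by simp)
  have m0 : ∀ n, (Tab α β)^[n] 0 ∈ Icc (0:ℝ) 1 := Tab_iter_mem' (by simp)
  simp only [K_eq hα hβ hy (m1 _), K_eq hα hβ hy (m0 _)] at h1
  simp only [K_eq2 hy (m1 _), K_eq2 hy (m0 _)] at h2
  have h3 := (h2.sub h1).tendsto_sum_nat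
  set c := fun n => (Tab α β)^[n] 1 with hc
  set c' := fun n => (Tab α β)^[n] 0 with hc'
  set v : ℕ → ℝ := fun n => (min (c n) y - min (c' n) y - y * (c n - c' n)) / β ^ (n+1) with hv
  have fl : ∀ z : ℝ, (⌊β * z + α⌋ : ℝ) = β * z + α - Tab α β z := by
    intro z; unfold Tab; rw [Int.fract]; ring
  have h4 : ∀ N, ∑ n ∈ Finset.range N, ((min ((Tab α β)^[n] 1) y - min ((Tab α β)^[n] 0) y) / β ^ (n+1)
      - (β⁻¹ * (⌊β * (Tab α β)^[n] 1 + α⌋ * y + min (Tab α β ((Tab α β)^[n] 1)) y - min α y) -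
        β⁻¹ * (⌊β * (Tab α β)^[n] 0 + α⌋ * y + min (Tab α β ((Tab α β)^[n] 0)) y - min α y)) / β ^ (n+1))
      = v 0 - v N := by
    intro N
    rw [← Finset.sum_range_sub']
    refine Finset.sum_congr rfl fun n _ => ?_
    simp only [hv, hc, hc', fl, Function.iterate_succ_apply']
    rw [pow_succ β (n+1)]
    field_simp
    ring
  have hv0 : v 0 = 0 := by
    simp only [hv, hc, hc', Function.iterate_zero, id]
    rw [min_eq_right hy.2, min_eq_left hy.1]; simp
  have hvt : Tendsto v atTop (𝓝 0) := by
    refine squeeze_zero_norm (a := fun n => 3 * β⁻¹ ^ (n+1)) (fun n => ?_) ?_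
    · have a1 := m1 n
      have a0 := m0 n
      have b1 : |min (c n) y - min (c' n) y| ≤ 1 := by
        rw [abs_le]
        have := le_min a1.1 hy.1
        have := le_min a0.1 hy.1
        have := (min_le_right (c n) y).trans hy.2
        have := (min_le_right (c' n) y).trans hy.2
        constructor <;> simp only [hc, hc'] at * <;> linarith
      have b2 : |y * (c n - c' n)| ≤ 1 := by
        rw [abs_mul, abs_of_nonneg hy.1]
        have : |c n - c' n| ≤ 1 := by
          rw [abs_le]; simp only [hc, hc']
          constructor <;> linarith [a1.1, a1.2, a0.1, a0.2]
        calc _ ≤ 1 * 1 := mul_le_mul hy.2 this (abs_nonneg _) zero_le_one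
          _ = 1 := by norm_num
      rw [Real.norm_eq_abs, hv, abs_div, abs_of_pos (by positivity : 0 < β ^ (n+1)), inv_pow,
        div_eq_mul_inv]
      gcongr
      exact (abs_sub _ _).trans (by linarith)
    · have := (geo_summable hβ).tendsto_atTop_zero.const_mul 3
      simpa using this
  have h5 : Tendsto (fun N => v 0 - v N) atTop (𝓝 0) := by
    rw [hv0]; simpa using hvt.const_sub 0
  simp only [h4] at h3
  have := tendsto_nhds_unique h3 h5
  linarith


theorem goodM_of_inv {α β : ℝ} {p : Measure ℝ} [IsFiniteMeasure p] (hp0 : p univ ≠ 0)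
    (hinv : p.map (Tab α β) = p) {C : ℝ} (hC : 0 ≤ C)
    (hb : ∀ E, MeasurableSet E → p E ≤ ENNReal.ofReal C * volume (E ∩ Icc (0:ℝ) 1)) :
    GoodM α β ((p univ)⁻¹ • p) := by
  have hfin : p univ ≠ ⊤ := measure_ne_top _ _
  refine ⟨⟨?_⟩, ⟨measurable_Tab α β, ?_⟩, (p univ)⁻¹.toReal * C, by positivity, ?_⟩
  · simp [ENNReal.inv_mul_cancel hp0 hfin]
  · rw [Measure.map_smul, hinv]
  · intro E hE hEf
    rw [measureReal_ennreal_smul_apply, mul_assoc]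
    refine mul_le_mul_of_nonneg_left ?_ ENNReal.toReal_nonneg
    have h1 := hb E hE
    have h2 : p.real E ≤ C * volume.real (E ∩ Icc (0:ℝ) 1) := by
      rw [measureReal_def, measureReal_def]
      have := ENNReal.toReal_mono (ENNReal.mul_ne_top ENNReal.ofReal_ne_top
        (measure_ne_top_of_subset inter_subset_left hEf)) h1
      rwa [ENNReal.toReal_mul, ENNReal.toReal_ofReal hC] at this
    refine h2.trans (mul_le_mul_of_nonneg_left ?_ hC)
    have h3 : volume.real (E ∩ Icc (0:ℝ) 1) ≤ volume.real E := measureReal_mono inter_subset_left hEf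
    have h4 : volume.real (E ∩ Icc (0:ℝ) 1) ≤ 1 := by
      have : volume.real (E ∩ Icc (0:ℝ) 1) ≤ volume.real (Icc (0:ℝ) 1) :=
        measureReal_mono inter_subset_right (by simp)
      simpa using this
    have h0 : 0 ≤ volume.real (E ∩ Icc (0:ℝ) 1) := measureReal_nonneg
    refine le_trans ?_ (Real.sqrt_le_sqrt h3)
    exact Real.le_sqrt_of_sq_le (by nlinarith)

theorem map_le_of_balance {T : ℝ → ℝ} (hT : Measurable T) {p q : Measure ℝ} [IsFiniteMeasure p]
    [IsFiniteMeasure q] (h : p.map T + q = q.map T + p) {S : Set ℝ} (hS : MeasurableSet S)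
    (hq : q S = 0) (hp : p Sᶜ = 0) : p.map T = p := by
  symm
  refine Measure.eq_of_le_of_measure_univ_eq ?_ ?_
  · refine Measure.le_iff.2 fun E hE => ?_
    have h1 : p E = p (E ∩ S) := by
      have hz : p (E \ S) = 0 := measure_mono_null (fun x hx => hx.2) hp
      rw [← measure_inter_add_sdiff E hS, hz, add_zero]
    have h2 := congrArg (fun m => m (E ∩ S)) h
    simp only [Measure.add_apply] at h2
    rw [measure_mono_null inter_subset_right hq, add_zero] at h2
    calc p E = p (E ∩ S) := h1
      _ ≤ p.map T (E ∩ S) := by rw [h2]; exact le_add_self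
      _ ≤ p.map T E := measure_mono inter_subset_left
  · rw [Measure.map_apply hT MeasurableSet.univ, preimage_univ]

noncomputable def pP (α β : ℝ) : Measure ℝ :=
  (volume.restrict (Icc (0:ℝ) 1)).withDensity (fun x => ENNReal.ofReal (parryG α β x))
noncomputable def pQ (α β : ℝ) : Measure ℝ :=
  (volume.restrict (Icc (0:ℝ) 1)).withDensity (fun x => ENNReal.ofReal (-parryG α β x))

theorem pdens_le {G : ℝ → ℝ} {C : ℝ} (hC : ∀ x, |G x| ≤ C) (E : Set ℝ)
    (hE : MeasurableSet E) :
    ((volume.restrict (Icc (0:ℝ) 1)).withDensity (fun x => ENNReal.ofReal (G x))) E ≤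
      ENNReal.ofReal C * volume (E ∩ Icc (0:ℝ) 1) := by
  rw [withDensity_apply _ hE, Measure.restrict_restrict hE]
  calc _ ≤ ∫⁻ x in E ∩ Icc (0:ℝ) 1, ENNReal.ofReal C :=
        lintegral_mono fun x => ENNReal.ofReal_le_ofReal ((le_abs_self _).trans (hC x))
    _ = _ := by rw [setLIntegral_const]

theorem pdens_fin {G : ℝ → ℝ} {C : ℝ} (hC : ∀ x, |G x| ≤ C) :
    IsFiniteMeasure ((volume.restrict (Icc (0:ℝ) 1)).withDensity (fun x => ENNReal.ofReal (G x))) := by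
  refine ⟨(pdens_le hC univ MeasurableSet.univ).trans_lt ?_⟩
  exact ENNReal.mul_lt_top ENNReal.ofReal_lt_top (by simp)

theorem parryG_integrable (α : ℝ) {β : ℝ} (hβ : 1 < β) :
    Integrable (parryG α β) (volume.restrict (Icc (0:ℝ) 1)) := by
  obtain ⟨C, hC, h⟩ := parryG_bound α hβ
  exact Integrable.of_bound (C := C) (parryG_meas α hβ).aestronglyMeasurable
    (Eventually.of_forall h)

theorem pP_sub_pQ (α : ℝ) {β : ℝ} (hβ : 1 < β) {A : Set ℝ} (hA : MeasurableSet A) :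
    (pP α β).real A - (pQ α β).real A = ∫ u in Icc (0:ℝ) 1, A.indicator (parryG α β) u := by
  rw [integral_indicator hA, integral_eq_lintegral_pos_part_sub_lintegral_neg_part
    (parryG_integrable α hβ).integrableOn, measureReal_def, measureReal_def, pP, pQ,
    withDensity_apply _ hA, withDensity_apply _ hA]

theorem parry_balance {α β : ℝ} (hα : α ∈ Ico (0:ℝ) 1) (hβ : 1 < β) :
    (pP α β).map (Tab α β) + pQ α β = (pQ α β).map (Tab α β) + pP α β := by
  obtain ⟨C, hC, hG⟩ := parryG_bound α hβ
  haveI : IsFiniteMeasure (pP α β) := pdens_fin hG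
  haveI : IsFiniteMeasure (pQ α β) := pdens_fin (G := fun x => - parryG α β x) (C := C)
    (fun x => by rw [abs_neg]; exact hG x)
  have hT := measurable_Tab α β
  refine Measure.ext_of_Iic _ _ fun y => ?_
  have key : ∫ u in Icc (0:ℝ) 1, (Tab α β ⁻¹' (Iic y)).indicator (parryG α β) u =
      ∫ u in Icc (0:ℝ) 1, (Iic y).indicator (parryG α β) u := by
    rcases lt_or_ge y 0 with h | h
    · refine setIntegral_congr_fun measurableSet_Icc fun u hu => ?_
      have := (Tab_mem α β u).1
      rw [indicator_of_notMem, indicator_of_notMem]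
      · simp only [mem_Iic, not_le]; exact h.trans_le hu.1
      · simp only [mem_preimage, mem_Iic, not_le]; linarith
    rcases lt_or_ge 1 y with h' | h'
    · refine setIntegral_congr_fun measurableSet_Icc fun u hu => ?_
      have := (Tab_mem α β u).2
      rw [indicator_of_mem, indicator_of_mem]
      · simp only [mem_Iic]; linarith [hu.2]
      · simp only [mem_preimage, mem_Iic]; linarith
    · have := parry_inv_core hα hβ (y := y) ⟨h, h'⟩
      convert! this using 2
      · funext u; by_cases hh : Tab α β u ≤ y <;> simp [indicator, hh]
      · funext u; by_cases hh : u ≤ y <;> simp [indicator, hh]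
  rw [← pP_sub_pQ α hβ (hT measurableSet_Iic), ← pP_sub_pQ α hβ measurableSet_Iic] at key
  simp only [Measure.add_apply, Measure.map_apply hT measurableSet_Iic]
  rw [← ENNReal.toReal_eq_toReal_iff' (by finiteness) (by finiteness),
    ENNReal.toReal_add (by finiteness) (by finiteness), ENNReal.toReal_add (by finiteness) (by finiteness)]
  simp only [measureReal_def] at key
  linarith

theorem parryG_near_one {α β : ℝ} (hβ : 1 < β) :
    ∃ ε > 0, ∀ x ∈ Ioo (1-ε) 1, 0 < parryG α β x := by
  have hβ0 : (0:ℝ) < β := by linarith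
  -- tail
  obtain ⟨N, hN⟩ : ∃ N, 1 ≤ N ∧ ∑' n : ℕ, β⁻¹ ^ (n + N + 1) < β⁻¹ := by
    have h1 := tendsto_sum_nat_add (fun n : ℕ => β⁻¹ ^ (n+1))
    have h2 := (h1.eventually (gt_mem_nhds (inv_pos.2 hβ0))).and (eventually_ge_atTop 1)
    obtain ⟨N, h3, h4⟩ := h2.exists
    exact ⟨N, h4, h3⟩
  obtain ⟨hN1, hN⟩ := hN
  have hev : ∀ᶠ x in 𝓝[<] (1:ℝ), ∀ n ∈ Finset.range N, 1 ≤ n →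
      (Tab α β)^[n] 1 < x ∧ (Tab α β)^[n] 0 < x := by
    rw [Filter.eventually_all_finset]
    intro n hn
    rcases Nat.eq_zero_or_pos n with h | h
    · exact Eventually.of_forall fun x h' => by omega
    · obtain ⟨m, rfl⟩ := Nat.exists_eq_succ_of_ne_zero h.ne'
      have a1 : (Tab α β)^[m+1] 1 < 1 := by rw [Function.iterate_succ_apply']; exact (Tab_mem _ _ _).2
      have a0 : (Tab α β)^[m+1] 0 < 1 := by rw [Function.iterate_succ_apply']; exact (Tab_mem _ _ _).2
      filter_upwards [mem_nhdsWithin_of_mem_nhds (lt_mem_nhds a1),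
        mem_nhdsWithin_of_mem_nhds (lt_mem_nhds a0)] with x h1 h0 _
      exact ⟨h1, h0⟩
  have hev2 : ∀ᶠ x in 𝓝[<] (1:ℝ), (0:ℝ) < x := mem_nhdsWithin_of_mem_nhds (lt_mem_nhds one_pos)
  have hev3 := hev.and hev2
  obtain ⟨l, hl, hl2⟩ := (mem_nhdsLT_iff_exists_Ioo_subset' (show (0:ℝ) < 1 by norm_num)).1 hev3
  refine ⟨1 - l, by simpa using hl, fun x hx => ?_⟩
  obtain ⟨h1, h2⟩ := hl2 (by simpa using hx)
  rw [parryG_eq, ← (pterm_summable α hβ x).sum_add_tsum_nat_add N]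
  have h3 : ∑ n ∈ Finset.range N, pterm α β n x = β⁻¹ := by
    rw [Finset.sum_eq_single_of_mem 0 (by simp; omega)]
    · simp [pterm, hx.2, not_lt.2 h2.le]
    · intro n hn hn0
      have := h1 n hn (by omega)
      simp [pterm, not_lt.2 this.1.le, not_lt.2 this.2.le]
  have h4 := tsum_of_norm_bounded (f := fun n => pterm α β (n+N) x)
    ((summable_nat_add_iff N).2 (geo_summable hβ)).hasSum (fun n => pterm_bound α hβ (n+N) x)
  rw [h3]
  rw [Real.norm_eq_abs] at h4
  have := (abs_le.1 h4).1
  linarith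

theorem parryMeasure_good {α β : ℝ} (hα : α ∈ Ico (0:ℝ) 1) (hβ : 1 < β) :
    GoodM α β (parryMeasure α β) := by
  obtain ⟨C, hC, hG⟩ := parryG_bound α hβ
  have hG' : ∀ x, |-parryG α β x| ≤ C := fun x => by rw [abs_neg]; exact hG x
  haveI : IsFiniteMeasure (pP α β) := pdens_fin hG
  haveI : IsFiniteMeasure (pQ α β) := pdens_fin (G := fun x => - parryG α β x) hG'
  have hT := measurable_Tab α β
  have hbal := parry_balance hα hβ
  set S : Set ℝ := {x | 0 < parryG α β x} with hS
  have hSm : MeasurableSet S := measurableSet_lt measurable_const (parryG_meas α hβ)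
  have hqS : pQ α β S = 0 := by
    rw [pQ, withDensity_apply _ hSm]
    refine (setLIntegral_congr_fun hSm (g := fun _ => 0) fun x hx => ?_).trans (by simp)
    exact ENNReal.ofReal_of_nonpos (by have : 0 < parryG α β x := hx; linarith)
  have hpS : pP α β Sᶜ = 0 := by
    rw [pP, withDensity_apply _ hSm.compl]
    refine (setLIntegral_congr_fun hSm.compl (g := fun _ => 0) fun x hx => ?_).trans (by simp)
    exact ENNReal.ofReal_of_nonpos (not_lt.1 hx)
  have ip := map_le_of_balance hT hbal hSm hqS hpS
  have iq := map_le_of_balance hT hbal.symm hSm.compl hpS (by rwa [compl_compl])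
  have hp0 : pP α β univ ≠ 0 := by
    obtain ⟨ε, hε, hpos⟩ := parryG_near_one (α := α) hβ
    intro h0
    have h1 : pP α β (Ioo (max 0 (1-ε)) 1) = 0 := measure_mono_null (subset_univ _) h0
    rw [pP, withDensity_apply _ measurableSet_Ioo, Measure.restrict_restrict measurableSet_Ioo,
      setLIntegral_eq_zero_iff (measurableSet_Ioo.inter measurableSet_Icc)
      (parryG_meas α hβ).ennreal_ofReal] at h1
    have h2 : volume (Ioo (max 0 (1-ε)) 1) = 0 := by
      refine measure_mono_null (fun x hx => ?_) h1
      simp only [mem_compl_iff, mem_ofPred_eq]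
      intro h
      have h3 : max 0 (1-ε) < x := hx.1
      have h4 := max_lt_iff.1 h3
      have := h ⟨hx, h4.1.le, hx.2.le⟩
      have := ENNReal.ofReal_eq_zero.1 this
      have := hpos x ⟨h4.2, hx.2⟩
      linarith
    rw [Real.volume_Ioo, ENNReal.ofReal_eq_zero] at h2
    have : max 0 (1-ε) < 1 := max_lt (by norm_num) (by linarith)
    linarith
  have gp := goodM_of_inv hp0 ip hC.le (fun E hE => pdens_le hG E hE)
  have hq0 : pQ α β univ = 0 := by
    by_contra hq0
    have gq := goodM_of_inv hq0 iq hC.le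
      (fun E hE => pdens_le (G := fun x => - parryG α β x) hG' E hE)
    have := gp.unique hβ gq
    have h1 := congrArg (fun m => m S) this
    simp only [Measure.smul_apply, smul_eq_mul, hqS, mul_zero] at h1
    have h2 : pP α β univ = pP α β S := by
      rw [← measure_add_measure_compl hSm, hpS, add_zero]
    rw [← h2, ENNReal.inv_mul_cancel hp0 (measure_ne_top _ _)] at h1
    exact one_ne_zero h1
  have hN : parryN α β = (pP α β).real univ := by
    have := pP_sub_pQ α hβ (A := univ) MeasurableSet.univ
    rw [measureReal_def (pQ α β), hq0] at this
    simp only [ENNReal.toReal_zero, sub_zero, indicator_univ] at this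
    rw [this]; rfl
  have hNpos : 0 < (pP α β).real univ := ENNReal.toReal_pos hp0 (measure_ne_top _ _)
  have : parryMeasure α β = (pP α β univ)⁻¹ • pP α β := by
    rw [parryMeasure, pP, ← withDensity_smul _ (parryG_meas α hβ).ennreal_ofReal]
    congr 1
    funext x
    rw [hN, div_eq_inv_mul, ENNReal.ofReal_mul (by positivity), ENNReal.ofReal_inv_of_pos hNpos,
      ofReal_measureReal]
    rfl
  rw [this]; exact gp


/-- empirical averages -/
noncomputable def avg (u : ℕ → ℝ) (n : ℕ) : ℝ := (n : ℝ)⁻¹ * ∑ m ∈ Finset.range n, u m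

theorem exists_limit_measure {X : Type*} [TopologicalSpace X] [CompactSpace X] [T2Space X]
    [MeasurableSpace X] [BorelSpace X] [SecondCountableTopology X]
    (o : ℕ → X) (U : Ultrafilter ℕ) (hU : (U : Filter ℕ) ≤ atTop) :
    ∃ ν : Measure X, IsProbabilityMeasure ν ∧ ∀ g : X → ℝ, Continuous g →
      Tendsto (avg (fun m => g (o m))) U (𝓝 (∫ y, g y ∂ν)) := by
  classical
  let mu : ℕ → Measure X := fun n => (n : ℝ≥0∞)⁻¹ • ∑ m ∈ Finset.range n, Measure.dirac (o m)
  have hmu : ∀ n, n ≠ 0 → IsProbabilityMeasure (mu n) := by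
    intro n hn
    refine ⟨?_⟩
    simp only [mu, Measure.smul_apply, Measure.finsetSum_apply, measure_univ, Finset.sum_const,
      Finset.card_range, smul_eq_mul, nsmul_eq_mul, mul_one]
    exact ENNReal.inv_mul_cancel (by exact_mod_cast hn) (by simp)
  let P : ℕ → ProbabilityMeasure X := fun n =>
    if h : n ≠ 0 then ⟨mu n, hmu n h⟩ else ⟨Measure.dirac (o 0), inferInstance⟩
  obtain ⟨ν, -, hν⟩ := isCompact_univ.ultrafilter_le_nhds (U.map P) (by simp)
  have hν' : Tendsto P U (𝓝 ν) := hν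
  refine ⟨ν, inferInstance, fun g hg => ?_⟩
  have h1 := (ProbabilityMeasure.tendsto_iff_forall_integral_tendsto.1 hν')
    (BoundedContinuousFunction.mkOfCompact ⟨g, hg⟩)
  refine h1.congr' ?_
  have h0 : ∀ᶠ n in (U : Filter ℕ), n ≠ 0 := hU (eventually_ne_atTop 0)
  filter_upwards [h0] with n hn
  have : ((P n : ProbabilityMeasure X) : Measure X) = mu n := by simp [P, hn]
  rw [this]
  simp only [mu, BoundedContinuousFunction.mkOfCompact_apply, ContinuousMap.coe_mk, avg]
  rw [integral_smul_measure, integral_finsetSum_measure]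
  · simp [integral_dirac]
  · intro i _
    exact integrable_dirac (by simp)

theorem limit_invariant {X : Type*} [TopologicalSpace X] [CompactSpace X] [T2Space X]
    [MeasurableSpace X] [BorelSpace X] [SecondCountableTopology X] {s : X → X} (hs : Continuous s)
    {w : X} {U : Ultrafilter ℕ} (hU : (U : Filter ℕ) ≤ atTop) {ν : Measure X}
    [IsProbabilityMeasure ν] (h : ∀ g : X → ℝ, Continuous g →
      Tendsto (avg (fun m => g (s^[m] w))) U (𝓝 (∫ y, g y ∂ν))) : ν.map s = ν := by
  haveI : IsProbabilityMeasure (ν.map s) :=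
    Measure.isProbabilityMeasure_map hs.measurable.aemeasurable
  refine ext_of_forall_integral_eq_of_IsFiniteMeasure fun f => ?_
  rw [integral_map hs.measurable.aemeasurable f.continuous.measurable.aestronglyMeasurable]
  have h1 := h (fun y => f (s y)) (f.continuous.comp hs)
  have h2 := h f f.continuous
  have h3 : Tendsto (fun n => avg (fun m => f (s (s^[m] w))) n - avg (fun m => f (s^[m] w)) n)
      U (𝓝 0) := by
    refine Tendsto.mono_left ?_ hU
    refine squeeze_zero_norm (a := fun n : ℕ => (n:ℝ)⁻¹ * (2 * ‖f‖)) (fun n => ?_) ?_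
    · have : avg (fun m => f (s (s^[m] w))) n - avg (fun m => f (s^[m] w)) n
          = (n:ℝ)⁻¹ * (f (s^[n] w) - f w) := by
        have := Finset.sum_range_sub (fun m => f (s^[m] w)) n
        simp only [Function.iterate_zero, id] at this
        rw [← this, Finset.sum_sub_distrib]
        simp only [avg, Function.iterate_succ_apply']; ring
      rw [this, norm_mul, Real.norm_of_nonneg (by positivity)]
      gcongr
      calc _ ≤ ‖f (s^[n] w)‖ + ‖f w‖ := norm_sub_le _ _
        _ ≤ ‖f‖ + ‖f‖ := add_le_add (f.norm_coe_le_norm _) (f.norm_coe_le_norm _)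
        _ = _ := by ring
    · simpa using tendsto_inv_atTop_nhds_zero_nat.mul_const (2 * ‖f‖)
  have h4 := tendsto_nhds_unique (h1.sub h2) h3
  linarith

def ACx (α β x : ℝ) : Prop :=
  ∃ C : ℝ, 0 ≤ C ∧ ∀ g : ℝ → ℝ, Continuous g → (∀ y, 0 ≤ g y ∧ g y ≤ 1) → ∀ ε > 0,
    ∀ᶠ n in atTop, avg (fun m => g ((Tab α β)^[m] x)) n ≤ C * √(∫ y in Icc (0:ℝ) 1, g y) + ε

/-- from limit bound to measure bound -/
theorem measure_bound_of_functional {κ : Measure ℝ} [IsProbabilityMeasure κ] {C : ℝ} (hC : 0 ≤ C)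
    (h : ∀ g : ℝ → ℝ, Continuous g → (∀ y, 0 ≤ g y ∧ g y ≤ 1) →
      ∫ y, g y ∂κ ≤ C * √(∫ y in Icc (0:ℝ) 1, g y)) {E : Set ℝ} (hE : MeasurableSet E)
    (hEf : volume E ≠ ⊤) : κ.real E ≤ C * √(volume.real E) := by
  have open_bd : ∀ O : Set ℝ, IsOpen O → volume O ≠ ⊤ → κ.real O ≤ C * √(volume.real O) := by
    intro O hO hOf
    have hk : ∀ K, K ⊆ O → IsCompact K → κ K ≤ ENNReal.ofReal (C * √(volume.real O)) := by
      intro K hKO hK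
      obtain ⟨g, hg1, hg0, hgc, hg01⟩ := exists_continuous_one_zero_of_isCompact hK
        hO.isClosed_compl (disjoint_compl_right_iff_subset.2 hKO)
      have h1 := h g g.continuous (fun y => hg01 y)
      have gint : ∀ (m : Measure ℝ) [IsFiniteMeasure m], Integrable g m := fun m _ =>
        Integrable.of_bound (C := 1) g.continuous.measurable.aestronglyMeasurable
          (Eventually.of_forall fun y => by
            rw [Real.norm_of_nonneg (hg01 y).1]; exact (hg01 y).2)
      have h2 : κ.real K ≤ ∫ y, g y ∂κ := by
        rw [← integral_indicator_one hK.measurableSet]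
        refine integral_mono ((integrable_const 1).indicator hK.measurableSet) (gint κ) fun y => ?_
        by_cases hy : y ∈ K
        · simp [hy, hg1 hy]
        · simp [hy, (hg01 y).1]
      have h3 : ∫ y in Icc (0:ℝ) 1, g y ≤ volume.real O := by
        calc ∫ y in Icc (0:ℝ) 1, g y ≤ ∫ y in Icc (0:ℝ) 1, O.indicator 1 y := by
              refine integral_mono (gint _) ((integrable_const 1).indicator hO.measurableSet) fun y => ?_
              by_cases hy : y ∈ O
              · simp [hy, (hg01 y).2]
              · simp [hy]; exact (hg0 hy).le
          _ = (volume.restrict (Icc (0:ℝ) 1)).real O := by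
              rw [integral_indicator_one hO.measurableSet]
          _ ≤ _ := by
              rw [measureReal_def, measureReal_def]
              exact ENNReal.toReal_mono hOf (Measure.restrict_apply_le _ _)
      rw [← ofReal_measureReal]
      refine ENNReal.ofReal_le_ofReal (h2.trans (h1.trans ?_))
      gcongr
    rw [measureReal_def, hO.measure_eq_iSup_isCompact]
    refine ENNReal.toReal_le_of_le_ofReal (by positivity) ?_
    exact iSup_le fun K => iSup_le fun h1 => iSup_le fun h2 => hk K h1 h2
  have hlim : Tendsto (fun e : ℝ => C * √(volume.real E + e)) (𝓝[>] 0) (𝓝 (C * √(volume.real E))) := by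
    have : Continuous (fun e : ℝ => C * √(volume.real E + e)) := by fun_prop
    have := this.tendsto 0
    rw [add_zero] at this
    exact this.mono_left nhdsWithin_le_nhds
  refine ge_of_tendsto hlim ?_
  filter_upwards [self_mem_nhdsWithin] with e he
  obtain ⟨O, hEO, hO, hlt⟩ := Set.exists_isOpen_lt_of_lt E (volume E + ENNReal.ofReal e)
    (ENNReal.lt_add_right hEf (by simpa using he))
  have hOf : volume O ≠ ⊤ := (hlt.trans_le le_top).ne
  have h5 : volume.real O ≤ volume.real E + e := by
    have := ENNReal.toReal_mono (by finiteness) hlt.le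
    rwa [ENNReal.toReal_add hEf (by finiteness), ENNReal.toReal_ofReal (le_of_lt he)] at this
  calc κ.real E ≤ κ.real O := measureReal_mono hEO (measure_ne_top _ _)
    _ ≤ C * √(volume.real O) := open_bd O hO hOf
    _ ≤ _ := by gcongr


theorem code_floor {α β x : ℝ} (hα : 0 ≤ α) (hβ : 0 ≤ β) (hx : x ∈ Ico (0:ℝ) 1) (n : ℕ) :
    ((code α β x n : ℕ) : ℝ) = (⌊β * (Tab α β)^[n] x + α⌋ : ℝ) := by
  have h0 := (Tab_iter_mem (α := α) (β := β) hx n).1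
  have h1 : 0 ≤ ⌊β * (Tab α β)^[n] x + α⌋ := Int.floor_nonneg.2 (by positivity)
  unfold code
  have := Int.toNat_of_nonneg h1
  exact_mod_cast this

theorem code_lt {α β x : ℝ} (hα : α ∈ Ico (0:ℝ) 1) (hβ : 0 ≤ β) (hx : x ∈ Ico (0:ℝ) 1) (n : ℕ) {L : ℕ}
    (hL : β + 1 ≤ L) : code α β x n < L := by
  have h0 := (Tab_iter_mem (α := α) (β := β) hx n)
  have h1 := code_floor hα.1 hβ hx n
  have h2 := Int.floor_le (β * (Tab α β)^[n] x + α)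
  have : ((code α β x n : ℕ) : ℝ) < L := by
    rw [h1]
    have : β * (Tab α β)^[n] x ≤ β * 1 := mul_le_mul_of_nonneg_left h0.2.le hβ
    linarith [hα.2]
  exact_mod_cast this

section proj
variable (α β : ℝ) {L : ℕ}

noncomputable def prj (y : ℕ → Fin L) : ℝ := ∑' n : ℕ, (((y n : ℕ) : ℝ) - α) / β ^ (n+1)
def shF (y : ℕ → Fin L) : ℕ → Fin L := fun n => y (n+1)
def embF (y : ℕ → Fin L) : ℕ → ℕ := fun n => (y n : ℕ)

theorem shF_cont : Continuous (shF (L := L)) := by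
  unfold shF; fun_prop

theorem embF_cont : Continuous (embF (L := L)) :=
  continuous_pi fun n => (continuous_of_discreteTopology (f := fun i : Fin L => (i : ℕ))).comp
    (continuous_apply n)

theorem prj_term_bound {β : ℝ} (hβ : 1 < β) (y : ℕ → Fin L) (n : ℕ) :
    ‖(((y n : ℕ) : ℝ) - α) / β ^ (n+1)‖ ≤ (L + |α|) * β⁻¹ ^ (n+1) := by
  have hβ0 : (0:ℝ) < β := by linarith
  rw [norm_div, Real.norm_eq_abs, Real.norm_of_nonneg (by positivity : 0 ≤ β ^ (n+1)), inv_pow,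
    div_eq_mul_inv]
  gcongr
  refine (abs_sub _ _).trans ?_
  have : ((y n : ℕ) : ℝ) ≤ L := by exact_mod_cast (y n).2.le
  rw [abs_of_nonneg (by positivity)]
  linarith

theorem prj_summable {β : ℝ} (hβ : 1 < β) (y : ℕ → Fin L) :
    Summable (fun n : ℕ => (((y n : ℕ) : ℝ) - α) / β ^ (n+1)) :=
  Summable.of_norm_bounded ((geo_summable hβ).mul_left _) (prj_term_bound α hβ y)

theorem prj_cont {β : ℝ} (hβ : 1 < β) : Continuous (prj α β (L := L)) := by
  refine continuous_tsum (fun n => ?_) ((geo_summable hβ).mul_left (L + |α|))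
    (fun n y => prj_term_bound α hβ y n)
  have : Continuous (fun y : ℕ → Fin L => ((y n : ℕ) : ℝ)) :=
    (continuous_of_discreteTopology (f := fun i : Fin L => ((i : ℕ) : ℝ))).comp (continuous_apply n)
  fun_prop

theorem prj_step {β : ℝ} (hβ : 1 < β) (y : ℕ → Fin L) :
    β * prj α β y + α = (y 0 : ℕ) + prj α β (shF y) := by
  have hβ0 : (0:ℝ) < β := by linarith
  unfold prj
  rw [(prj_summable α hβ y).tsum_eq_zero_add]
  have : ∑' b : ℕ, (((y (b+1) : ℕ) : ℝ) - α) / β ^ (b + 1 + 1) =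
      β⁻¹ * ∑' b : ℕ, (((shF y b : ℕ) : ℝ) - α) / β ^ (b + 1) := by
    rw [← tsum_mul_left]
    congr 1
    funext b
    simp only [shF]
    rw [pow_succ β (b+1)]
    field_simp
  rw [this]
  field_simp
  ring

theorem prj_code {α β x : ℝ} (hα : α ∈ Ico (0:ℝ) 1) (hβ : 1 < β) (hx : x ∈ Ico (0:ℝ) 1)
    {y : ℕ → Fin L} (hy : embF y = code α β x) : prj α β y = x := by
  have hβ0 : (0:ℝ) < β := by linarith
  have h1 := (prj_summable α hβ y).hasSum.tendsto_sum_nat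
  have h2 : ∀ N, ∑ n ∈ Finset.range N, (((y n : ℕ) : ℝ) - α) / β ^ (n+1) =
      x - (Tab α β)^[N] x / β ^ N := by
    intro N
    induction N with
    | zero => simp
    | succ N ih =>
      rw [Finset.sum_range_succ, ih, Tab_succ_eq hα.1 hβ0.le hx.1]
      have : ((y N : ℕ) : ℝ) = (code α β x N : ℝ) := by rw [← hy]; rfl
      rw [this, pow_succ]
      field_simp
      ring
  have h3 : Tendsto (fun N => x - (Tab α β)^[N] x / β ^ N) atTop (𝓝 x) := by
    have : Tendsto (fun N => (Tab α β)^[N] x / β ^ N) atTop (𝓝 0) := by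
      refine squeeze_zero_norm (a := fun N => β⁻¹ ^ N) (fun N => ?_)
        (tendsto_pow_atTop_nhds_zero_of_lt_one (by positivity) (inv_lt_one_of_one_lt₀ hβ))
      have := Tab_iter_mem (α := α) (β := β) hx N
      rw [Real.norm_of_nonneg (div_nonneg this.1 (by positivity)), inv_pow, div_eq_mul_inv]
      exact mul_le_of_le_one_left (by positivity) this.2.le
    simpa using this.const_sub x
  simp only [h2] at h1
  exact tendsto_nhds_unique h1 h3

end proj

theorem equi_of_AC {α β x : ℝ} (hα : α ∈ Ico (0:ℝ) 1) (hβ : 1 < β) (hx : x ∈ Ico (0:ℝ) 1)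
    (hAC : ACx α β x) (f : BoundedContinuousFunction (ℕ → ℕ) ℝ) :
    Tendsto (fun n : ℕ => (n : ℝ)⁻¹ * ∑ m ∈ Finset.range n, f (shiftN^[m] (code α β x)))
          atTop (nhds (∫ y, f y ∂((parryMeasure α β).map (code α β)))) := by
  have hβ0 : (0:ℝ) < β := by linarith
  rw [tendsto_iff_ultrafilter]
  intro U hU
  set L : ℕ := ⌈β⌉₊ + 1 with hLdef
  have hL : β + 1 ≤ L := by rw [hLdef]; push_cast; linarith [Nat.le_ceil β]
  -- the coded point
  let w : ℕ → Fin L := fun n => ⟨code α β x n, code_lt hα hβ0.le hx n hL⟩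
  have hw : embF w = code α β x := rfl
  have hemb_sh : ∀ m (y : ℕ → Fin L), embF (shF^[m] y) = shiftN^[m] (embF y) := by
    intro m
    induction m with
    | zero => intro y; rfl
    | succ m ih => intro y; rw [Function.iterate_succ_apply, Function.iterate_succ_apply, ih]; rfl
  have hprj_orb : ∀ m, prj α β (shF^[m] w) = (Tab α β)^[m] x := by
    intro m
    refine prj_code hα hβ (Tab_iter_mem hx m) ?_
    rw [hemb_sh, hw, shift_iter_code]
  obtain ⟨ν, hP, hν⟩ := exists_limit_measure (fun m => shF^[m] w) U hU
  have hinv := limit_invariant shF_cont hU hν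
  have hpc := prj_cont α hβ (L := L)
  have hinvk : ∀ k, ν.map (shF^[k]) = ν := by
    intro k
    induction k with
    | zero => simp
    | succ k ih =>
      rw [Function.iterate_succ', ← Measure.map_map shF_cont.measurable
        (shF_cont.iterate k).measurable, ih, hinv]
  -- push forward
  set κ := ν.map (prj α β) with hκ
  haveI : IsProbabilityMeasure κ := Measure.isProbabilityMeasure_map hpc.measurable.aemeasurable
  have hκint : ∀ g : ℝ → ℝ, Continuous g → Tendsto (avg (fun m => g ((Tab α β)^[m] x))) U
      (𝓝 (∫ y, g y ∂κ)) := by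
    intro g hg
    rw [hκ, integral_map hpc.measurable.aemeasurable hg.measurable.aestronglyMeasurable]
    have := hν (fun y => g (prj α β y)) (hg.comp hpc)
    simpa only [hprj_orb] using this
  obtain ⟨C, hC, hAC⟩ := hAC
  have hbd : ∀ E, MeasurableSet E → volume E ≠ ⊤ → κ.real E ≤ C * √(volume.real E) := by
    intro E hE hEf
    refine measure_bound_of_functional hC (fun g hg hg01 => ?_) hE hEf
    refine le_of_forall_pos_le_add fun ε hε => ?_
    exact le_of_tendsto (hκint g hg) (hU (hAC g hg hg01 ε hε))
  have hκIcc : ∀ᵐ t ∂κ, t ∈ Icc (0:ℝ) 1 := by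
    have h1 := hκint (fun t => min 1 (Metric.infDist t (Icc (0:ℝ) 1)))
      (continuous_const.min (Metric.continuous_infDist_pt _))
    have h2 : avg (fun m => min 1 (Metric.infDist ((Tab α β)^[m] x) (Icc (0:ℝ) 1))) = fun _ => 0 := by
      funext n
      unfold avg
      rw [Finset.sum_eq_zero, mul_zero]
      intro m _
      rw [Metric.infDist_zero_of_mem (Ico_subset_Icc_self (Tab_iter_mem hx m))]; simp
    rw [h2] at h1
    have h3 := tendsto_nhds_unique h1 tendsto_const_nhds
    rw [integral_eq_zero_iff_of_nonneg (fun t => le_min zero_le_one Metric.infDist_nonneg)] at h3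
    · filter_upwards [h3] with t ht
      have ht' : min 1 (Metric.infDist t (Icc (0:ℝ) 1)) = 0 := ht
      have : Metric.infDist t (Icc (0:ℝ) 1) = 0 := by
        rcases min_choice 1 (Metric.infDist t (Icc (0:ℝ) 1)) with h | h
        · rw [h] at ht'; norm_num at ht'
        · rw [h] at ht'; exact ht'
      exact (isClosed_Icc.mem_iff_infDist_zero ⟨0, by simp⟩).2 this
    · refine Integrable.of_bound (C := 1) (continuous_const.min
        (Metric.continuous_infDist_pt _)).measurable.aestronglyMeasurable
        (Eventually.of_forall fun t => ?_)
      rw [Real.norm_of_nonneg (le_min zero_le_one Metric.infDist_nonneg)]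
      exact min_le_left _ _
  have hκ1 : ∀ᵐ t ∂κ, t ≠ 1 := by
    have h := hbd {1} (measurableSet_singleton 1) (by simp)
    have h2 : volume.real ({1} : Set ℝ) = 0 := by rw [measureReal_def, measure_singleton]; rfl
    rw [h2, Real.sqrt_zero, mul_zero] at h
    have h3 : κ.real {1} = 0 := le_antisymm h measureReal_nonneg
    rw [measureReal_eq_zero_iff] at h3
    exact compl_mem_ae_iff.2 h3
  have hκIco : ∀ᵐ t ∂κ, t ∈ Ico (0:ℝ) 1 := by
    filter_upwards [hκIcc, hκ1] with t h1 h2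
    exact ⟨h1.1, lt_of_le_of_ne h1.2 h2⟩
  have hνall : ∀ᵐ y ∂ν, ∀ k, prj α β (shF^[k] y) ∈ Ico (0:ℝ) 1 := by
    rw [ae_all_iff]
    intro k
    have h1 : ∀ᵐ y ∂ν, prj α β y ∈ Ico (0:ℝ) 1 := ae_of_ae_map hpc.measurable.aemeasurable hκIco
    rw [← hinvk k] at h1
    exact ae_of_ae_map (shF_cont.iterate k).measurable.aemeasurable h1
  have hstep : ∀ᵐ y ∂ν, (∀ k, (Tab α β)^[k] (prj α β y) = prj α β (shF^[k] y)) ∧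
      code α β (prj α β y) = embF y := by
    filter_upwards [hνall] with y hy
    have hd : ∀ k, ⌊β * prj α β (shF^[k] y) + α⌋ = (y k : ℕ) ∧
        Tab α β (prj α β (shF^[k] y)) = prj α β (shF^[k+1] y) := by
      intro k
      have h1 := prj_step α hβ (shF^[k] y)
      have h2 : (shF^[k] y) 0 = y k := by
        have : ∀ k (z : ℕ → Fin L) j, (shF^[k] z) j = z (j + k) := by
          intro k
          induction k with
          | zero => intro z j; rfl
          | succ k ih => intro z j; rw [Function.iterate_succ_apply, ih]; rfl
        rw [this]; simp
      rw [h2, ← Function.iterate_succ_apply' shF] at h1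
      have h3 := hy (k+1)
      unfold Tab
      rw [h1]
      constructor
      · rw [Int.floor_eq_iff]; push_cast; constructor <;> linarith [h3.1, h3.2]
      · rw [Int.fract_natCast_add]; exact Int.fract_eq_self.2 h3
    have hit : ∀ k, (Tab α β)^[k] (prj α β y) = prj α β (shF^[k] y) := by
      intro k
      induction k with
      | zero => rfl
      | succ k ih => rw [Function.iterate_succ_apply', ih, (hd k).2]
    refine ⟨hit, ?_⟩
    funext k
    unfold code
    rw [hit, (hd k).1]; simp [embF]
  have hgood : GoodM α β κ := by
    refine ⟨inferInstance, ⟨measurable_Tab α β, ?_⟩, C, hC, hbd⟩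
    rw [hκ, Measure.map_map (measurable_Tab α β) hpc.measurable]
    have : ν.map (Tab α β ∘ prj α β) = ν.map (prj α β ∘ shF) := by
      refine Measure.map_congr ?_
      filter_upwards [hstep] with y hy
      exact hy.1 1
    rw [this, ← Measure.map_map hpc.measurable shF_cont.measurable, hinv]
  have hκμ : κ = parryMeasure α β := hgood.unique hβ (parryMeasure_good hα hβ)
  have hfin : (parryMeasure α β).map (code α β) = ν.map embF := by
    rw [← hκμ, hκ, Measure.map_map (measurable_code α β) hpc.measurable]
    refine Measure.map_congr ?_
    filter_upwards [hstep] with y hy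
    exact hy.2
  rw [hfin, integral_map embF_cont.measurable.aemeasurable f.continuous.measurable.aestronglyMeasurable]
  have := hν (fun y => f (embF y)) (f.continuous.comp embF_cont)
  simp only [hemb_sh, hw] at this
  exact this


def SameW (α x : ℝ) (n : ℕ) (β β' : ℝ) : Prop := ∀ i < n, code α β x i = code α β' x i

theorem SameW.symm {α x : ℝ} {n : ℕ} {β β' : ℝ} (h : SameW α x n β β') : SameW α x n β' β :=
  fun i hi => (h i hi).symm
theorem SameW.trans {α x : ℝ} {n : ℕ} {β β' β'' : ℝ} (h : SameW α x n β β')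
    (h' : SameW α x n β' β'') : SameW α x n β β'' :=
  fun i hi => (h i hi).trans (h' i hi)
theorem SameW.mono {α x : ℝ} {n m : ℕ} {β β' : ℝ} (h : SameW α x n β β') (hm : m ≤ n) :
    SameW α x m β β' := fun i hi => h i (lt_of_lt_of_le hi hm)

theorem xi_diff {α x β β' : ℝ} (hα : 0 ≤ α) (hx : 0 ≤ x) (hβ : 0 ≤ β) (hβ' : 0 ≤ β') {n : ℕ}
    (h : SameW α x (n+1) β β') :
    (Tab α β')^[n+1] x - (Tab α β)^[n+1] x =
      (β' - β) * (Tab α β)^[n] x + β' * ((Tab α β')^[n] x - (Tab α β)^[n] x) := by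
  rw [Tab_succ_eq hα hβ' hx, Tab_succ_eq hα hβ hx, h n (by omega)]
  ring

theorem xi_mono {α x β β' : ℝ} (hα : 0 ≤ α) (hx : x ∈ Icc (0:ℝ) 1) (hβ : 0 ≤ β) (hββ : β ≤ β') :
    ∀ n : ℕ, SameW α x n β β' → (Tab α β)^[n] x ≤ (Tab α β')^[n] x := by
  intro n
  induction n with
  | zero => intro _; simp
  | succ n ih =>
    intro h
    have h1 := ih (h.mono (by omega))
    have h2 := xi_diff hα hx.1 hβ (hβ.trans hββ) h
    have h3 := (Tab_iter_mem' (α := α) (β := β) hx n).1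
    have : 0 ≤ (β' - β) * (Tab α β)^[n] x := mul_nonneg (by linarith) h3
    have : 0 ≤ β' * ((Tab α β')^[n] x - (Tab α β)^[n] x) := mul_nonneg (by linarith) (by linarith)
    linarith

theorem xi_upper {α x β β' : ℝ} (hα : 0 ≤ α) (hx : x ∈ Icc (0:ℝ) 1) (hβ : 1 < β) (hββ : β ≤ β') :
    ∀ n : ℕ, SameW α x n β β' →
      ((Tab α β')^[n] x - (Tab α β)^[n] x) * (β' - 1) ≤ (β' - β) * (β' ^ n - 1) := by
  intro n
  induction n with
  | zero => intro _; simp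
  | succ n ih =>
    intro h
    have h1 := ih (h.mono (by omega))
    have h2 := xi_diff hα hx.1 (by linarith) (by linarith) h
    have h3 := (Tab_iter_mem' (α := α) (β := β) hx n).2
    rw [h2, pow_succ]
    have e1 : (β' - β) * (Tab α β)^[n] x * (β' - 1) ≤ (β' - β) * 1 * (β' - 1) := by
      have : 0 ≤ β' - β := by linarith
      have : 0 ≤ β' - 1 := by linarith
      gcongr
    have e2 := mul_le_mul_of_nonneg_left h1 (by linarith : 0 ≤ β')
    nlinarith

theorem xi_upper' {α x β β' b : ℝ} (hα : 0 ≤ α) (hx : x ∈ Icc (0:ℝ) 1) (hb : 1 < b) (hbβ : b ≤ β)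
    (hββ : β ≤ β') (n : ℕ) (h : SameW α x n β β') :
      ((Tab α β')^[n] x - (Tab α β)^[n] x) ≤ (β' - β) * β' ^ n / (b - 1) := by
  have h1 := xi_upper hα hx (hb.trans_le hbβ) hββ n h
  have h2 := xi_mono hα hx (by linarith) hββ n h
  rw [le_div_iff₀ (by linarith)]
  have e1 : ((Tab α β')^[n] x - (Tab α β)^[n] x) * (b - 1) ≤
      ((Tab α β')^[n] x - (Tab α β)^[n] x) * (β' - 1) := by
    apply mul_le_mul_of_nonneg_left <;> linarith
  have : (β' - β) * (β' ^ n - 1) ≤ (β' - β) * β' ^ n := by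
    apply mul_le_mul_of_nonneg_left <;> linarith
  linarith

/-- propagation of lower bounds -/
theorem xi_lower_prop {α x β β' : ℝ} (hα : 0 ≤ α) (hx : x ∈ Icc (0:ℝ) 1) (hβ : 0 ≤ β) (hββ : β ≤ β')
    {k : ℕ} {e : ℝ} (he : SameW α x k β β' → e ≤ (Tab α β')^[k] x - (Tab α β)^[k] x) (n : ℕ) :
    SameW α x (k+n) β β' → e * β' ^ n ≤ (Tab α β')^[k+n] x - (Tab α β)^[k+n] x := by
  induction n with
  | zero => intro h; simpa using he h
  | succ n ih =>
    intro h
    have h1 := ih (h.mono (by omega))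
    have h2 := xi_diff hα hx.1 hβ (by linarith) (n := k + n) h
    have h3 := (Tab_iter_mem' (α := α) (β := β) hx (k+n)).1
    rw [← add_assoc, h2, pow_succ]
    have : 0 ≤ (β' - β) * (Tab α β)^[k+n] x := mul_nonneg (by linarith) h3
    have := mul_le_mul_of_nonneg_left h1 (by linarith : 0 ≤ β')
    linarith

theorem xi_lower1 {α x β β' : ℝ} (hα : 0 ≤ α) (hx : x ∈ Icc (0:ℝ) 1) (hβ : 0 ≤ β) (hββ : β ≤ β')
    (n : ℕ) (h : SameW α x (1+n) β β') :
    x * (β' - β) * β' ^ n ≤ (Tab α β')^[1+n] x - (Tab α β)^[1+n] x := by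
  refine xi_lower_prop hα hx hβ hββ (fun h => ?_) n h
  have := xi_diff hα hx.1 hβ (by linarith) (n := 0) h
  simp only [Function.iterate_zero, id, zero_add] at this
  rw [this]; linarith

theorem Tab_zero {α β : ℝ} (hα : α ∈ Ico (0:ℝ) 1) : Tab α β 0 = α := by
  simp [Tab, Int.fract_eq_self.2 hα]

theorem xi_lower2 {α β β' : ℝ} (hα : α ∈ Ico (0:ℝ) 1) (hβ : 0 ≤ β) (hββ : β ≤ β')
    (n : ℕ) (h : SameW α 0 (2+n) β β') :
    α * (β' - β) * β' ^ n ≤ (Tab α β')^[2+n] 0 - (Tab α β)^[2+n] 0 := by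
  refine xi_lower_prop hα.1 (by simp) hβ hββ (fun h => ?_) n h
  have := xi_diff hα.1 le_rfl hβ (by linarith) (n := 1) h
  simp only [Function.iterate_one, Tab_zero hα, Nat.reduceAdd] at this
  rw [this]; linarith

theorem xi_lower {α x B : ℝ} (hα : α ∈ Ico (0:ℝ) 1) (hx : x ∈ Icc (0:ℝ) 1) (hxα : (x, α) ≠ (0,0))
    (hB : 1 < B) :
    ∃ c > 0, ∀ β β' : ℝ, 0 ≤ β → β ≤ β' → β' ≤ B → ∀ n, 2 ≤ n → SameW α x n β β' →
      c * ((β' - β) * β' ^ n) ≤ (Tab α β')^[n] x - (Tab α β)^[n] x := by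
  rcases eq_or_lt_of_le hx.1 with h0 | h0
  · subst h0
    have hα0 : 0 < α := lt_of_le_of_ne hα.1 (fun h => hxα (by rw [← h]))
    refine ⟨α / B ^ 2, by positivity, fun β β' hβ hββ hB' n hn h => ?_⟩
    obtain ⟨n, rfl⟩ := Nat.exists_eq_add_of_le hn
    refine le_trans ?_ (xi_lower2 hα hβ hββ n h)
    rw [pow_add]
    have h1 : β' ^ 2 / B ^ 2 ≤ 1 := by
      rw [div_le_one (by positivity)]; gcongr; linarith
    have h2 : 0 ≤ α * (β' - β) * β' ^ n := by
      have : 0 ≤ β' - β := by linarith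
      have : 0 ≤ β' := by linarith
      positivity
    calc _ = (α * (β' - β) * β' ^ n) * (β' ^ 2 / B ^ 2) := by ring
      _ ≤ _ := mul_le_of_le_one_right h2 h1
  · refine ⟨x / B, by positivity, fun β β' hβ hββ hB' n hn h => ?_⟩
    obtain ⟨n, rfl⟩ := Nat.exists_eq_add_of_le (show 1 ≤ n by omega)
    refine le_trans ?_ (xi_lower1 hα.1 hx hβ hββ n h)
    rw [pow_add]
    have h1 : β' / B ≤ 1 := by
      rw [div_le_one (by positivity)]; linarith
    have h2 : 0 ≤ x * (β' - β) * β' ^ n := by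
      have : 0 ≤ β' - β := by linarith
      have : 0 ≤ β' := by linarith
      have := hx.1
      positivity
    calc _ = (x * (β' - β) * β' ^ n) * (β' / B) := by ring
      _ ≤ _ := mul_le_of_le_one_right h2 h1

/-- cells are order connected -/
theorem same_between {α x β₁ β₂ β₃ : ℝ} (hα : 0 ≤ α) (hx : x ∈ Icc (0:ℝ) 1) (hβ : 0 ≤ β₁)
    (h12 : β₁ ≤ β₂) (h23 : β₂ ≤ β₃) : ∀ n, SameW α x n β₁ β₃ → SameW α x n β₁ β₂ := by
  intro n
  induction n with
  | zero => intro _ i hi; omega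
  | succ n ih =>
    intro h i hi
    have h1 := ih (h.mono (by omega))
    rcases Nat.lt_succ_iff_lt_or_eq.1 hi with h' | rfl
    · exact h1 i h'
    have h0 := h.mono (show i ≤ i + 1 by omega)
    have m1 := xi_mono hα hx hβ h12 i h1
    have m2 := xi_mono hα hx (hβ.trans h12) h23 i (h1.symm.trans h0)
    have p1 := (Tab_iter_mem' (α := α) (β := β₁) hx i).1
    have a1 : β₁ * (Tab α β₁)^[i] x + α ≤ β₂ * (Tab α β₂)^[i] x + α := by
      have : 0 ≤ β₂ := by linarith
      gcongr
    have a2 : β₂ * (Tab α β₂)^[i] x + α ≤ β₃ * (Tab α β₃)^[i] x + α := by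
      have : 0 ≤ β₃ := by linarith
      have : 0 ≤ (Tab α β₂)^[i] x := by linarith
      gcongr
    have e := h i hi
    unfold code at e ⊢
    have f1 := Int.toNat_le_toNat (Int.floor_le_floor a1)
    have f2 := Int.toNat_le_toNat (Int.floor_le_floor a2)
    omega


def GenericB (α β : ℝ) : Prop :=
  ∀ k : ℕ, (Tab α β)^[k+1] 1 ≠ 0 ∧ (0 < α → (Tab α β)^[k+1] 0 ≠ 0)

theorem countable_zero_set {α t : ℝ} {n : ℕ}
    (h : ∀ β β' : ℝ, 1 < β → β < β' → SameW α t n β β' → (Tab α β)^[n] t < (Tab α β')^[n] t) :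
    {β : ℝ | 1 < β ∧ (Tab α β)^[n] t = 0}.Countable := by
  have hinj : InjOn (fun β => (fun i : Fin n => code α β t i)) {β : ℝ | 1 < β ∧ (Tab α β)^[n] t = 0} := by
    have key : ∀ β β' : ℝ, 1 < β → (Tab α β)^[n] t = 0 → (Tab α β')^[n] t = 0 → β < β' →
        (fun i : Fin n => code α β t i) = (fun i : Fin n => code α β' t i) → False := by
      intro β β' h1 h0 h0' hlt he
      have := h β β' h1 hlt (fun i hi => congrFun he ⟨i, hi⟩)
      rw [h0, h0'] at this
      exact lt_irrefl _ this
    intro β hβ β' hβ' he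
    rcases lt_trichotomy β β' with hlt | heq | hgt
    · exact (key β β' hβ.1 hβ.2 hβ'.2 hlt he).elim
    · exact heq
    · exact (key β' β hβ'.1 hβ'.2 hβ.2 hgt he.symm).elim
  exact Set.MapsTo.countable_of_injOn (fun β _ => mem_univ _) hinj countable_univ

theorem countable_nongeneric {α : ℝ} (hα : α ∈ Ico (0:ℝ) 1) :
    {β : ℝ | 1 < β ∧ ¬ GenericB α β}.Countable := by
  have h1 : ∀ k : ℕ, {β : ℝ | 1 < β ∧ (Tab α β)^[k+1] 1 = 0}.Countable := by
    intro k
    refine countable_zero_set fun β β' hβ hlt hs => ?_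
    rw [add_comm] at hs ⊢
    have := xi_lower1 hα.1 (by simp) (by linarith) hlt.le k hs
    have h2 : 0 < 1 * (β' - β) * β' ^ k := by
      have : 0 < β' - β := by linarith
      have : 0 < β' := by linarith
      positivity
    linarith
  have h0 : 0 < α → ∀ k : ℕ, {β : ℝ | 1 < β ∧ (Tab α β)^[k+1] 0 = 0}.Countable := by
    intro hα0 k
    rcases Nat.eq_zero_or_pos k with rfl | hk
    · convert! countable_empty using 1
      ext β
      simp only [zero_add, Function.iterate_one, Tab_zero hα, mem_ofPred_eq, mem_empty_iff_false,
        iff_false]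
      intro h; linarith [h.2]
    obtain ⟨k, rfl⟩ := Nat.exists_eq_add_of_le hk
    refine countable_zero_set fun β β' hβ hlt hs => ?_
    rw [show 1 + k + 1 = 2 + k by ring] at hs ⊢
    have := xi_lower2 hα (by linarith) hlt.le k hs
    have h2 : 0 < α * (β' - β) * β' ^ k := by
      have : 0 < β' - β := by linarith
      have : 0 < β' := by linarith
      positivity
    linarith
  by_cases hα0 : 0 < α
  · refine ((countable_iUnion h1).union (countable_iUnion (h0 hα0))).mono ?_
    rintro β ⟨hβ, hn⟩
    unfold GenericB at hn
    push Not at hn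
    obtain ⟨k, hk⟩ := hn
    by_cases hh : (Tab α β)^[k+1] 1 = 0
    · exact Or.inl (mem_iUnion.2 ⟨k, hβ, hh⟩)
    · exact Or.inr (mem_iUnion.2 ⟨k, hβ, (hk hh).2⟩)
  · refine (countable_iUnion h1).mono ?_
    rintro β ⟨hβ, hn⟩
    unfold GenericB at hn
    push Not at hn
    obtain ⟨k, hk⟩ := hn
    by_cases hh : (Tab α β)^[k+1] 1 = 0
    · exact (mem_iUnion.2 ⟨k, hβ, hh⟩)
    · exact (hα0 (hk hh).1).elim

theorem floor_eventually {v : ℝ} (hv : Int.fract v ≠ 0) : ∀ᶠ u in 𝓝 v, ⌊u⌋ = ⌊v⌋ := by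
  have h1 : (⌊v⌋ : ℝ) < v := by
    have := Int.floor_add_fract v
    have := (Int.fract_nonneg v).lt_of_ne' hv
    linarith
  filter_upwards [Ioo_mem_nhds h1 (Int.lt_floor_add_one v)] with u hu
  exact Int.floor_eq_iff.2 ⟨hu.1.le, hu.2⟩

theorem cont_code {α β₀ t₀ : ℝ} : ∀ N : ℕ, (∀ k < N, (Tab α β₀)^[k+1] t₀ ≠ 0) →
    ContinuousAt (fun p : ℝ × ℝ => (Tab α p.1)^[N] p.2) (β₀, t₀) ∧
    ∀ᶠ p : ℝ × ℝ in 𝓝 (β₀, t₀), ∀ i < N, code α p.1 p.2 i = code α β₀ t₀ i := by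
  intro N
  induction N with
  | zero =>
    intro _
    exact ⟨by simpa using continuousAt_snd, Eventually.of_forall fun p i hi => by omega⟩
  | succ N ih =>
    intro h
    obtain ⟨hc, he⟩ := ih (fun k hk => h k (by omega))
    have hv : ContinuousAt (fun p : ℝ × ℝ => p.1 * (Tab α p.1)^[N] p.2 + α) (β₀, t₀) :=
      (continuousAt_fst.mul hc).add continuousAt_const
    have hne : Int.fract (β₀ * (Tab α β₀)^[N] t₀ + α) ≠ 0 := by
      have := h N (by omega)
      rw [Function.iterate_succ_apply'] at this
      exact this
    have hfl := hv.eventually (floor_eventually hne)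
    constructor
    · have : ContinuousAt (fun p : ℝ × ℝ => p.1 * (Tab α p.1)^[N] p.2 + α -
        (⌊β₀ * (Tab α β₀)^[N] t₀ + α⌋ : ℝ)) (β₀, t₀) := hv.sub continuousAt_const
      refine this.congr ?_
      filter_upwards [hfl] with p hp
      rw [Function.iterate_succ_apply', Tab, Int.fract, hp]
    · filter_upwards [he, hfl] with p h1 h2 i hi
      rcases Nat.lt_succ_iff_lt_or_eq.1 hi with h' | rfl
      · exact h1 i h'
      · unfold code; rw [h2]

/-- hypothesis : N-digit codes constant near the end points -/
def EndConst (α b B η : ℝ) (N : ℕ) : Prop :=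
  (∀ β ∈ Ioo b B, ∀ β' ∈ Ioo b B, ∀ t ∈ Ico 0 η, ∀ t' ∈ Ico 0 η, ∀ i < N,
    code α β t i = code α β' t' i) ∧
  (∀ β ∈ Ioo b B, ∀ β' ∈ Ioo b B, ∀ t ∈ Ioo (1-η) 1, ∀ t' ∈ Ioo (1-η) 1, ∀ i < N,
    code α β t i = code α β' t' i)

theorem small_code {β t : ℝ} (hβ : 0 ≤ β) (ht : 0 ≤ t) : ∀ N : ℕ, (∀ i ≤ N, β ^ i * t < 1) →
    (Tab 0 β)^[N] t = β ^ N * t := by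
  intro N
  induction N with
  | zero => intro _; simp
  | succ N ih =>
    intro h
    rw [Function.iterate_succ_apply', ih (fun i hi => h i (by omega)), Tab, add_zero, ← mul_assoc,
      ← pow_succ']
    exact Int.fract_eq_self.2 ⟨by positivity, h _ le_rfl⟩

theorem exists_endConst {α β₀ : ℝ} (hα : α ∈ Ico (0:ℝ) 1) (hβ₀ : 1 < β₀) (hg : GenericB α β₀) (N : ℕ)
    {b₀ : ℝ} (hb₀ : b₀ < β₀) {B₀ : ℝ} (hB₀ : β₀ < B₀) :
    ∃ b B η : ℝ, b₀ ≤ b ∧ b < β₀ ∧ β₀ < B ∧ B ≤ B₀ ∧ 0 < η ∧ η ≤ 1/2 ∧ EndConst α b B η N := by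
  have near : ∀ t₀ : ℝ, (∀ k < N, (Tab α β₀)^[k+1] t₀ ≠ 0) → ∃ e > 0, ∀ β t, |β - β₀| < e →
      |t - t₀| < e → ∀ i < N, code α β t i = code α β₀ t₀ i := by
    intro t₀ h
    obtain ⟨e, he, hh⟩ := Metric.eventually_nhds_iff.1 (cont_code N h).2
    refine ⟨e, he, fun β t h1 h2 => hh (y := (β, t)) ?_⟩
    rw [Prod.dist_eq]
    exact max_lt h1 h2
  obtain ⟨e1, he1, h1⟩ := near 1 (fun k _ => (hg k).1)
  have zero : ∃ e > 0, ∀ β t, |β - β₀| < e → t ∈ Ico 0 e → ∀ i < N, code α β t i = code α β₀ 0 i := by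
    rcases eq_or_lt_of_le hα.1 with h | h
    · subst h
      set M := (β₀ + 1) ^ N with hM
      have hM1 : 0 < M := by positivity
      refine ⟨min 1 M⁻¹, by positivity, fun β t hβ ht i hi => ?_⟩
      have a1 : β < β₀ + 1 := by
        have := (abs_lt.1 (hβ.trans_le (min_le_left _ _))).2; linarith
      have a0 : 0 ≤ β := by
        have := (abs_lt.1 (hβ.trans_le (min_le_left _ _))).1; linarith
      have a2 : ∀ i ≤ N, β ^ i * t < 1 := by
        intro i hi
        have : β ^ i ≤ M := by
          calc β ^ i ≤ (β₀ + 1) ^ i := by gcongr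
            _ ≤ _ := pow_le_pow_right₀ (by linarith) hi
        have h3 : t < M⁻¹ := ht.2.trans_le (min_le_right _ _)
        calc β ^ i * t ≤ M * t := by gcongr; exact ht.1
          _ < M * M⁻¹ := by gcongr
          _ = 1 := mul_inv_cancel₀ hM1.ne'
      unfold code
      rw [small_code a0 ht.1 i (fun j hj => a2 j (by omega)),
        small_code (by linarith) le_rfl i (by simp)]
      have := a2 (i+1) (by omega)
      have e1 : ⌊β * (β ^ i * t) + 0⌋ = 0 := by
        rw [Int.floor_eq_zero_iff, add_zero, ← mul_assoc, ← pow_succ']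
        exact ⟨by have := ht.1; positivity, this⟩
      rw [e1]; simp
    · obtain ⟨e, he, hh⟩ := near 0 (fun k _ => (hg k).2 h)
      refine ⟨e, he, fun β t hβ ht i hi => hh β t hβ ?_ i hi⟩
      rw [sub_zero, abs_of_nonneg ht.1]; exact ht.2
  obtain ⟨e0, he0, h0⟩ := zero
  set e := min e0 e1 with hee
  have hepos : 0 < e := lt_min he0 he1
  have habs : ∀ β ∈ Ioo (max b₀ (β₀ - e)) (min B₀ (β₀ + e)), |β - β₀| < e := by
    intro β hβ
    have := (max_lt_iff.1 hβ.1).2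
    have := (lt_min_iff.1 hβ.2).2
    rw [abs_lt]; constructor <;> linarith
  refine ⟨max b₀ (β₀ - e), min B₀ (β₀ + e), min (1/2) e, le_max_left _ _, max_lt hb₀ (by linarith),
    lt_min hB₀ (by linarith), min_le_left _ _, by positivity, min_le_left _ _, ?_, ?_⟩
  · intro β hβ β' hβ' t ht t' ht' i hi
    have hm : min (1/2) e ≤ e0 := (min_le_right _ _).trans (min_le_left _ _)
    rw [h0 β t ((habs β hβ).trans_le (min_le_left _ _)) ⟨ht.1, ht.2.trans_le hm⟩ i hi,
      h0 β' t' ((habs β' hβ').trans_le (min_le_left _ _)) ⟨ht'.1, ht'.2.trans_le hm⟩ i hi]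
  · intro β hβ β' hβ' t ht t' ht' i hi
    have hm : min (1/2) e ≤ e1 := (min_le_right _ _).trans (min_le_right _ _)
    rw [h1 β t ((habs β hβ).trans_le (min_le_right _ _)) (by
        rw [abs_lt]; constructor <;> linarith [ht.1, ht.2]) i hi,
      h1 β' t' ((habs β' hβ').trans_le (min_le_right _ _)) (by
        rw [abs_lt]; constructor <;> linarith [ht'.1, ht'.2]) i hi]

theorem EndConst.mono {α b B η : ℝ} {N M : ℕ} (h : EndConst α b B η N) (hM : M ≤ N) :
    EndConst α b B η M :=
  ⟨fun β hβ β' hβ' t ht t' ht' i hi => h.1 β hβ β' hβ' t ht t' ht' i (by omega),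
   fun β hβ β' hβ' t ht t' ht' i hi => h.2 β hβ β' hβ' t ht t' ht' i (by omega)⟩

theorem code_succ (α β t : ℝ) (i : ℕ) : code α β t (i+1) = code α β (Tab α β t) i := by
  rw [code_Tab]; rfl

/-- at most two continuations -/
theorem two_children {α b B η : ℝ} (hα : 0 ≤ α) (hb : 1 < b) (hη : η ≤ 1/2) : ∀ N : ℕ,
    EndConst α b B η N → ∀ δ : ℝ, 0 ≤ δ → (B + 1) ^ N * δ < η → ∀ E : Set (ℝ × ℝ),
    (∀ p ∈ E, p.1 ∈ Ioo b B ∧ p.2 ∈ Ico (0:ℝ) 1) →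
    (∀ p ∈ E, ∀ q ∈ E, |p.1 - q.1| ≤ δ ∧ |p.2 - q.2| ≤ δ) →
    ∃ w₁ w₂ : ℕ → ℕ, ∀ p ∈ E, (∀ i < N, code α p.1 p.2 i = w₁ i) ∨ (∀ i < N, code α p.1 p.2 i = w₂ i) := by
  intro N
  induction N with
  | zero => intro _ _ _ _ E _ _; exact ⟨0, 0, fun p _ => Or.inl fun i hi => by omega⟩
  | succ N ih =>
    intro hEC δ hδ hδη E hE hosc
    by_cases hne : E.Nonempty
    swap
    · exact ⟨0, 0, fun p hp => (hne ⟨p, hp⟩).elim⟩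
    obtain ⟨p₀, hp₀⟩ := hne
    have hB : 1 < B := hb.trans ((hE p₀ hp₀).1.1.trans (hE p₀ hp₀).1.2)
    set v : ℝ × ℝ → ℝ := fun p => p.1 * p.2 + α with hv
    have hδ1 : (B + 1) * δ < η := by
      refine lt_of_le_of_lt ?_ hδη
      have : (B+1) ^ 1 ≤ (B+1) ^ (N+1) := pow_le_pow_right₀ (by linarith) (by omega)
      rw [pow_one] at this
      gcongr
    have hvo : ∀ p ∈ E, ∀ q ∈ E, |v p - v q| ≤ (B + 1) * δ := by
      intro p hp q hq
      have h1 := hosc p hp q hq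
      have hq' := hE q hq
      have hp' := hE p hp
      have : v p - v q = (p.1 - q.1) * q.2 + p.1 * (p.2 - q.2) := by simp only [hv]; ring
      rw [this]
      calc _ ≤ |(p.1 - q.1) * q.2| + |p.1 * (p.2 - q.2)| := abs_add_le _ _
        _ = |p.1 - q.1| * q.2 + p.1 * |p.2 - q.2| := by
            rw [abs_mul, abs_mul, abs_of_nonneg hq'.2.1, abs_of_nonneg (by linarith [hp'.1.1] : 0 ≤ p.1)]
        _ ≤ δ * 1 + B * δ := by
            have := hq'.2.1
            refine add_le_add (mul_le_mul h1.1 hq'.2.2.le hq'.2.1 hδ) (mul_le_mul hp'.1.2.le h1.2 (abs_nonneg _) (by linarith))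
        _ = _ := by ring
    have hc0 : ∀ p : ℝ × ℝ, code α p.1 p.2 0 = ⌊v p⌋.toNat := fun p => rfl
    have hT : ∀ p : ℝ × ℝ, Tab α p.1 p.2 = Int.fract (v p) := fun p => rfl
    by_cases hfl : ∀ p ∈ E, ⌊v p⌋ = ⌊v p₀⌋
    · obtain ⟨w₁, w₂, hw⟩ := ih (hEC.mono (by omega)) ((B+1) * δ) (by positivity)
        (by rw [← mul_assoc, ← pow_succ]; exact hδη) ((fun p => (p.1, Tab α p.1 p.2)) '' E)
        (by
          rintro _ ⟨p, hp, rfl⟩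
          exact ⟨(hE p hp).1, Tab_mem _ _ _⟩)
        (by
          rintro _ ⟨p, hp, rfl⟩ _ ⟨q, hq, rfl⟩
          refine ⟨(hosc p hp q hq).1.trans (by nlinarith), ?_⟩
          have := hvo p hp q hq
          simp only [hT, Int.fract, hfl p hp, hfl q hq]
          simpa using this)
      refine ⟨fun i => Nat.casesOn i ⌊v p₀⌋.toNat w₁, fun i => Nat.casesOn i ⌊v p₀⌋.toNat w₂, fun p hp => ?_⟩
      have hfp := hfl p hp
      rcases hw _ ⟨p, hp, rfl⟩ with h | h
      · left
        intro i hi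
        cases i with
        | zero => exact (hc0 p).trans (congrArg Int.toNat hfp)
        | succ i => rw [code_succ]; exact h i (by omega)
      · right
        intro i hi
        cases i with
        | zero => exact (hc0 p).trans (congrArg Int.toNat hfp)
        | succ i => rw [code_succ]; exact h i (by omega)
    · push Not at hfl
      obtain ⟨p₁, hp₁, hne⟩ := hfl
      -- ordered pair
      obtain ⟨a, ha, c, hc, hac⟩ : ∃ a ∈ E, ∃ c ∈ E, ⌊v a⌋ < ⌊v c⌋ := by
        rcases lt_or_gt_of_ne hne with h | h
        · exact ⟨p₁, hp₁, p₀, hp₀, h⟩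
        · exact ⟨p₀, hp₀, p₁, hp₁, h⟩
      set j := ⌊v c⌋ with hj
      have hjc : (j:ℝ) ≤ v c := Int.floor_le _
      have hja : v a < j := by
        rw [← Int.floor_lt]; exact hac
      have split : ∀ p ∈ E, (⌊v p⌋ = j - 1 ∧ Tab α p.1 p.2 ∈ Ioo (1-η) 1) ∨
          (⌊v p⌋ = j ∧ Tab α p.1 p.2 ∈ Ico 0 η) := by
        intro p hp
        have h1 := abs_le.1 (hvo p hp a ha)
        have h2 := abs_le.1 (hvo p hp c hc)
        rcases lt_or_ge (v p) j with h | h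
        · left
          have : ⌊v p⌋ = j - 1 := by
            rw [Int.floor_eq_iff]; push_cast; constructor <;> linarith
          refine ⟨this, ?_⟩
          rw [hT, Int.fract, this]; push_cast; constructor <;> linarith
        · right
          have : ⌊v p⌋ = j := by
            rw [Int.floor_eq_iff]; constructor <;> linarith
          refine ⟨this, ?_⟩
          rw [hT, Int.fract, this]; constructor <;> linarith
      refine ⟨code α a.1 a.2, code α c.1 c.2, fun p hp => ?_⟩
      have hEC' := hEC.mono (show N ≤ N + 1 by omega)
      have sa := split a ha
      have sc := split c hc
      have sa' : ⌊v a⌋ = j - 1 ∧ Tab α a.1 a.2 ∈ Ioo (1-η) 1 := by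
        rcases sa with h | h
        · exact h
        · omega
      have sc' : Tab α c.1 c.2 ∈ Ico 0 η := by
        rcases sc with h | h
        · omega
        · exact h.2
      rcases split p hp with h | h
      · left
        intro i hi
        cases i with
        | zero => rw [hc0, hc0, h.1, sa'.1]
        | succ i =>
          rw [code_succ, code_succ]
          exact hEC'.2 _ (hE p hp).1 _ (hE a ha).1 _ h.2 _ sa'.2 i (by omega)
      · right
        intro i hi
        cases i with
        | zero => rw [hc0, hc0, h.1]
        | succ i =>
          rw [code_succ, code_succ]
          exact hEC'.1 _ (hE p hp).1 _ (hE c hc).1 _ h.2 _ sc' i (by omega)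


theorem condExp_cell {Ω ι : Type*} {m0 : MeasurableSpace Ω} {μ : Measure Ω} [IsFiniteMeasure μ]
    [mι : MeasurableSpace ι] [Countable ι] [MeasurableSingletonClass ι] {W : Ω → ι}
    (hW : Measurable W) {f : Ω → ℝ} (hf : Integrable f μ) :
    ∀ᵐ β ∂μ, 0 < μ.real (W ⁻¹' {W β}) ∧
      (μ[f | MeasurableSpace.comap W mι]) β * μ.real (W ⁻¹' {W β}) =
        ∫ u in W ⁻¹' {W β}, f u ∂μ := by
  have hm : MeasurableSpace.comap W mι ≤ m0 := hW.comap_le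
  have hnull : ∀ᵐ β ∂μ, ∀ w : ι, μ (W ⁻¹' {w}) = 0 → W β ≠ w := by
    rw [ae_all_iff]
    intro w
    by_cases h : μ (W ⁻¹' {w}) = 0
    · have : ∀ᵐ β ∂μ, β ∉ W ⁻¹' {w} := compl_mem_ae_iff.2 h
      filter_upwards [this] with β hβ _
      exact hβ
    · exact Eventually.of_forall fun β h' => (h h').elim
  filter_upwards [hnull] with β hβ
  have hpos : 0 < μ.real (W ⁻¹' {W β}) :=
    ENNReal.toReal_pos (fun h => hβ _ h rfl) (measure_ne_top _ _)
  refine ⟨hpos, ?_⟩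
  have hcell : MeasurableSet[MeasurableSpace.comap W mι] (W ⁻¹' {W β}) :=
    ⟨{W β}, measurableSet_singleton _, rfl⟩
  rw [← setIntegral_condExp hm hf hcell]
  have hconst : ∀ u ∈ W ⁻¹' {W β}, (μ[f | MeasurableSpace.comap W mι]) u =
      (μ[f | MeasurableSpace.comap W mι]) β := by
    intro u hu
    have hms : MeasurableSet[MeasurableSpace.comap W mι]
        ((μ[f | MeasurableSpace.comap W mι]) ⁻¹' {(μ[f | MeasurableSpace.comap W mι]) β}) :=
      stronglyMeasurable_condExp.measurable (measurableSet_singleton _)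
    obtain ⟨A, -, hA⟩ := hms
    have h1 : β ∈ W ⁻¹' A := by rw [hA]; rfl
    have h2 : u ∈ W ⁻¹' A := by
      have : W u = W β := hu
      rw [mem_preimage, this]; exact h1
    rw [hA] at h2
    exact h2
  rw [setIntegral_congr_fun (hm _ hcell) hconst, setIntegral_const, smul_eq_mul, mul_comm]

theorem int_sq_sum {Ω : Type*} {m0 : MeasurableSpace Ω} {μ : Measure Ω} [IsFiniteMeasure μ]
    {D : ℕ → Ω → ℝ} (hD : ∀ n, MemLp (D n) 2 μ) {V : ℝ} (hV : ∀ n, ∫ u, D n u ^ 2 ∂μ ≤ V) {q : ℕ}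
    (horth : ∀ n m, n + q ≤ m → ∫ u, D n u * D m u ∂μ = 0) (n : ℕ) :
    ∫ u, (∑ m ∈ Finset.range n, D m u) ^ 2 ∂μ ≤ 2 * q * V * n := by
  have hV0 : 0 ≤ V := le_trans (integral_nonneg fun u => sq_nonneg _) (hV 0)
  have hint : ∀ i j, Integrable (fun u => D i u * D j u) μ := fun i j =>
    (hD i).integrable_mul (hD j)
  have hb : ∀ i j, ∫ u, D i u * D j u ∂μ ≤ V := by
    intro i j
    have h1 := (hD i).integrable_sq
    have h2 := (hD j).integrable_sq
    have : ∫ u, D i u * D j u ∂μ ≤ ∫ u, (D i u ^ 2 + D j u ^ 2) / 2 ∂μ := by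
      refine integral_mono (hint i j) ((h1.add h2).div_const 2) fun u => ?_
      show D i u * D j u ≤ (D i u ^ 2 + D j u ^ 2) / 2
      nlinarith [sq_nonneg (D i u - D j u)]
    rw [integral_div, integral_add h1 h2] at this
    linarith [hV i, hV j]
  have e1 : ∫ u, (∑ m ∈ Finset.range n, D m u) ^ 2 ∂μ =
      ∑ i ∈ Finset.range n, ∑ j ∈ Finset.range n, ∫ u, D i u * D j u ∂μ := by
    have : (fun u => (∑ m ∈ Finset.range n, D m u) ^ 2) =
        fun u => ∑ i ∈ Finset.range n, ∑ j ∈ Finset.range n, D i u * D j u := by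
      funext u; rw [sq, Finset.sum_mul_sum]
    rw [this, integral_finsetSum _ fun i _ => integrable_finsetSum _ fun j _ => hint i j]
    refine Finset.sum_congr rfl fun i _ => ?_
    rw [integral_finsetSum _ fun j _ => hint i j]
  rw [e1]
  have e2 : ∀ i ∈ Finset.range n, ∑ j ∈ Finset.range n, ∫ u, D i u * D j u ∂μ ≤ 2 * q * V := by
    intro i _
    calc ∑ j ∈ Finset.range n, ∫ u, D i u * D j u ∂μ
        ≤ ∑ j ∈ Finset.range n, (if j ∈ Finset.Ico (i - q) (i + q) then V else 0) := by
          refine Finset.sum_le_sum fun j _ => ?_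
          split_ifs with h
          · exact hb i j
          · rw [Finset.mem_Ico] at h
            by_cases h1 : i + q ≤ j
            · rw [horth i j h1]
            · have h2 : j + q ≤ i := by omega
              have := horth j i h2
              simp_rw [mul_comm (D i _)]
              rw [this]
      _ = ((Finset.range n).filter (· ∈ Finset.Ico (i - q) (i + q))).card * V := by
          rw [← Finset.sum_filter, Finset.sum_const, nsmul_eq_mul]
      _ ≤ _ := by
          refine mul_le_mul_of_nonneg_right ?_ hV0
          have h1 : ((Finset.range n).filter (· ∈ Finset.Ico (i - q) (i + q))).card ≤
              (Finset.Ico (i - q) (i + q)).card :=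
            Finset.card_le_card fun j hj => (Finset.mem_filter.1 hj).2
          rw [Nat.card_Ico] at h1
          have : ((Finset.range n).filter (· ∈ Finset.Ico (i - q) (i + q))).card ≤ 2 * q := by omega
          exact_mod_cast this
  calc _ ≤ ∑ i ∈ Finset.range n, 2 * q * V := Finset.sum_le_sum e2
    _ = _ := by rw [Finset.sum_const, Finset.card_range, nsmul_eq_mul]; ring

theorem slln_sq {Ω : Type*} {m0 : MeasurableSpace Ω} {μ : Measure Ω} [IsFiniteMeasure μ]
    {D : ℕ → Ω → ℝ} (hD : ∀ n, MemLp (D n) 2 μ) {V : ℝ} (hV : ∀ n, ∫ u, D n u ^ 2 ∂μ ≤ V) {q : ℕ}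
    (horth : ∀ n m, n + q ≤ m → ∫ u, D n u * D m u ∂μ = 0) :
    ∀ᵐ u ∂μ, Tendsto (fun k : ℕ => avg (fun m => D m u) (k ^ 2)) atTop (𝓝 0) := by
  have hV0 : 0 ≤ V := le_trans (integral_nonneg fun u => sq_nonneg _) (hV 0)
  have hS : ∀ n, MemLp (fun u => ∑ m ∈ Finset.range n, D m u) 2 μ := fun n =>
    memLp_finsetSum _ fun m _ => hD m
  have hA : ∀ k : ℕ, MemLp (fun u => avg (fun m => D m u) (k^2)) 2 μ := by
    intro k
    exact (hS (k^2)).const_mul _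
  have hAi : ∀ k : ℕ, ∫ u, (avg (fun m => D m u) (k^2)) ^ 2 ∂μ ≤ 2 * q * V * (1 / (k:ℝ) ^ 2) := by
    intro k
    have h1 := int_sq_sum hD hV horth (k^2)
    simp only [avg, mul_pow]
    rw [integral_const_mul]
    rcases Nat.eq_zero_or_pos k with rfl | hk
    · simp
    · have hk' : (0:ℝ) < k := by exact_mod_cast hk
      calc _ ≤ (((k^2 : ℕ) : ℝ)⁻¹) ^ 2 * (2 * q * V * ((k^2 : ℕ) : ℝ)) := by gcongr
        _ = _ := by push_cast; field_simp
  have hfin : ∫⁻ u, ∑' k : ℕ, ENNReal.ofReal ((avg (fun m => D m u) (k^2)) ^ 2) ∂μ ≠ ⊤ := by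
    rw [lintegral_tsum]
    · have : ∀ k : ℕ, ∫⁻ u, ENNReal.ofReal ((avg (fun m => D m u) (k^2)) ^ 2) ∂μ ≤
          ENNReal.ofReal (2 * q * V * (1 / (k:ℝ) ^ 2)) := by
        intro k
        rw [← ofReal_integral_eq_lintegral_ofReal (hA k).integrable_sq
          (Eventually.of_forall fun u => sq_nonneg _)]
        exact ENNReal.ofReal_le_ofReal (hAi k)
      refine ne_top_of_le_ne_top ?_ (ENNReal.tsum_le_tsum this)
      have hs : Summable (fun k : ℕ => 2 * q * V * (1 / (k:ℝ) ^ 2)) :=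
        (Real.summable_one_div_nat_pow.2 (by norm_num)).mul_left _
      rw [← ENNReal.ofReal_tsum_of_nonneg (fun k => by positivity) hs]
      exact ENNReal.ofReal_ne_top
    · intro k
      exact ((hA k).aestronglyMeasurable.aemeasurable.pow_const 2).ennreal_ofReal
  have hae := ae_lt_top' (AEMeasurable.tsum fun k =>
    ((hA k).aestronglyMeasurable.aemeasurable.pow_const 2).ennreal_ofReal) hfin
  filter_upwards [hae] with u hu
  have h1 := ENNReal.tendsto_atTop_zero_of_tsum_ne_top hu.ne
  have h2 : Tendsto (fun k : ℕ => (avg (fun m => D m u) (k^2)) ^ 2) atTop (𝓝 0) := by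
    have := (ENNReal.tendsto_toReal ENNReal.zero_ne_top).comp h1
    simpa [Function.comp_def, ENNReal.toReal_ofReal (sq_nonneg _)] using this
  have h3 := (Real.continuous_sqrt.tendsto 0).comp h2
  simp only [Function.comp_def, Real.sqrt_sq_eq_abs, Real.sqrt_zero] at h3
  exact (tendsto_zero_iff_abs_tendsto_zero _).2 h3

/-- The orthogonality and bounds for conditional expectation differences. -/
theorem slln_condExp {Ω : Type*} {m0 : MeasurableSpace Ω} {μ : Measure Ω} [IsFiniteMeasure μ]
    {F : ℕ → MeasurableSpace Ω} (hF : ∀ n, F n ≤ m0) (hmono : Monotone F) {f : ℕ → Ω → ℝ}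
    (hf : ∀ n, MemLp (f n) 2 μ) {V : ℝ} (hV : ∀ n, ∫ u, f n u ^ 2 ∂μ ≤ V) (q : ℕ) :
    ∀ᵐ u ∂μ, Tendsto (fun k : ℕ => avg (fun m => (μ[f m | F (m+q)]) u - (μ[f m | F m]) u) (k ^ 2))
      atTop (𝓝 0) := by
  have hE : ∀ n m, MemLp (μ[f n | F m]) 2 μ := fun n m => (hf n).condExp (by norm_num)
  have hV0 : 0 ≤ V := le_trans (integral_nonneg fun u => sq_nonneg _) (hV 0)
  have hEV : ∀ n m, ∫ u, (μ[f n | F m]) u ^ 2 ∂μ ≤ V := by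
    intro n m
    have i1 := (hE n m).integrable_mul (hf n)
    have i1' : Integrable (fun u => (μ[f n | F m]) u * f n u) μ := i1
    have h1 : ∫ u, (μ[f n | F m]) u * f n u ∂μ = ∫ u, (μ[f n | F m]) u ^ 2 ∂μ := by
      have := condExp_mul_of_stronglyMeasurable_left (m := F m) (μ := μ) (f := μ[f n | F m]) (g := f n)
        stronglyMeasurable_condExp i1 ((hf n).integrable (by norm_num))
      have h2 := integral_condExp (hF m) (μ := μ) (f := μ[f n | F m] * f n)
      have h3 := integral_congr_ae this
      rw [h2] at h3
      simp only [Pi.mul_apply] at h3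
      rw [h3]
      simp only [sq]
    have h0 : 0 ≤ ∫ u, (f n u - (μ[f n | F m]) u) ^ 2 ∂μ := integral_nonneg fun u => sq_nonneg _
    have h3 : ∫ u, (f n u - (μ[f n | F m]) u) ^ 2 ∂μ =
        ∫ u, f n u ^ 2 ∂μ - 2 * ∫ u, (μ[f n | F m]) u * f n u ∂μ + ∫ u, (μ[f n | F m]) u ^ 2 ∂μ := by
      have i2 : Integrable (fun u => f n u ^ 2 - 2 * ((μ[f n | F m]) u * f n u)) μ :=
        (hf n).integrable_sq.sub (i1'.const_mul 2)
      rw [← integral_const_mul, ← integral_sub (hf n).integrable_sq (i1'.const_mul 2),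
        ← integral_add i2 (hE n m).integrable_sq]
      congr 1
      funext u
      ring
    rw [h1] at h3
    linarith [hV n]
  refine slln_sq (V := 4 * V) (q := q) (fun n => (hE n (n+q)).sub (hE n n)) (fun n => ?_) ?_
  · have i1 := (hE n (n+q)).integrable_sq
    have i2 := (hE n n).integrable_sq
    have : ∫ u, ((μ[f n | F (n+q)]) u - (μ[f n | F n]) u) ^ 2 ∂μ ≤
        ∫ u, (2 * (μ[f n | F (n+q)]) u ^ 2 + 2 * (μ[f n | F n]) u ^ 2) ∂μ := by
      refine integral_mono ((hE n (n+q)).sub (hE n n)).integrable_sq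
        ((i1.const_mul 2).add (i2.const_mul 2)) fun u => ?_
      simp only [Pi.sub_apply]
      nlinarith [sq_nonneg ((μ[f n | F (n+q)]) u + (μ[f n | F n]) u)]
    rw [integral_add (i1.const_mul 2) (i2.const_mul 2), integral_const_mul, integral_const_mul] at this
    linarith [hEV n (n+q), hEV n n]
  · intro n m hnm
    set g : Ω → ℝ := μ[f n | F (n+q)] - μ[f n | F n] with hg
    set h : Ω → ℝ := μ[f m | F (m+q)] - μ[f m | F m] with hh
    have gm : StronglyMeasurable[F m] g :=
      (stronglyMeasurable_condExp.mono (hmono hnm)).sub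
        (stronglyMeasurable_condExp.mono (hmono (by omega)))
    have hgL : MemLp g 2 μ := (hE n (n+q)).sub (hE n n)
    have hhL : MemLp h 2 μ := (hE m (m+q)).sub (hE m m)
    have hh0 : μ[h | F m] =ᵐ[μ] 0 := by
      have e1 := condExp_sub (μ := μ) (m := F m) (f := μ[f m | F (m+q)]) (g := μ[f m | F m])
        integrable_condExp integrable_condExp
      have e2 := condExp_condExp_of_le (μ := μ) (f := f m) (hmono (show m ≤ m + q by omega)) (hF (m+q))
      have e3 := condExp_condExp_of_le (μ := μ) (f := f m) (le_refl (F m)) (hF m)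
      filter_upwards [e1, e2, e3] with u h1 h2 h3
      rw [h1]; simp [h2, h3]
    have e4 := condExp_mul_of_stronglyMeasurable_left gm (hgL.integrable_mul hhL)
      (hhL.integrable (by norm_num))
    have e5 := integral_condExp (hF m) (μ := μ) (f := g * h)
    have : ∫ u, g u * h u ∂μ = ∫ u, (g * h) u ∂μ := rfl
    show ∫ u, g u * h u ∂μ = 0
    rw [this, ← e5, integral_congr_ae e4]
    refine (integral_congr_ae (g := fun _ => (0:ℝ)) ?_).trans (by simp)
    filter_upwards [hh0] with u hu
    simp [hu]


structure Dat (α x b B c : ℝ) : Prop where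
  hα : α ∈ Ico (0:ℝ) 1
  hx : x ∈ Ico (0:ℝ) 1
  hb : 1 < b
  hbB : b < B
  hc : 0 < c
  low : ∀ β β' : ℝ, 0 ≤ β → β ≤ β' → β' ≤ B → ∀ n, 2 ≤ n → SameW α x n β β' →
      c * ((β' - β) * β' ^ n) ≤ (Tab α β')^[n] x - (Tab α β)^[n] x

theorem measurable_xi (α x : ℝ) (n : ℕ) : Measurable (fun β => (Tab α β)^[n] x) := by
  induction n with
  | zero => simp
  | succ n ih =>
    simp only [Function.iterate_succ_apply', Tab]
    exact measurable_fract.comp ((measurable_id.mul ih).add_const α)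

theorem measurable_codeb (α x : ℝ) (n : ℕ) : Measurable (fun β => code α β x n) := by
  unfold code
  have h1 : Measurable (fun β => ⌊β * (Tab α β)^[n] x + α⌋) :=
    Int.measurable_floor.comp ((measurable_id.mul (measurable_xi α x n)).add_const α)
  exact (measurable_of_countable Int.toNat).comp h1

noncomputable def Wd (α x : ℝ) (n : ℕ) (β : ℝ) : Fin n → ℕ := fun i => code α β x i

theorem measurable_Wd (α x : ℝ) (n : ℕ) : Measurable (Wd α x n) :=
  measurable_pi_iff.2 fun i => measurable_codeb α x i

theorem Wd_eq {α x : ℝ} {n : ℕ} {β β' : ℝ} : Wd α x n β = Wd α x n β' ↔ SameW α x n β β' := by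
  constructor
  · intro h i hi
    exact congrFun h ⟨i, hi⟩
  · intro h
    funext i
    exact h i i.2

/-- The cell of a word. -/
def Cw (α x b B : ℝ) (n : ℕ) (w : Fin n → ℕ) : Set ℝ := Ioo b B ∩ Wd α x n ⁻¹' {w}

theorem measurableSet_Cw (α x b B : ℝ) (n : ℕ) (w : Fin n → ℕ) : MeasurableSet (Cw α x b B n w) :=
  measurableSet_Ioo.inter (measurable_Wd α x n (measurableSet_singleton _))

section
variable {α x b B c : ℝ} {n : ℕ} {w : Fin n → ℕ}

theorem Cw_same {β β' : ℝ} (h : β ∈ Cw α x b B n w) (h' : β' ∈ Cw α x b B n w) :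
    SameW α x n β β' := Wd_eq.1 ((h.2 : Wd α x n β = w).trans (h'.2 : Wd α x n β' = w).symm)

theorem mem_Cw_of_same {β β' : ℝ} (h : β ∈ Cw α x b B n w) (h' : β' ∈ Ioo b B)
    (hs : SameW α x n β β') : β' ∈ Cw α x b B n w :=
  ⟨h', (Wd_eq.2 hs).symm.trans h.2⟩

theorem Cw_fin : volume (Cw α x b B n w) ≠ ⊤ :=
  ne_top_of_le_ne_top (by simp) (measure_mono (inter_subset_left : Cw α x b B n w ⊆ Ioo b B))

theorem Cw_len (hd : Dat α x b B c) {β β' : ℝ} (h : β ∈ Cw α x b B n w)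
    (h' : β' ∈ Cw α x b B n w) (hle : β ≤ β') : β' - β ≤ volume.real (Cw α x b B n w) := by
  have : Icc β β' ⊆ Cw α x b B n w := by
    intro u hu
    refine mem_Cw_of_same h ⟨lt_of_lt_of_le h.1.1 hu.1, lt_of_le_of_lt hu.2 h'.1.2⟩ ?_
    exact same_between hd.hα.1 ⟨hd.hx.1, hd.hx.2.le⟩ (by linarith [hd.hb, h.1.1]) hu.1 hu.2 n (Cw_same h h')
  have h2 := measureReal_mono this Cw_fin
  rwa [Real.volume_real_Icc_of_le hle] at h2

theorem Cw_diff (hd : Dat α x b B c) (hn : 2 ≤ n) {β β' : ℝ} (h : β ∈ Cw α x b B n w)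
    (h' : β' ∈ Cw α x b B n w) : β' - β ≤ 1 / (c * β' ^ n) := by
  have hb := hd.hb
  have hc := hd.hc
  have p' : 0 < β' := by linarith [h'.1.1]
  rcases le_total β β' with hle | hle
  · have h1 := hd.low β β' (by linarith [h.1.1]) hle h'.1.2.le n hn (Cw_same h h')
    have h2 := (Tab_iter_mem (α := α) (β := β') hd.hx n).2
    have h3 := (Tab_iter_mem (α := α) (β := β) hd.hx n).1
    rw [le_div_iff₀ (by positivity)]
    nlinarith
  · have : 0 < 1 / (c * β' ^ n) := by positivity
    linarith

theorem Cw_diff' (hd : Dat α x b B c) (hn : 2 ≤ n) {β β' : ℝ} (h : β ∈ Cw α x b B n w)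
    (h' : β' ∈ Cw α x b B n w) : |β' - β| ≤ 1 / (c * b ^ n) := by
  have hb := hd.hb
  have hc := hd.hc
  have key : ∀ u ∈ Cw α x b B n w, 1 / (c * u ^ n) ≤ 1 / (c * b ^ n) := by
    intro u hu
    have : b < u := hu.1.1
    gcongr
  rw [abs_le]
  constructor
  · linarith [Cw_diff hd hn h' h, key _ h]
  · linarith [Cw_diff hd hn h h', key _ h']

/-- left endpoint -/
noncomputable def aw (α x b B : ℝ) (n : ℕ) (w : Fin n → ℕ) : ℝ := sInf (Cw α x b B n w)

theorem aw_bdd : BddBelow (Cw α x b B n w) := ⟨b, fun _ hu => hu.1.1.le⟩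

theorem aw_le {β : ℝ} (h : β ∈ Cw α x b B n w) : aw α x b B n w ≤ β := csInf_le aw_bdd h

theorem le_aw {β : ℝ} (h : β ∈ Cw α x b B n w) : b ≤ aw α x b B n w :=
  le_csInf ⟨β, h⟩ fun _ hu => hu.1.1.le

noncomputable def Dc (b c : ℝ) : ℝ := Real.exp (1 / (c * (b - 1)))

theorem Cw_distort (hd : Dat α x b B c) (hn : 2 ≤ n) {β : ℝ} (h : β ∈ Cw α x b B n w) :
    β ^ n ≤ Dc b c * aw α x b B n w ^ n := by
  have hb := hd.hb
  have hc := hd.hc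
  have hβ : b < β := h.1.1
  set a := aw α x b B n w with ha
  have hab : b ≤ a := le_aw h
  have haβ : a ≤ β := aw_le h
  have h1 : β - a ≤ 1 / (c * β ^ n) := by
    have : β - 1 / (c * β ^ n) ≤ a :=
      le_csInf ⟨β, h⟩ fun u hu => by linarith [Cw_diff hd hn hu h]
    linarith
  have h2 : β ≤ a * Real.exp (β - a) := by
    have := Real.add_one_le_exp (β - a)
    nlinarith
  have h3 : β ^ n ≤ a ^ n * Real.exp (n * (β - a)) := by
    rw [Real.exp_nat_mul, ← mul_pow]
    exact pow_le_pow_left₀ (by linarith) h2 n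
  have h4 : n * (β - a) ≤ 1 / (c * (b - 1)) := by
    have hbern := one_add_mul_le_pow (a := b - 1) (by linarith) n
    have e : 1 + (b - 1) = b := by ring
    rw [e] at hbern
    have hn0 : (0:ℝ) ≤ n := by positivity
    have hbn : b ^ n ≤ β ^ n := pow_le_pow_left₀ (by linarith) hβ.le n
    have pb : 0 < b - 1 := by linarith
    have pβ : 0 < β := by linarith
    calc n * (β - a) ≤ n * (1 / (c * β ^ n)) := by gcongr
      _ ≤ 1 / (c * (b - 1)) := by
        rw [mul_one_div, div_le_div_iff₀ (by positivity) (by positivity)]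
        nlinarith
  calc β ^ n ≤ a ^ n * Real.exp (n * (β - a)) := h3
    _ ≤ a ^ n * Dc b c := by
      have pa : 0 < a := by linarith
      have : 0 ≤ a ^ n := by positivity
      unfold Dc
      gcongr
    _ = _ := mul_comm _ _

/-- Long cells: large oscillation. -/
theorem Cw_long (hd : Dat α x b B c) (hn : 2 ≤ n) {δ : ℝ} (hδ : 0 < δ) {β β' : ℝ}
    (h : β ∈ Cw α x b B n w) (h' : β' ∈ Cw α x b B n w)
    (ho : δ < |(Tab α β')^[n] x - (Tab α β)^[n] x|) :
    1 / aw α x b B n w ^ n ≤ volume.real (Cw α x b B n w) * (Dc b c / (δ * (b - 1))) := by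
  wlog hle : β ≤ β' generalizing β β'
  · exact this h' h (by rwa [abs_sub_comm]) (le_of_not_ge hle)
  have hb := hd.hb
  have hx' : x ∈ Icc (0:ℝ) 1 := ⟨hd.hx.1, hd.hx.2.le⟩
  have m := xi_mono hd.hα.1 hx' (by linarith [h.1.1]) hle n (Cw_same h h')
  rw [abs_of_nonneg (by linarith)] at ho
  have u := xi_upper' hd.hα.1 hx' hb h.1.1.le hle n (Cw_same h h')
  have l := Cw_len hd h h' hle
  have d := Cw_distort hd hn h'
  have hab := le_aw h
  have pb : 0 < b - 1 := by linarith
  set a := aw α x b B n w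
  set ℓ := volume.real (Cw α x b B n w)
  have pa : 0 < a := by linarith
  have pD : 0 < Dc b c := Real.exp_pos _
  have pβ : 0 < β' := by linarith [h'.1.1]
  have s : δ ≤ ℓ * (Dc b c * a ^ n) / (b - 1) := by
    refine (ho.le.trans u).trans ?_
    have : 0 ≤ ℓ := measureReal_nonneg
    gcongr
  rw [mul_div_assoc', div_le_div_iff₀ (by positivity) (by positivity)]
  rw [le_div_iff₀ pb] at s
  linarith

end


/-- `1/(a^n ℓ)` as a function of the word. -/
noncomputable def Rw (α x b B : ℝ) (n : ℕ) (w : Fin n → ℕ) : ℝ :=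
  1 / (aw α x b B n w ^ n * volume.real (Cw α x b B n w))

noncomputable def Rf (α x b B : ℝ) (n : ℕ) (β : ℝ) : ℝ := Rw α x b B n (Wd α x n β)

noncomputable def Qf (α x b B : ℝ) (n : ℕ) (β : ℝ) : ℝ := √ (Rf α x b B n β)

section
variable {α x b B c : ℝ} {n : ℕ}

theorem measurable_Rf : Measurable (Rf α x b B n) :=
  (measurable_of_countable (Rw α x b B n)).comp (measurable_Wd α x n)

theorem measurable_Qf : Measurable (Qf α x b B n) := measurable_Rf.sqrt

theorem Rw_nonneg (hd : Dat α x b B c) (w : Fin n → ℕ) : 0 ≤ Rw α x b B n w := by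
  unfold Rw
  have : 0 ≤ aw α x b B n w := by
    apply Real.sInf_nonneg
    intro u hu
    linarith [hu.1.1, hd.hb]
  have : 0 ≤ volume.real (Cw α x b B n w) := measureReal_nonneg
  positivity

theorem Rf_nonneg (hd : Dat α x b B c) (β : ℝ) : 0 ≤ Rf α x b B n β := Rw_nonneg hd _

theorem Qf_sq (hd : Dat α x b B c) (β : ℝ) : Qf α x b B n β ^ 2 = Rf α x b B n β :=
  Real.sq_sqrt (Rf_nonneg hd β)

theorem child_int (hd : Dat α x b B c) (w : Fin n → ℕ) (N : ℕ) (v : ℕ → ℕ) :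
    ∫⁻ β in Cw α x b B n w ∩ {β | ∀ i < N, code α β x (n+i) = v i},
      ENNReal.ofReal (Rf α x b B (n+N) β) ≤ ENNReal.ofReal (1 / (aw α x b B n w ^ n * b ^ N)) := by
  set S := Cw α x b B n w ∩ {β | ∀ i < N, code α β x (n+i) = v i} with hS
  rcases S.eq_empty_or_nonempty with he | ⟨β₀, h0⟩
  · rw [he]; simp
  have hb := hd.hb
  set w' := Wd α x (n+N) β₀ with hw'
  have hSC : S = Cw α x b B (n+N) w' := by
    ext β
    constructor
    · intro h
      refine ⟨h.1.1, ?_⟩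
      show Wd α x (n+N) β = w'
      rw [hw', Wd_eq]
      intro i hi
      by_cases hin : i < n
      · exact Cw_same h.1 h0.1 i hin
      · obtain ⟨j, rfl⟩ := Nat.exists_eq_add_of_le (not_lt.1 hin)
        rw [h.2 j (by omega), h0.2 j (by omega)]
    · intro h
      have hs : SameW α x (n+N) β₀ β := (Wd_eq.1 (h.2 : Wd α x (n+N) β = w')).symm
      refine ⟨mem_Cw_of_same h0.1 h.1 (hs.mono (by omega)), fun i hi => ?_⟩
      rw [← hs (n+i) (by omega), h0.2 i hi]
  have h0' : β₀ ∈ Cw α x b B (n+N) w' := hSC ▸ h0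
  have hsub : Cw α x b B (n+N) w' ⊆ Cw α x b B n w := hSC ▸ inter_subset_left
  have haa : aw α x b B n w ≤ aw α x b B (n+N) w' := csInf_le_csInf aw_bdd ⟨β₀, h0'⟩ hsub
  have hba : b ≤ aw α x b B n w := le_aw h0.1
  rw [hSC]
  have hcongr : ∫⁻ β in Cw α x b B (n+N) w', ENNReal.ofReal (Rf α x b B (n+N) β) =
      ∫⁻ β in Cw α x b B (n+N) w', ENNReal.ofReal (Rw α x b B (n+N) w') := by
    refine setLIntegral_congr_fun (measurableSet_Cw _ _ _ _ _ _) fun β hβ => ?_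
    have : Wd α x (n+N) β = w' := hβ.2
    simp only [Rf, this]
  rw [hcongr, setLIntegral_const]
  have e : volume (Cw α x b B (n+N) w') = ENNReal.ofReal (volume.real (Cw α x b B (n+N) w')) :=
    (ENNReal.ofReal_toReal Cw_fin).symm
  rw [e, ← ENNReal.ofReal_mul (Rw_nonneg hd _)]
  apply ENNReal.ofReal_le_ofReal
  unfold Rw
  set a := aw α x b B n w
  set a' := aw α x b B (n+N) w'
  set ℓ := volume.real (Cw α x b B (n+N) w')
  have hℓ : 0 ≤ ℓ := measureReal_nonneg
  have pa : 0 < a := by linarith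
  have pb : 0 < b := by linarith
  have pa' : 0 < a' := by linarith
  calc 1 / (a' ^ (n+N) * ℓ) * ℓ ≤ 1 / a' ^ (n+N) := by
        rcases hℓ.eq_or_lt with h | h
        · rw [← h]; simp; positivity
        · apply le_of_eq; field_simp
    _ ≤ 1 / (a ^ n * b ^ N) := by
        rw [pow_add]
        have : b ≤ a' := by linarith
        gcongr

theorem code_add (α β x : ℝ) (n i : ℕ) : code α β x (n+i) = code α β ((Tab α β)^[n] x) i := by
  unfold code
  rw [← Function.iterate_add_apply, add_comm i n]

theorem all_int (hd : Dat α x b B c) (w : Fin n → ℕ) (N : ℕ) {L : ℕ} (hL : B + 1 ≤ L) :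
    ∫⁻ β in Cw α x b B n w, ENNReal.ofReal (Rf α x b B (n+N) β) ≤
      ENNReal.ofReal (L ^ N * (1 / (aw α x b B n w ^ n * b ^ N))) := by
  have hcov : Cw α x b B n w ⊆ ⋃ v : Fin N → Fin L, Cw α x b B n w ∩
      {β | ∀ i < N, code α β x (n+i) = (fun i => if h : i < N then (v ⟨i, h⟩ : ℕ) else 0) i} := by
    intro β hβ
    have hlt : ∀ i, code α β x i < L := fun i => by
      have := code_lt hd.hα (β := β) (by linarith [hd.hb, hβ.1.1]) hd.hx i (L := L)
        (by linarith [hβ.1.2])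
      exact_mod_cast this
    refine mem_iUnion.2 ⟨fun i => ⟨code α β x (n + i), hlt _⟩, hβ, fun i hi => ?_⟩
    simp [hi]
  calc _ ≤ ∫⁻ β in ⋃ v : Fin N → Fin L, Cw α x b B n w ∩
      {β | ∀ i < N, code α β x (n+i) = (fun i => if h : i < N then (v ⟨i, h⟩ : ℕ) else 0) i},
        ENNReal.ofReal (Rf α x b B (n+N) β) := lintegral_mono_set hcov
    _ ≤ ∑' v : Fin N → Fin L, _ := lintegral_iUnion_le _ _
    _ ≤ ∑' v : Fin N → Fin L, ENNReal.ofReal (1 / (aw α x b B n w ^ n * b ^ N)) :=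
        ENNReal.tsum_le_tsum fun v => child_int hd w N _
    _ = _ := by
        rw [tsum_fintype, Finset.sum_const, Finset.card_univ, Fintype.card_fun, Fintype.card_fin,
          Fintype.card_fin, nsmul_eq_mul, ENNReal.ofReal_mul (by positivity),
          ENNReal.ofReal_pow (by positivity), ENNReal.ofReal_natCast]
        push_cast; rfl

theorem two_int (hd : Dat α x b B c) (w : Fin n → ℕ) (N : ℕ) {v₁ v₂ : ℕ → ℕ}
    (h : ∀ β ∈ Cw α x b B n w, (∀ i < N, code α β x (n+i) = v₁ i) ∨
      (∀ i < N, code α β x (n+i) = v₂ i)) :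
    ∫⁻ β in Cw α x b B n w, ENNReal.ofReal (Rf α x b B (n+N) β) ≤
      ENNReal.ofReal (2 * (1 / (aw α x b B n w ^ n * b ^ N))) := by
  have hcov : Cw α x b B n w ⊆ (Cw α x b B n w ∩ {β | ∀ i < N, code α β x (n+i) = v₁ i}) ∪
      (Cw α x b B n w ∩ {β | ∀ i < N, code α β x (n+i) = v₂ i}) := by
    intro β hβ
    rcases h β hβ with h | h
    · exact Or.inl ⟨hβ, h⟩
    · exact Or.inr ⟨hβ, h⟩
  calc _ ≤ _ := lintegral_mono_set hcov
    _ ≤ _ := lintegral_union_le _ _ _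
    _ ≤ _ := add_le_add (child_int hd w N _) (child_int hd w N _)
    _ = _ := by
        rw [← two_mul, ENNReal.ofReal_mul (by norm_num)]; norm_num

end


/-- filtration -/
noncomputable def Fn (α x : ℝ) (n : ℕ) : MeasurableSpace ℝ := MeasurableSpace.comap (Wd α x n) inferInstance

theorem Fn_le (α x : ℝ) (n : ℕ) : Fn α x n ≤ (inferInstance : MeasurableSpace ℝ) := (measurable_Wd α x n).comap_le

theorem Fn_mono (α x : ℝ) : Monotone (Fn α x) := by
  intro n m hnm
  rintro s ⟨A, hA, rfl⟩
  refine ⟨(fun (w : Fin m → ℕ) (i : Fin n) => w (Fin.castLE hnm i)) ⁻¹' A, ?_, rfl⟩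
  exact (measurable_pi_iff.2 fun i => measurable_pi_apply _) hA

noncomputable abbrev muJ (b B : ℝ) : Measure ℝ := volume.restrict (Ioo b B)

section
variable {α x b B c : ℝ} {n : ℕ}

theorem ce_le {f : ℝ → ℝ} (hf : Integrable f (muJ b B)) {φ : (Fin n → ℕ) → ℝ}
    (h : ∀ w, 0 < volume.real (Cw α x b B n w) →
      ∫ u in Cw α x b B n w, f u ≤ φ w * volume.real (Cw α x b B n w)) :
    ∀ᵐ β ∂(muJ b B), ((muJ b B)[f | Fn α x n]) β ≤ φ (Wd α x n β) := by
  filter_upwards [condExp_cell (measurable_Wd α x n) hf] with β hβ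
  have hms : MeasurableSet (Wd α x n ⁻¹' {Wd α x n β}) :=
    measurable_Wd α x n (measurableSet_singleton _)
  have e1 : (muJ b B).real (Wd α x n ⁻¹' {Wd α x n β}) =
      volume.real (Cw α x b B n (Wd α x n β)) := by
    rw [muJ, measureReal_restrict_apply hms, inter_comm]; rfl
  have e2 : (muJ b B).restrict (Wd α x n ⁻¹' {Wd α x n β}) =
      volume.restrict (Cw α x b B n (Wd α x n β)) := by
    rw [muJ, Measure.restrict_restrict hms, inter_comm]; rfl
  rw [e1, e2] at hβ
  have := h _ hβ.1
  rw [← hβ.2] at this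
  exact le_of_mul_le_mul_right this hβ.1

theorem lint_J (hd : Dat α x b B c) (N : ℕ) {L : ℕ} (hL : B + 1 ≤ L) :
    ∫⁻ β in Ioo b B, ENNReal.ofReal (Rf α x b B N β) ≤ ENNReal.ofReal (L ^ N * (1 / b ^ N)) := by
  have h := all_int hd (n := 0) (fun i => i.elim0) N hL
  have e : Cw α x b B 0 (fun i => i.elim0) = Ioo b B := by
    unfold Cw
    rw [inter_eq_left]
    intro β _
    exact Subsingleton.elim _ _
  rw [e, zero_add, pow_zero, one_mul] at h
  exact h

theorem integrable_Rf (hd : Dat α x b B c) (N : ℕ) : Integrable (Rf α x b B N) (muJ b B) := by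
  obtain ⟨L, hL⟩ := exists_nat_ge (B+1)
  refine ⟨measurable_Rf.aestronglyMeasurable, ?_⟩
  rw [hasFiniteIntegral_iff_ofReal (Eventually.of_forall fun β => Rf_nonneg hd β)]
  exact lt_of_le_of_lt (lint_J hd N hL) ENNReal.ofReal_lt_top

theorem memLp_Qf (hd : Dat α x b B c) (N : ℕ) : MemLp (Qf α x b B N) 2 (muJ b B) := by
  rw [memLp_two_iff_integrable_sq measurable_Qf.aestronglyMeasurable]
  simp_rw [Qf_sq hd]
  exact integrable_Rf hd N

theorem key_cell (hd : Dat α x b B c) {η δ : ℝ} {N L : ℕ} (hE : EndConst α b B η N)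
    (hη : η ≤ 1/2) (hδ : 0 < δ) (hδη : (B+1)^N * δ < η) (hN : 2 / b ^ N ≤ 1/4) (hL : B + 1 ≤ L)
    (hn : 2 ≤ n) (hnδ : 1 / (c * b ^ n) ≤ δ) (w : Fin n → ℕ)
    (hℓ : 0 < volume.real (Cw α x b B n w)) :
    ∫ β in Cw α x b B n w, Rf α x b B (n+N) β ≤
      (Rw α x b B n w / 4 + L ^ N * (Dc b c / (δ * (b-1)))) * volume.real (Cw α x b B n w) := by
  have hb := hd.hb
  have pb : 0 < b := by linarith
  have pb1 : 0 < b - 1 := by linarith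
  have pD : 0 < Dc b c := Real.exp_pos _
  have hR := Rw_nonneg hd w
  obtain ⟨β₀, h0⟩ : (Cw α x b B n w).Nonempty := by
    by_contra h
    rw [not_nonempty_iff_eq_empty] at h
    rw [h] at hℓ
    simp at hℓ
  have hba : b ≤ aw α x b B n w := le_aw h0
  have pa : 0 < aw α x b B n w := by linarith
  rw [integral_eq_lintegral_of_nonneg_ae (Eventually.of_forall fun β => Rf_nonneg hd β)
    measurable_Rf.aestronglyMeasurable]
  apply ENNReal.toReal_le_of_le_ofReal (by positivity)
  by_cases hosc : ∀ β ∈ Cw α x b B n w, ∀ β' ∈ Cw α x b B n w,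
      |(Tab α β')^[n] x - (Tab α β)^[n] x| ≤ δ
  · obtain ⟨v₁, v₂, hv⟩ := two_children hd.hα.1 hb hη N hE δ hδ.le hδη
      ((fun β => (β, (Tab α β)^[n] x)) '' Cw α x b B n w)
      (by
        rintro _ ⟨β, hβ, rfl⟩
        exact ⟨hβ.1, Tab_iter_mem hd.hx n⟩)
      (by
        rintro _ ⟨β, hβ, rfl⟩ _ ⟨β', hβ', rfl⟩
        exact ⟨(Cw_diff' hd hn hβ' hβ).trans hnδ, hosc β' hβ' β hβ⟩)
    refine (two_int hd w N (v₁ := v₁) (v₂ := v₂) ?_).trans (ENNReal.ofReal_le_ofReal ?_)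
    · intro β hβ
      simp only [code_add]
      exact hv _ ⟨β, hβ, rfl⟩
    · have e : 2 * (1 / (aw α x b B n w ^ n * b ^ N)) = 2 / b ^ N * (1 / aw α x b B n w ^ n) := by
        field_simp
      have e2 : Rw α x b B n w * volume.real (Cw α x b B n w) = 1 / aw α x b B n w ^ n := by
        unfold Rw; field_simp
      have e3 : Rw α x b B n w / 4 * volume.real (Cw α x b B n w) =
          1 / 4 * (1 / aw α x b B n w ^ n) := by rw [← e2]; ring
      rw [e, add_mul, e3]
      have h1 : 2 / b ^ N * (1 / aw α x b B n w ^ n) ≤ 1/4 * (1 / aw α x b B n w ^ n) := by gcongr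
      have h2 : 0 ≤ L ^ N * (Dc b c / (δ * (b-1))) * volume.real (Cw α x b B n w) := by positivity
      linarith
  · push Not at hosc
    obtain ⟨β, hβ, β', hβ', ho⟩ := hosc
    have hl := Cw_long hd hn hδ hβ hβ' ho
    refine (all_int hd w N hL).trans (ENNReal.ofReal_le_ofReal ?_)
    have h1 : 1 / (aw α x b B n w ^ n * b ^ N) ≤ 1 / aw α x b B n w ^ n := by
      have : 1 ≤ b ^ N := one_le_pow₀ hb.le
      have hp : 0 < aw α x b B n w ^ n := by positivity
      gcongr
      nlinarith
    have h2 : (L:ℝ) ^ N * (1 / (aw α x b B n w ^ n * b ^ N)) ≤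
        L ^ N * (volume.real (Cw α x b B n w) * (Dc b c / (δ * (b - 1)))) := by
      gcongr
      exact h1.trans hl
    have h3 : 0 ≤ Rw α x b B n w / 4 * volume.real (Cw α x b B n w) := by positivity
    linarith

theorem key_cell_Q (hd : Dat α x b B c) {K : ℝ} (hK : 0 < K) {N : ℕ} (w : Fin n → ℕ)
    (hℓ : 0 < volume.real (Cw α x b B n w))
    (h : ∫ β in Cw α x b B n w, Rf α x b B (n+N) β ≤
      (Rw α x b B n w / 4 + K) * volume.real (Cw α x b B n w)) :
    ∫ β in Cw α x b B n w, Qf α x b B (n+N) β ≤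
      (√(Rw α x b B n w) / 2 + √K) * volume.real (Cw α x b B n w) := by
  have hR := Rw_nonneg hd w
  set q := √(Rw α x b B n w)
  have hq : q ^ 2 = Rw α x b B n w := Real.sq_sqrt hR
  have hq0 : 0 ≤ q := Real.sqrt_nonneg _
  have hk : √K ^ 2 = K := Real.sq_sqrt hK.le
  have hk0 : 0 < √K := Real.sqrt_pos.2 hK
  set k := √K
  set s := q / 2 + k with hs
  have hs0 : 0 < s := by positivity
  set ℓ := volume.real (Cw α x b B n w) with hℓdef
  have iR : IntegrableOn (Rf α x b B (n+N)) (Cw α x b B n w) :=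
    IntegrableOn.mono_set (integrable_Rf hd (n+N)) inter_subset_left
  have iQ : IntegrableOn (Qf α x b B (n+N)) (Cw α x b B n w) :=
    IntegrableOn.mono_set ((memLp_Qf hd (n+N)).integrable (by norm_num)) inter_subset_left
  have ic : IntegrableOn (fun _ => s) (Cw α x b B n w) := integrableOn_const Cw_fin
  have h1 : ∫ β in Cw α x b B n w, Qf α x b B (n+N) β ≤
      ∫ β in Cw α x b B n w, (Rf α x b B (n+N) β / s + s) / 2 := by
    refine integral_mono iQ (((iR.div_const s).add ic).div_const 2) fun β => ?_
    show Qf α x b B (n+N) β ≤ (Rf α x b B (n+N) β / s + s) / 2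
    rw [← Qf_sq hd]
    set y := Qf α x b B (n+N) β
    rw [le_div_iff₀ (by norm_num), ← sub_nonneg]
    have : y ^ 2 / s + s - y * 2 = (y - s)^2 / s := by field_simp; ring
    rw [this]; positivity
  rw [integral_div, integral_add (iR.div_const s) ic, integral_div, setIntegral_const, smul_eq_mul,
    ← hℓdef] at h1
  have h2 : (∫ β in Cw α x b B n w, Rf α x b B (n+N) β) / s ≤ s * ℓ := by
    rw [div_le_iff₀ hs0]
    refine h.trans ?_
    rw [← hq, ← hk]
    have : q^2 / 4 + k^2 ≤ s * s := by rw [hs]; nlinarith [mul_nonneg hq0 hk0.le]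
    nlinarith
  linarith

end


theorem avg_rec {P d : ℕ → ℝ} {κ : ℝ} {N : ℕ} (hP : ∀ m, 0 ≤ P m)
    (h : ∀ m, P (m+N) ≤ P m / 2 + κ + d m) {n : ℕ} (hn : 0 < n) :
    avg P n ≤ 2 * κ + 2 * avg d n + 2 * ((∑ m ∈ Finset.range N, P m) / n) := by
  have h1 : ∑ m ∈ Finset.range n, P (m+N) ≤ ∑ m ∈ Finset.range n, (P m / 2 + κ + d m) :=
    Finset.sum_le_sum fun m _ => h m
  rw [Finset.sum_add_distrib, Finset.sum_add_distrib, ← Finset.sum_div, Finset.sum_const,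
    Finset.card_range, nsmul_eq_mul] at h1
  have h2 : ∑ m ∈ Finset.range n, P m ≤ ∑ m ∈ Finset.range N, P m + ∑ m ∈ Finset.range n, P (m+N) := by
    have e : ∑ m ∈ Finset.range N, P m + ∑ m ∈ Finset.range n, P (m+N) =
        ∑ m ∈ Finset.range (N+n), P m := by
      rw [Finset.sum_range_add]; simp only [add_comm]
    rw [e]
    exact Finset.sum_le_sum_of_subset_of_nonneg (by
      intro m hm; rw [Finset.mem_range] at *; omega) fun m _ _ => hP m
  have hn' : (0:ℝ) < n := by exact_mod_cast hn
  unfold avg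
  have h3 : ∑ m ∈ Finset.range n, P m ≤ 2 * (n * κ) + 2 * ∑ m ∈ Finset.range n, d m +
      2 * ∑ m ∈ Finset.range N, P m := by linarith
  calc (n:ℝ)⁻¹ * ∑ m ∈ Finset.range n, P m ≤ (n:ℝ)⁻¹ * (2 * (n * κ) + 2 * ∑ m ∈ Finset.range n, d m +
      2 * ∑ m ∈ Finset.range N, P m) := by gcongr
    _ = _ := by field_simp

def KeyC (α x b B K : ℝ) (N n₀ : ℕ) : Prop := ∀ n, n₀ ≤ n → ∀ w : Fin n → ℕ,
  0 < volume.real (Cw α x b B n w) → ∫ β in Cw α x b B n w, Rf α x b B (n+N) β ≤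
      (Rw α x b B n w / 4 + K) * volume.real (Cw α x b B n w)

section
variable {α x b B c K : ℝ} {N n₀ : ℕ}

theorem intR_rec (hd : Dat α x b B c) (hk : KeyC α x b B K N n₀) {n : ℕ} (hn : n₀ ≤ n) :
    ∫ β, Rf α x b B (n+N) β ∂(muJ b B) ≤
      (∫ β, Rf α x b B n β ∂(muJ b B)) / 4 + K * (muJ b B).real univ := by
  have h := ce_le (α := α) (x := x) (integrable_Rf hd (n+N)) (φ := fun w => Rw α x b B n w / 4 + K)
    (hk n hn)
  rw [← integral_condExp (Fn_le α x n) (f := Rf α x b B (n+N))]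
  have i1 := integrable_Rf hd n
  calc _ ≤ ∫ β, (Rf α x b B n β / 4 + K) ∂(muJ b B) :=
        integral_mono_ae integrable_condExp ((i1.div_const 4).add (integrable_const K)) h
    _ = _ := by
        rw [integral_add (i1.div_const 4) (integrable_const K), integral_div, integral_const,
          smul_eq_mul, mul_comm K]

theorem intR_bdd (hd : Dat α x b B c) (hK : 0 < K) (hN : 0 < N) (hk : KeyC α x b B K N n₀) :
    ∃ V, ∀ n, ∫ β, Rf α x b B n β ∂(muJ b B) ≤ V := by
  set I : ℕ → ℝ := fun n => ∫ β, Rf α x b B n β ∂(muJ b B) with hI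
  have hI0 : ∀ n, 0 ≤ I n := fun n => integral_nonneg fun β => Rf_nonneg hd β
  set M := K * (muJ b B).real univ
  have hM : 0 ≤ M := mul_nonneg hK.le measureReal_nonneg
  refine ⟨∑ i ∈ Finset.range (n₀+N), I i + 2 * M, fun n => ?_⟩
  have hs : 0 ≤ ∑ i ∈ Finset.range (n₀+N), I i := Finset.sum_nonneg fun i _ => hI0 i
  induction n using Nat.strong_induction_on with
  | _ n ih =>
    by_cases h : n < n₀ + N
    · have := Finset.single_le_sum (f := I) (fun i _ => hI0 i) (Finset.mem_range.2 h)
      show I n ≤ _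
      linarith
    · obtain ⟨m, rfl⟩ := Nat.exists_eq_add_of_le' (show N ≤ n by omega)
      have h1 := intR_rec hd hk (n := m) (by omega)
      have h2 := ih m (by omega)
      show I (m+N) ≤ _
      have h1' : I (m+N) ≤ I m / 4 + M := h1
      have h2' : I m ≤ ∑ i ∈ Finset.range (n₀+N), I i + 2 * M := h2
      linarith

theorem stageA (hd : Dat α x b B c) (hK : 0 < K) (hN : 0 < N) (hk : KeyC α x b B K N n₀) :
    ∀ᵐ β ∂(muJ b B), ∀ ε > 0, ∀ᶠ k : ℕ in atTop,
      avg (fun m => Qf α x b B (m+n₀) β) (k^2) ≤ 2 * √K + ε := by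
  obtain ⟨V, hV⟩ := intR_bdd hd hK hN hk
  have h1 := slln_condExp (μ := muJ b B) (F := fun n => Fn α x (n+n₀)) (fun n => Fn_le α x _)
    (fun n m h => Fn_mono α x (by omega)) (f := fun m => Qf α x b B (m+n₀+N))
    (fun n => memLp_Qf hd _) (V := V) (fun n => by simp_rw [Qf_sq hd]; exact hV _) N
  have h2 : ∀ m, (muJ b B)[Qf α x b B (m+n₀+N) | Fn α x (m+N+n₀)] = Qf α x b B (m+n₀+N) := by
    intro m
    have e : m + N + n₀ = m + n₀ + N := by omega
    rw [e]
    refine condExp_of_stronglyMeasurable (Fn_le α x _) ?_ ((memLp_Qf hd _).integrable (by norm_num))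
    apply Measurable.stronglyMeasurable
    have : Qf α x b B (m+n₀+N) = (fun w => √(Rw α x b B (m+n₀+N) w)) ∘ Wd α x (m+n₀+N) := rfl
    rw [this]
    exact (measurable_of_countable _).comp (comap_measurable _)
  have h3 : ∀ᵐ β ∂(muJ b B), ∀ m, ((muJ b B)[Qf α x b B (m+n₀+N) | Fn α x (m+n₀)]) β ≤
      Qf α x b B (m+n₀) β / 2 + √K := by
    rw [ae_all_iff]
    intro m
    exact ce_le (α := α) (x := x) ((memLp_Qf hd _).integrable (by norm_num))
      (φ := fun w => √(Rw α x b B (m+n₀) w) / 2 + √K)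
      fun w hw => key_cell_Q hd hK w hw (hk _ (by omega) w hw)
  filter_upwards [h1, h3] with β h1 h3 ε hε
  simp only [h2] at h1
  set d : ℕ → ℝ := fun m => Qf α x b B (m+n₀+N) β -
    ((muJ b B)[Qf α x b B (m+n₀+N) | Fn α x (m+n₀)]) β with hd'
  set P : ℕ → ℝ := fun m => Qf α x b B (m+n₀) β with hP
  have hrec : ∀ m, P (m+N) ≤ P m / 2 + √K + d m := by
    intro m
    have e : m + N + n₀ = m + n₀ + N := by omega
    have := h3 m
    simp only [hP, hd', e]
    linarith
  have hP0 : ∀ m, 0 ≤ P m := fun m => Real.sqrt_nonneg _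
  have hsq : Tendsto (fun k : ℕ => ((k^2 : ℕ) : ℝ)) atTop atTop :=
    tendsto_natCast_atTop_atTop.comp (tendsto_pow_atTop (by norm_num))
  have t2 : Tendsto (fun k : ℕ => (∑ m ∈ Finset.range N, P m) / ((k^2 : ℕ) : ℝ)) atTop (𝓝 0) :=
    hsq.const_div_atTop _
  filter_upwards [h1.eventually_lt_const (show (0:ℝ) < ε/4 by linarith),
    t2.eventually_lt_const (show (0:ℝ) < ε/4 by linarith), eventually_gt_atTop 0] with k k1 k2 k3
  have := avg_rec hP0 hrec (n := k^2) (by positivity)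
  linarith
end


section
variable {α x b B c K : ℝ} {N n₀ n : ℕ}

theorem Cw_map_le (hd : Dat α x b B c) (hn : 2 ≤ n) (w : Fin n → ℕ) {β₀ : ℝ}
    (h0 : β₀ ∈ Cw α x b B n w) :
    (volume.restrict (Cw α x b B n w)).map (fun β => (Tab α β)^[n] x) ≤
      ENNReal.ofReal (1 / (c * aw α x b B n w ^ n)) • (volume.restrict (Icc (0:ℝ) 1)) := by
  have hb := hd.hb
  have hc := hd.hc
  have pa : 0 < aw α x b B n w := by linarith [le_aw h0]
  set a := aw α x b B n w with ha
  set ξ : ℝ → ℝ := fun β => (Tab α β)^[n] x with hξ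
  have hmξ : Measurable ξ := measurable_xi α x n
  set κ : ℝ≥0 := Real.toNNReal (1 / (c * a ^ n)) with hκ
  have hexp : ∀ β ∈ Cw α x b B n w, ∀ β' ∈ Cw α x b B n w, β ≤ β' →
      c * a ^ n * (β' - β) ≤ ξ β' - ξ β := by
    intro β h β' h' hle
    have h1 := hd.low β β' (by linarith [h.1.1]) hle h'.1.2.le n hn (Cw_same h h')
    refine le_trans ?_ h1
    have h2 : a ^ n ≤ β' ^ n := pow_le_pow_left₀ pa.le (aw_le h') n
    have h3 : 0 ≤ β' - β := by linarith
    calc c * a ^ n * (β' - β) ≤ c * β' ^ n * (β' - β) := by gcongr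
      _ = _ := by ring
  have hexp' : ∀ β ∈ Cw α x b B n w, ∀ β' ∈ Cw α x b B n w,
      |β' - β| ≤ 1 / (c * a ^ n) * |ξ β' - ξ β| := by
    intro β h β' h'
    wlog hle : β ≤ β' generalizing β β'
    · rw [abs_sub_comm, abs_sub_comm (ξ β')]
      exact this β' h' β h (le_of_not_ge hle)
    have := hexp β h β' h' hle
    rw [abs_of_nonneg (sub_nonneg.2 hle), div_mul_eq_mul_div, le_div_iff₀ (by positivity), one_mul]
    calc _ = c * a ^ n * (β' - β) := by ring
      _ ≤ _ := this
      _ ≤ _ := le_abs_self _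
  refine Measure.le_iff.2 fun A hA => ?_
  rw [Measure.map_apply hmξ hA, Measure.restrict_apply (hmξ hA), Measure.smul_apply,
    Measure.restrict_apply hA, smul_eq_mul]
  set S := ξ ⁻¹' A ∩ Cw α x b B n w with hS
  have hinj : InjOn ξ S := by
    intro β h β' h' heq
    have := hexp' β h.2 β' h'.2
    rw [heq, sub_self, abs_zero, mul_zero] at this
    have := abs_nonpos_iff.1 this
    linarith
  have himg : Function.invFunOn ξ S '' (ξ '' S) = S := by
    rw [image_image]
    exact (image_congr fun β hβ => hinj.leftInvOn_invFunOn hβ).trans (image_id S)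
  have hlip : LipschitzOnWith κ (Function.invFunOn ξ S) (ξ '' S) := by
    apply LipschitzOnWith.of_dist_le_mul
    rintro _ ⟨β, h, rfl⟩ _ ⟨β', h', rfl⟩
    rw [hinj.leftInvOn_invFunOn h, hinj.leftInvOn_invFunOn h', hκ, Real.coe_toNNReal _ (by positivity),
      Real.dist_eq, Real.dist_eq]
    exact hexp' β' h'.2 β h.2
  have h1 := hlip.hausdorffMeasure_image_le (d := 1) (by norm_num)
  rw [himg, hausdorffMeasure_real, ENNReal.rpow_one] at h1
  refine h1.trans ?_
  have h2 : ξ '' S ⊆ A ∩ Icc 0 1 := by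
    rintro _ ⟨β, h, rfl⟩
    exact ⟨h.1, Ico_subset_Icc_self (Tab_iter_mem hd.hx n)⟩
  exact mul_le_mul_right (measure_mono h2) _

theorem Cw_int_le (hd : Dat α x b B c) (hn : 2 ≤ n) (w : Fin n → ℕ)
    (hℓ : 0 < volume.real (Cw α x b B n w)) {g : ℝ → ℝ} (hg : Continuous g)
    (hg01 : ∀ y, 0 ≤ g y ∧ g y ≤ 1) :
    ∫ β in Cw α x b B n w, g ((Tab α β)^[n] x) ≤
      (√((∫ y in Icc (0:ℝ) 1, g y) / c) * √(Rw α x b B n w)) * volume.real (Cw α x b B n w) := by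
  have hb := hd.hb
  have hc := hd.hc
  obtain ⟨β₀, h0⟩ : (Cw α x b B n w).Nonempty := by
    by_contra h
    rw [not_nonempty_iff_eq_empty] at h
    rw [h] at hℓ
    simp at hℓ
  have pa : 0 < aw α x b B n w := by linarith [le_aw h0]
  have hmξ := measurable_xi α x n
  set G := ∫ y in Icc (0:ℝ) 1, g y with hG
  have hG0 : 0 ≤ G := integral_nonneg fun y => (hg01 y).1
  have hgi : Integrable g (volume.restrict (Icc (0:ℝ) 1)) := hg.continuousOn.integrableOn_Icc
  have h1 : ∫ β in Cw α x b B n w, g ((Tab α β)^[n] x) ≤ 1 / (c * aw α x b B n w ^ n) * G := by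
    have e : ∫ β in Cw α x b B n w, g ((Tab α β)^[n] x) =
        ∫ y, g y ∂((volume.restrict (Cw α x b B n w)).map (fun β => (Tab α β)^[n] x)) :=
      (integral_map hmξ.aemeasurable hg.aestronglyMeasurable).symm
    rw [e]
    refine (integral_mono_measure (Cw_map_le hd hn w h0) (Eventually.of_forall fun y => (hg01 y).1)
      (hgi.smul_measure ENNReal.ofReal_ne_top)).trans ?_
    rw [integral_smul_measure, ENNReal.toReal_ofReal (by positivity), smul_eq_mul]
  have h2 : ∫ β in Cw α x b B n w, g ((Tab α β)^[n] x) ≤ volume.real (Cw α x b B n w) := by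
    have ic : IntegrableOn (fun _ => (1:ℝ)) (Cw α x b B n w) := integrableOn_const Cw_fin
    have := integral_mono_of_nonneg (μ := volume.restrict (Cw α x b B n w))
      (f := fun β => g ((Tab α β)^[n] x)) (g := fun _ => (1:ℝ))
      (Eventually.of_forall fun β => (hg01 _).1) ic (Eventually.of_forall fun β => (hg01 _).2)
    rw [setIntegral_const] at this
    simpa using this
  have h3 : 0 ≤ ∫ β in Cw α x b B n w, g ((Tab α β)^[n] x) := integral_nonneg fun β => (hg01 _).1
  set I := ∫ β in Cw α x b B n w, g ((Tab α β)^[n] x)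
  have hR := Rw_nonneg hd w
  have e2 : Rw α x b B n w * volume.real (Cw α x b B n w) = 1 / aw α x b B n w ^ n := by
    unfold Rw; field_simp
  set ℓ := volume.real (Cw α x b B n w)
  refine le_of_sq_le_sq ?_ (by positivity)
  rw [mul_pow, mul_pow, Real.sq_sqrt (by positivity), Real.sq_sqrt hR]
  calc I ^ 2 = I * I := sq I
    _ ≤ (1 / (c * aw α x b B n w ^ n) * G) * ℓ := mul_le_mul h1 h2 h3 (by positivity)
    _ = G / c * (1 / aw α x b B n w ^ n) * ℓ := by field_simp
    _ = _ := by rw [← e2]; ring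

theorem osc_le (hd : Dat α x b B c) (hn : 2 ≤ n) (q : ℕ) {w : Fin (n+q) → ℕ} {β β' : ℝ}
    (h : β ∈ Cw α x b B (n+q) w) (h' : β' ∈ Cw α x b B (n+q) w) :
    |(Tab α β')^[n] x - (Tab α β)^[n] x| ≤ 1 / (c * (b-1)) / b ^ q := by
  wlog hle : β ≤ β' generalizing β β'
  · rw [abs_sub_comm]; exact this h' h (le_of_not_ge hle)
  have hb := hd.hb
  have hc := hd.hc
  have pb1 : 0 < b - 1 := by linarith
  have pb : 0 < b := by linarith
  have hβ' : b < β' := h'.1.1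
  have pβ' : 0 < β' := by linarith
  have hx' : x ∈ Icc (0:ℝ) 1 := ⟨hd.hx.1, hd.hx.2.le⟩
  have hs := (Cw_same h h').mono (show n ≤ n + q by omega)
  have m := xi_mono hd.hα.1 hx' (by linarith [h.1.1]) hle n hs
  rw [abs_of_nonneg (by linarith)]
  have u := xi_upper' hd.hα.1 hx' hb h.1.1.le hle n hs
  have dd := Cw_diff hd (show 2 ≤ n + q by omega) h h'
  refine u.trans ?_
  calc (β' - β) * β' ^ n / (b-1) ≤ 1 / (c * β' ^ (n+q)) * β' ^ n / (b-1) := by gcongr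
    _ = 1 / (c * (b-1)) / β' ^ q := by rw [pow_add]; field_simp
    _ ≤ _ := by gcongr

theorem ce_ge (hd : Dat α x b B c) (hn : 2 ≤ n) {g : ℝ → ℝ} (hg : Continuous g)
    (hg01 : ∀ y, 0 ≤ g y ∧ g y ≤ 1) {q : ℕ} {ε : ℝ}
    (hq : ∀ y ∈ Icc (0:ℝ) 1, ∀ y' ∈ Icc (0:ℝ) 1, |y' - y| ≤ 1 / (c * (b-1)) / b ^ q → g y' ≤ g y + ε) :
    ∀ᵐ β ∂(muJ b B), g ((Tab α β)^[n] x) ≤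
      ((muJ b B)[fun β => g ((Tab α β)^[n] x) | Fn α x (n+q)]) β + ε := by
  set f : ℝ → ℝ := fun β => g ((Tab α β)^[n] x) with hf
  have hfm : Measurable f := hg.measurable.comp (measurable_xi α x n)
  have hfi : ∀ (ν : Measure ℝ) [IsFiniteMeasure ν], Integrable f ν := fun ν _ =>
    Integrable.of_bound hfm.aestronglyMeasurable 1 (Eventually.of_forall fun β => by
      rw [Real.norm_eq_abs, abs_of_nonneg (hg01 _).1]; exact (hg01 _).2)
  set φ : (Fin (n+q) → ℕ) → ℝ := fun w => - (sSup (f '' Cw α x b B (n+q) w)) + ε with hφ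
  have hbdd : ∀ w, BddAbove (f '' Cw α x b B (n+q) w) := by
    intro w
    refine ⟨1, ?_⟩
    rintro _ ⟨β, _, rfl⟩
    exact (hg01 _).2
  have h1 := ce_le (α := α) (x := x) (n := n+q) (hfi (muJ b B)).neg (φ := φ) (by
    intro w hw
    have hne : (Cw α x b B (n+q) w).Nonempty := by
      by_contra h
      rw [not_nonempty_iff_eq_empty] at h
      rw [h] at hw
      simp at hw
    haveI : IsFiniteMeasure (volume.restrict (Cw α x b B (n+q) w)) :=
      ⟨by rw [Measure.restrict_apply_univ]; exact Cw_fin.lt_top⟩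
    have hpt : ∀ u ∈ Cw α x b B (n+q) w, (-f) u ≤ φ w := by
      intro u hu
      have : sSup (f '' Cw α x b B (n+q) w) ≤ f u + ε := by
        refine csSup_le (hne.image f) ?_
        rintro _ ⟨v, hv, rfl⟩
        exact hq _ (Ico_subset_Icc_self (Tab_iter_mem hd.hx n)) _
          (Ico_subset_Icc_self (Tab_iter_mem hd.hx n)) (osc_le hd hn q hu hv)
      simp only [Pi.neg_apply, hφ]
      linarith
    calc ∫ u in Cw α x b B (n+q) w, (-f) u ≤ ∫ u in Cw α x b B (n+q) w, φ w :=
          setIntegral_mono_on (hfi _).neg (integrable_const _) (measurableSet_Cw _ _ _ _ _ _) hpt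
      _ = _ := by rw [setIntegral_const, smul_eq_mul, mul_comm])
  have h2 := condExp_neg (μ := muJ b B) f (Fn α x (n+q))
  have h3 : ∀ᵐ β ∂(muJ b B), β ∈ Ioo b B := ae_restrict_mem measurableSet_Ioo
  filter_upwards [h1, h2, h3] with β h1 h2 h3
  rw [h2] at h1
  simp only [Pi.neg_apply, hφ] at h1
  have : f β ≤ sSup (f '' Cw α x b B (n+q) (Wd α x (n+q) β)) :=
    le_csSup (hbdd _) ⟨β, ⟨h3, rfl⟩, rfl⟩
  linarith

theorem stageB (hd : Dat α x b B c) (hn₀ : 2 ≤ n₀)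
    {g : ℝ → ℝ} (hg : Continuous g) (hg01 : ∀ y, 0 ≤ g y ∧ g y ≤ 1)
    (hA : ∀ᵐ β ∂(muJ b B), ∀ ε > 0, ∀ᶠ k : ℕ in atTop,
      avg (fun m => Qf α x b B (m+n₀) β) (k^2) ≤ 2 * √K + ε) :
    ∀ᵐ β ∂(muJ b B), ∀ ε > 0, ∀ᶠ k : ℕ in atTop,
      avg (fun m => g ((Tab α β)^[m+n₀] x)) (k^2) ≤
        √((∫ y in Icc (0:ℝ) 1, g y) / c) * (2 * √K) + ε := by
  have hb := hd.hb
  set s := √((∫ y in Icc (0:ℝ) 1, g y) / c) with hs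
  have hs0 : 0 ≤ s := Real.sqrt_nonneg _
  have main : ∀ j : ℕ, ∀ᵐ β ∂(muJ b B), ∀ᶠ k : ℕ in atTop,
      avg (fun m => g ((Tab α β)^[m+n₀] x)) (k^2) ≤ s * (2 * √K) + (2 + s) * (1 / ((j:ℝ)+1)) := by
    intro j
    set ε : ℝ := 1 / ((j:ℝ)+1) with hε
    have hε0 : 0 < ε := by positivity
    obtain ⟨q, hq⟩ : ∃ q : ℕ, ∀ y ∈ Icc (0:ℝ) 1, ∀ y' ∈ Icc (0:ℝ) 1,
        |y' - y| ≤ 1 / (c * (b-1)) / b ^ q → g y' ≤ g y + ε := by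
      have huc : UniformContinuousOn g (Icc (0:ℝ) 1) :=
        isCompact_Icc.uniformContinuousOn_of_continuous hg.continuousOn
      rw [Metric.uniformContinuousOn_iff] at huc
      obtain ⟨δ, hδ, h⟩ := huc ε hε0
      have ht : Tendsto (fun q : ℕ => 1 / (c * (b-1)) / b ^ q) atTop (𝓝 0) :=
        (tendsto_pow_atTop_atTop_of_one_lt hb).const_div_atTop _
      obtain ⟨q, hq⟩ := (ht.eventually_lt_const hδ).exists
      refine ⟨q, fun y hy y' hy' hyy => ?_⟩
      have := h y' hy' y hy (by rw [Real.dist_eq]; linarith)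
      rw [Real.dist_eq] at this
      linarith [(abs_lt.1 this).2]
    have hfm : ∀ m, Measurable (fun β => g ((Tab α β)^[m+n₀] x)) := fun m =>
      hg.measurable.comp (measurable_xi α x _)
    have hfi : ∀ m, MemLp (fun β => g ((Tab α β)^[m+n₀] x)) 2 (muJ b B) := fun m =>
      MemLp.of_bound (hfm m).aestronglyMeasurable 1 (Eventually.of_forall fun β => by
        rw [Real.norm_eq_abs, abs_of_nonneg (hg01 _).1]; exact (hg01 _).2)
    have h1 := slln_condExp (μ := muJ b B) (F := fun n => Fn α x (n+n₀)) (fun n => Fn_le α x _)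
      (fun n m h => Fn_mono α x (by omega)) hfi (V := (muJ b B).real univ) (fun n => by
        have := integral_mono_of_nonneg (μ := muJ b B)
          (f := fun β => g ((Tab α β)^[n+n₀] x) ^ 2) (g := fun _ => (1:ℝ))
          (Eventually.of_forall fun β => sq_nonneg _) (integrable_const _)
          (Eventually.of_forall fun β => by
            show g ((Tab α β)^[n+n₀] x) ^ 2 ≤ 1
            have := hg01 ((Tab α β)^[n+n₀] x)
            nlinarith)
        rw [integral_const] at this
        simpa using this) q
    have h2 : ∀ᵐ β ∂(muJ b B), ∀ m, g ((Tab α β)^[m+n₀] x) ≤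
        ((muJ b B)[fun β => g ((Tab α β)^[m+n₀] x) | Fn α x (m+q+n₀)]) β + ε := by
      rw [ae_all_iff]
      intro m
      have e : m + q + n₀ = m + n₀ + q := by omega
      rw [e]
      exact ce_ge hd (by omega) hg hg01 hq
    have h3 : ∀ᵐ β ∂(muJ b B), ∀ m,
        ((muJ b B)[fun β => g ((Tab α β)^[m+n₀] x) | Fn α x (m+n₀)]) β ≤
          s * Qf α x b B (m+n₀) β := by
      rw [ae_all_iff]
      intro m
      exact ce_le (α := α) (x := x) ((hfi m).integrable (by norm_num))
        (φ := fun w => s * √(Rw α x b B (m+n₀) w))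
        fun w hw => Cw_int_le hd (by omega) w hw hg hg01
    filter_upwards [h1, h2, h3, hA] with β h1 h2 h3 hA
    filter_upwards [h1.eventually_lt_const hε0, hA ε hε0, eventually_gt_atTop 0] with k k1 k2 k3
    set d : ℕ → ℝ := fun m =>
      ((muJ b B)[fun β => g ((Tab α β)^[m+n₀] x) | Fn α x (m+q+n₀)]) β -
      ((muJ b B)[fun β => g ((Tab α β)^[m+n₀] x) | Fn α x (m+n₀)]) β with hdd
    have hk : (0:ℝ) < ((k^2 : ℕ) : ℝ) := by positivity
    have h4 : avg (fun m => g ((Tab α β)^[m+n₀] x)) (k^2) ≤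
        avg d (k^2) + s * avg (fun m => Qf α x b B (m+n₀) β) (k^2) + ε := by
      have : ∑ m ∈ Finset.range (k^2), g ((Tab α β)^[m+n₀] x) ≤
          ∑ m ∈ Finset.range (k^2), (d m + s * Qf α x b B (m+n₀) β + ε) :=
        Finset.sum_le_sum fun m _ => by
          have a1 := h2 m
          have a2 := h3 m
          simp only [hdd]
          linarith
      rw [Finset.sum_add_distrib, Finset.sum_add_distrib, ← Finset.mul_sum, Finset.sum_const,
        Finset.card_range, nsmul_eq_mul] at this
      unfold avg
      calc _ ≤ ((k^2 : ℕ) : ℝ)⁻¹ * _ := mul_le_mul_of_nonneg_left this (by positivity)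
        _ = _ := by field_simp
    have h5 : s * avg (fun m => Qf α x b B (m+n₀) β) (k^2) ≤ s * (2 * √K + ε) := by gcongr
    have k1' : avg d (k^2) < ε := k1
    linarith
  filter_upwards [ae_all_iff.2 main] with β h ε hε
  have : Tendsto (fun j : ℕ => (2 + s) * (1 / ((j:ℝ)+1))) atTop (𝓝 ((2+s) * 0)) :=
    tendsto_one_div_add_atTop_nhds_zero_nat.const_mul _
  rw [mul_zero] at this
  obtain ⟨j, hj⟩ := (this.eventually_lt_const hε).exists
  filter_upwards [h j] with k hk
  linarith

end


theorem avg_interp {u : ℕ → ℝ} (hu : ∀ m, 0 ≤ u m ∧ u m ≤ 1) {n₀ : ℕ} {A : ℝ}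
    (h : ∀ ε > 0, ∀ᶠ k : ℕ in atTop, avg (fun m => u (m+n₀)) (k^2) ≤ A + ε) :
    ∀ ε > 0, ∀ᶠ n : ℕ in atTop, avg u n ≤ A + ε := by
  intro ε hε
  have hs : Tendsto Nat.sqrt atTop atTop := by
    refine tendsto_atTop.2 fun k => ?_
    filter_upwards [eventually_ge_atTop (k*k)] with n hn
    exact Nat.le_sqrt.2 hn
  have t1 : Tendsto (fun k : ℕ => ((n₀:ℝ) + 2) * (1 / (k:ℝ))) atTop (𝓝 (((n₀:ℝ)+2) * 0)) :=
    tendsto_one_div_atTop_nhds_zero_nat.const_mul _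
  rw [mul_zero] at t1
  filter_upwards [hs.eventually (h (ε/2) (by linarith)),
    hs.eventually (t1.eventually_lt_const (show (0:ℝ) < ε/2 by linarith)),
    hs.eventually (eventually_gt_atTop 0)] with n h1 h2 h3
  set k := Nat.sqrt n with hk
  have hkn : k * k ≤ n := Nat.sqrt_le n
  have hnk : n ≤ k * k + k + k := Nat.sqrt_le_add n
  have e1 : ∑ m ∈ Finset.range n, u m ≤ n₀ + ∑ m ∈ Finset.range (k^2), u (m+n₀) + 2 * k := by
    calc ∑ m ∈ Finset.range n, u m ≤ ∑ m ∈ Finset.range (n₀ + k^2 + 2*k), u m :=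
          Finset.sum_le_sum_of_subset_of_nonneg (by
            intro m hm; rw [Finset.mem_range] at *; nlinarith) fun m _ _ => (hu m).1
      _ = ∑ m ∈ Finset.range n₀, u m + ∑ m ∈ Finset.range (k^2), u (m+n₀) +
          ∑ m ∈ Finset.range (2*k), u (n₀ + k^2 + m) := by
          rw [Finset.sum_range_add, Finset.sum_range_add]
          simp only [add_comm]
      _ ≤ _ := by
          have a1 : ∑ m ∈ Finset.range n₀, u m ≤ n₀ := by
            have := Finset.sum_le_card_nsmul (Finset.range n₀) u 1 fun m _ => (hu m).2
            simpa using this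
          have a2 : ∑ m ∈ Finset.range (2*k), u (n₀ + k^2 + m) ≤ 2 * k := by
            have := Finset.sum_le_card_nsmul (Finset.range (2*k)) (fun m => u (n₀ + k^2 + m)) 1
              fun m _ => (hu _).2
            simpa using this
          linarith
  have hk0 : (0:ℝ) < k := by exact_mod_cast h3
  have hk1 : (1:ℝ) ≤ k := by exact_mod_cast h3
  have hn : ((k:ℝ)^2) ≤ n := by
    have : k^2 ≤ n := by nlinarith
    exact_mod_cast this
  have hs0 : 0 ≤ ∑ m ∈ Finset.range (k^2), u (m+n₀) := Finset.sum_nonneg fun m _ => (hu _).1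
  have e2 : avg u n ≤ ((k:ℝ)^2)⁻¹ * (n₀ + ∑ m ∈ Finset.range (k^2), u (m+n₀) + 2 * k) := by
    unfold avg
    have : 0 ≤ ∑ m ∈ Finset.range n, u m := Finset.sum_nonneg fun m _ => (hu _).1
    gcongr
  have e3 : ((k:ℝ)^2)⁻¹ * (n₀ + ∑ m ∈ Finset.range (k^2), u (m+n₀) + 2 * k) =
      avg (fun m => u (m+n₀)) (k^2) + ((k:ℝ)^2)⁻¹ * (n₀ + 2 * k) := by
    unfold avg; push_cast; ring
  have e4 : ((k:ℝ)^2)⁻¹ * (n₀ + 2 * k) ≤ ((n₀:ℝ) + 2) * (1 / (k:ℝ)) := by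
    have : (n₀:ℝ) + 2 * k ≤ (n₀ + 2) * k := by nlinarith [Nat.cast_nonneg (α := ℝ) n₀]
    calc _ ≤ ((k:ℝ)^2)⁻¹ * ((n₀ + 2) * k) := by gcongr
      _ = _ := by field_simp
  linarith

/-- A countable family of test functions. -/
noncomputable def tf (j : ℕ) (y : ℝ) : ℝ :=
  max 0 (min 1 (TopologicalSpace.denseSeq C(Icc (0:ℝ) 1, ℝ) j (projIcc 0 1 zero_le_one y)))

theorem tf_cont (j : ℕ) : Continuous (tf j) := by
  unfold tf
  exact continuous_const.max (continuous_const.min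
    ((ContinuousMap.continuous _).comp continuous_projIcc))

theorem tf_01 (j : ℕ) (y : ℝ) : 0 ≤ tf j y ∧ tf j y ≤ 1 :=
  ⟨le_max_left _ _, max_le zero_le_one (min_le_left _ _)⟩

theorem tf_dense {g : ℝ → ℝ} (hg : Continuous g) (hg01 : ∀ y, 0 ≤ g y ∧ g y ≤ 1) {ε : ℝ}
    (hε : 0 < ε) : ∃ j, ∀ y ∈ Icc (0:ℝ) 1, g y ≤ tf j y + ε ∧ tf j y ≤ g y + ε := by
  set G : C(Icc (0:ℝ) 1, ℝ) := ⟨fun y => g y, by fun_prop⟩ with hG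
  obtain ⟨j, hj⟩ := (TopologicalSpace.denseRange_denseSeq C(Icc (0:ℝ) 1, ℝ)).exists_dist_lt G hε
  refine ⟨j, fun y hy => ?_⟩
  have h1 := (ContinuousMap.dist_apply_le_dist (f := G)
    (g := TopologicalSpace.denseSeq C(Icc (0:ℝ) 1, ℝ) j) ⟨y, hy⟩).trans_lt hj
  unfold tf
  rw [projIcc_of_mem zero_le_one hy]
  rw [Real.dist_eq, abs_lt] at h1
  have e : G ⟨y, hy⟩ = g y := rfl
  rw [e] at h1
  obtain ⟨h2, h3⟩ := h1
  obtain ⟨h4, h5⟩ := hg01 y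
  constructor
  · rcases le_total 1 (TopologicalSpace.denseSeq C(Icc (0:ℝ) 1, ℝ) j ⟨y, hy⟩) with h | h
    · rw [min_eq_left h]; linarith [le_max_right (0:ℝ) 1]
    · rw [min_eq_right h]
      linarith [le_max_right (0:ℝ) (TopologicalSpace.denseSeq C(Icc (0:ℝ) 1, ℝ) j ⟨y, hy⟩)]
  · refine max_le (by linarith) ((min_le_right _ _).trans (by linarith))

theorem ACx_of_tf {α β x C : ℝ} (hx : x ∈ Ico (0:ℝ) 1) (hC : 0 ≤ C)
    (h : ∀ j, ∀ ε > 0, ∀ᶠ n : ℕ in atTop,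
      avg (fun m => tf j ((Tab α β)^[m] x)) n ≤ C * √(∫ y in Icc (0:ℝ) 1, tf j y) + ε) :
    ACx α β x := by
  refine ⟨C, hC, fun g hg hg01 ε hε => ?_⟩
  obtain ⟨e, he0, he⟩ : ∃ e > 0, C * √e + 2 * e < ε := by
    have : Tendsto (fun e : ℝ => C * √e + 2 * e) (𝓝[>] 0) (𝓝 0) := by
      have : Continuous (fun e : ℝ => C * √e + 2 * e) := by fun_prop
      have := (this.tendsto 0).mono_left (nhdsWithin_le_nhds (s := Ioi 0))
      simpa using this
    obtain ⟨e, h1, h2⟩ := ((this.eventually_lt_const hε).and self_mem_nhdsWithin).exists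
    exact ⟨e, h2, h1⟩
  obtain ⟨j, hj⟩ := tf_dense hg hg01 he0
  have hG0 : 0 ≤ ∫ y in Icc (0:ℝ) 1, g y := integral_nonneg fun y => (hg01 y).1
  have hint : ∫ y in Icc (0:ℝ) 1, tf j y ≤ (∫ y in Icc (0:ℝ) 1, g y) + e := by
    have ig : IntegrableOn g (Icc 0 1) := hg.continuousOn.integrableOn_Icc
    have ic : IntegrableOn (fun _ => e) (Icc (0:ℝ) 1) := by simp
    calc _ ≤ ∫ y in Icc (0:ℝ) 1, (g y + e) :=
          setIntegral_mono_on (tf_cont j).continuousOn.integrableOn_Icc (ig.add ic)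
            measurableSet_Icc fun y hy => (hj y hy).2
      _ = _ := by rw [integral_add ig ic]; simp
  have hsq : √(∫ y in Icc (0:ℝ) 1, tf j y) ≤ √(∫ y in Icc (0:ℝ) 1, g y) + √e :=
    (Real.sqrt_le_sqrt hint).trans (by
      rw [Real.sqrt_le_iff]
      refine ⟨by positivity, ?_⟩
      nlinarith [Real.sq_sqrt hG0, Real.sq_sqrt he0.le,
        mul_nonneg (Real.sqrt_nonneg (∫ y in Icc (0:ℝ) 1, g y)) (Real.sqrt_nonneg e)])
  filter_upwards [h j e he0, eventually_gt_atTop 0] with n hn hn0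
  have hn0' : (0:ℝ) < n := by exact_mod_cast hn0
  have h1 : avg (fun m => g ((Tab α β)^[m] x)) n ≤ avg (fun m => tf j ((Tab α β)^[m] x)) n + e := by
    unfold avg
    have : ∑ m ∈ Finset.range n, g ((Tab α β)^[m] x) ≤
        ∑ m ∈ Finset.range n, (tf j ((Tab α β)^[m] x) + e) :=
      Finset.sum_le_sum fun m _ => (hj _ (Ico_subset_Icc_self (Tab_iter_mem hx m))).1
    rw [Finset.sum_add_distrib, Finset.sum_const, Finset.card_range, nsmul_eq_mul] at this
    calc _ ≤ (n:ℝ)⁻¹ * _ := mul_le_mul_of_nonneg_left this (by positivity)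
      _ = _ := by field_simp
  have h2 := mul_le_mul_of_nonneg_left hsq hC
  linarith

theorem local_AC {α x β₀ : ℝ} (hα : α ∈ Ico (0:ℝ) 1) (hx : x ∈ Ico (0:ℝ) 1) (hxα : (x, α) ≠ (0,0))
    (hβ₀ : 1 < β₀) (hg : GenericB α β₀) :
    ∃ b B : ℝ, β₀ ∈ Ioo b B ∧ ∀ᵐ β ∂(muJ b B), ACx α β x := by
  obtain ⟨b₀, hb₀, hb₀'⟩ := exists_between hβ₀
  obtain ⟨N, hN0, hN⟩ : ∃ N : ℕ, 0 < N ∧ 2 / b₀ ^ N ≤ 1/4 := by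
    have ht : Tendsto (fun q : ℕ => 2 / b₀ ^ q) atTop (𝓝 0) :=
      (tendsto_pow_atTop_atTop_of_one_lt hb₀).const_div_atTop _
    obtain ⟨N, h1, h2⟩ := ((ht.eventually_lt_const (show (0:ℝ) < 1/4 by norm_num)).and
      (eventually_gt_atTop 0)).exists
    exact ⟨N, h2, h1.le⟩
  obtain ⟨b, B, η, h1, h2, h3, h4, h5, h6, h7⟩ := exists_endConst hα hβ₀ hg N hb₀'
    (show β₀ < β₀ + 1 by linarith)
  obtain ⟨c, hc, hlow⟩ := xi_lower hα ⟨hx.1, hx.2.le⟩ hxα (show 1 < B by linarith)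
  have hb : 1 < b := by linarith
  have hd : Dat α x b B c := ⟨hα, hx, hb, by linarith, hc, hlow⟩
  have hN' : 2 / b ^ N ≤ 1/4 := by
    refine le_trans ?_ hN
    have : 0 < b₀ := by linarith
    gcongr
  obtain ⟨L, hL⟩ := exists_nat_ge (B+1)
  have hB1 : 0 < (B+1)^N := by
    have : 0 < B + 1 := by linarith
    positivity
  obtain ⟨δ, hδ, hδη⟩ : ∃ δ > 0, (B+1)^N * δ < η := by
    refine ⟨η / (2 * (B+1)^N), by positivity, ?_⟩
    have : (B+1)^N * (η / (2 * (B+1)^N)) = η / 2 := by field_simp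
    linarith
  obtain ⟨n₁, hn₁⟩ : ∃ n₁ : ℕ, ∀ n ≥ n₁, 1 / (c * b ^ n) ≤ δ := by
    have ht : Tendsto (fun q : ℕ => (1/c) / b ^ q) atTop (𝓝 0) :=
      (tendsto_pow_atTop_atTop_of_one_lt hb).const_div_atTop _
    obtain ⟨n₁, h⟩ := eventually_atTop.1 (ht.eventually_lt_const hδ)
    refine ⟨n₁, fun n hn => ?_⟩
    have := h n hn
    rw [div_div] at this
    exact this.le
  set n₀ := n₁ + 2 with hn₀
  set K : ℝ := L ^ N * (Dc b c / (δ * (b-1))) with hKdef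
  have hL0 : (0:ℝ) < L := by linarith
  have pb1 : 0 < b - 1 := by linarith
  have pD : 0 < Dc b c := Real.exp_pos _
  have hK : 0 < K := by positivity
  have hk : KeyC α x b B K N n₀ := fun n hn w hw =>
    key_cell hd h7 h6 hδ hδη hN' hL (by omega) (hn₁ n (by omega)) w hw
  have hA := stageA hd hK hN0 hk
  refine ⟨b, B, ⟨h2, h3⟩, ?_⟩
  have hB := ae_all_iff.2 fun j => stageB (K := K) (n₀ := n₀) hd (by omega) (tf_cont j) (tf_01 j) hA
  filter_upwards [hB] with β hβ
  refine ACx_of_tf hx (C := 2 * √K / √c) (by positivity) fun j => ?_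
  have e : 2 * √K / √c * √(∫ y in Icc (0:ℝ) 1, tf j y) =
      √((∫ y in Icc (0:ℝ) 1, tf j y) / c) * (2 * √K) := by
    rw [Real.sqrt_div (integral_nonneg fun y => (tf_01 j y).1)]
    ring
  rw [e]
  exact avg_interp (u := fun m => tf j ((Tab α β)^[m] x)) (fun m => tf_01 j _) (hβ j)

theorem global_AC {α x : ℝ} (hα : α ∈ Ico (0:ℝ) 1) (hx : x ∈ Ico (0:ℝ) 1) (hxα : (x, α) ≠ (0,0)) :
    ∀ᵐ β ∂(volume.restrict (Ioi (1:ℝ))), ACx α β x := by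
  have h0 : volume {β : ℝ | 1 < β ∧ GenericB α β ∧ ¬ ACx α β x} = 0 := by
    refine measure_null_of_locally_null _ fun β₀ h => ?_
    obtain ⟨b, B, hm, hae⟩ := local_AC hα hx hxα h.1 h.2.1
    refine ⟨Ioo b B ∩ {β : ℝ | 1 < β ∧ GenericB α β ∧ ¬ ACx α β x},
      inter_mem (mem_nhdsWithin_of_mem_nhds (Ioo_mem_nhds hm.1 hm.2)) self_mem_nhdsWithin, ?_⟩
    · rw [ae_restrict_iff' measurableSet_Ioo] at hae
      refine measure_mono_null ?_ (ae_iff.1 hae)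
      rintro β ⟨h1, h2⟩ h3
      exact h2.2.2 (h3 h1)
  have h1 : volume {β : ℝ | 1 < β ∧ ¬ GenericB α β} = 0 :=
    (countable_nongeneric hα).measure_zero _
  rw [ae_restrict_iff' measurableSet_Ioi, ae_iff]
  refine measure_mono_null ?_ (measure_union_null h0 h1)
  intro β hβ
  rw [mem_ofPred_eq] at hβ
  push Not at hβ
  by_cases hg : GenericB α β
  · exact Or.inl ⟨hβ.1, hg, hβ.2⟩
  · exact Or.inr ⟨hβ.1, hg⟩


end Helpers

/-- For `x, α ∈ [0,1)` with `(x,α) ≠ (0,0)`, for Lebesgue-a.e. `β ∈ (1,∞)` the orbit of the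
coding sequence `i^{α,β}(x)` under the left shift equidistributes towards the pushforward of
the Parry measure under the coding map. -/
theorem orbit_code_equidistributes_ae (x α : ℝ) (hx : x ∈ Set.Ico (0 : ℝ) 1)
    (hα : α ∈ Set.Ico (0 : ℝ) 1) (hxα : (x, α) ≠ (0, 0)) :
    ∀ᵐ β ∂(volume.restrict (Set.Ioi (1 : ℝ))),
      ∀ f : BoundedContinuousFunction (ℕ → ℕ) ℝ,
        Tendsto (fun n : ℕ => (n : ℝ)⁻¹ * ∑ m ∈ Finset.range n, f (shiftN^[m] (code α β x)))
          atTop (nhds (∫ y, f y ∂((parryMeasure α β).map (code α β)))) := by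
  filter_upwards [global_AC hα hx hxα, ae_restrict_mem measurableSet_Ioi] with β h h1 f
  exact equi_of_AC hα h1 hx h f
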